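/- Assume the Reissner–Nordström radial setup and the notion of Dirichlet eigenvalue stated in the context. Let p ≥ 2 be an integer, C₁ > 0, S₀ > 0 sufficiently large, and δ ∈ (0, 1). There exists C > 0, depending only on δ, S₀, p, C₁, M, 𝐞, m, such that for all sufficiently large integers L the following holds. Suppose ω ∈ (0, m) satisfies L^{−p} ≤ m² − ω² ≤ C₁·L^{−2}, and suppose that every Dirichlet eigenvalue λ ≤ 0 at level (L, S₀) satisfies |m² − ω² + λ| ≥ e^{−(1/2)·𝕃·log 𝕃}. Then every weakly outgoing C² solution u of u'' − V(ω, L, ·)·u = H satisfies ∫_{−∞}^{2S₀} [ (r/(r − r₊))·|u' + iωu|² + (max(0, −s)^{1+δ} + 1)⁻¹·(|u'|² + |u|²) ] ds ≤ C·𝕃²·∫_{−∞}^{∞} (r/(r − r₊))·|H|² ds. -/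

import Mathlib

open MeasureTheory Filter Set

/-- The radial Klein–Gordon potential on a subextremal Reissner–Nordström exterior,
expressed in the tortoise-type coordinate `s` via the inverse map `rofs = r(s)`. -/
noncomputable def Vpot (M m E : ℝ) (rofs : ℝ → ℝ) (ω : ℝ) (L : ℕ) (s : ℝ) : ℝ :=
  -ω ^ 2 + (1 - 2 * M / rofs s + E ^ 2 / rofs s ^ 2) *
    (m ^ 2 + ((L : ℝ) * ((L : ℝ) + 1)) / rofs s ^ 2 +
      (2 * M * rofs s - 2 * E ^ 2) / rofs s ^ 4)

/-- `u` is weakly outgoing: `u ∼ c·e^{−iωs}` (with its derivative) as `s → −∞`, and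
`u` together with `u'` decays exponentially as `s → +∞`. -/
def WeaklyOutgoing (ω : ℝ) (u : ℝ → ℂ) : Prop :=
  (∃ c : ℂ,
    Filter.Tendsto (fun s : ℝ => u s - c * Complex.exp (-Complex.I * (ω : ℂ) * (s : ℂ)))
      Filter.atBot (nhds 0) ∧
    Filter.Tendsto (fun s : ℝ =>
        deriv u s + Complex.I * (ω : ℂ) * c * Complex.exp (-Complex.I * (ω : ℂ) * (s : ℂ)))
      Filter.atBot (nhds 0)) ∧
  ∃ ε : ℝ, 0 < ε ∧
    Filter.Tendsto (fun s : ℝ => Real.exp (ε * s) * (‖u s‖ + ‖deriv u s‖))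
      Filter.atTop (nhds 0)

/-- The omega-independent reference potential W0(s) = V(w,L,s) + w^2 - m^2. -/
noncomputable def W0 (M m E : ℝ) (rofs : ℝ → ℝ) (L : ℕ) (s : ℝ) : ℝ :=
  (1 - 2 * M / rofs s + E ^ 2 / rofs s ^ 2) *
    (m ^ 2 + ((L : ℝ) * ((L : ℝ) + 1)) / rofs s ^ 2 +
      (2 * M * rofs s - 2 * E ^ 2) / rofs s ^ 4) - m ^ 2

/-- lam is a Dirichlet eigenvalue at level (L, S0) of -d^2/ds^2 + W0 on (S0, inf). -/
def IsDirichletEV (M m E : ℝ) (rofs : ℝ → ℝ) (L : ℕ) (S₀ lam : ℝ) : Prop :=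
  ∃ ψ : ℝ → ℝ,
    (∃ x ∈ Set.Ioi S₀, ψ x ≠ 0) ∧
    ContDiffOn ℝ 2 ψ (Set.Ioi S₀) ∧
    (∫⁻ x in Set.Ioi S₀, ENNReal.ofReal (ψ x ^ 2)) < ⊤ ∧
    (∫⁻ x in Set.Ioi S₀, ENNReal.ofReal (deriv ψ x ^ 2)) < ⊤ ∧
    (∫⁻ x in Set.Ioi S₀, ENNReal.ofReal (deriv (deriv ψ) x ^ 2)) < ⊤ ∧
    Filter.Tendsto ψ (nhdsWithin S₀ (Set.Ioi S₀)) (nhds 0) ∧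
    ∀ x ∈ Set.Ioi S₀, -deriv (deriv ψ) x + W0 M m E rofs L x * ψ x = lam * ψ x

theorem sub_le_integral_of_deriv_le {f f' g : ℝ → ℝ} {a b : ℝ} (hab : a ≤ b)
    (hf : ∀ x ∈ Icc a b, HasDerivAt f (f' x) x) (hg : ContinuousOn g (Icc a b))
    (h : ∀ x ∈ Icc a b, f' x ≤ g x) : f b - f a ≤ ∫ x in a..b, g x :=
  intervalIntegral.sub_le_integral_of_hasDeriv_right_of_le hab
    (fun x hx => (hf x hx).continuousAt.continuousWithinAt)
    (fun x hx => (hf x (Ioo_subset_Icc_self hx)).hasDerivWithinAt)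
    hg.integrableOn_Icc (fun x hx => h x (Ioo_subset_Icc_self hx))

theorem le_of_deriv_nonneg {f f' : ℝ → ℝ} {a b : ℝ} (hab : a ≤ b)
    (hf : ∀ x ∈ Icc a b, HasDerivAt f (f' x) x) (h : ∀ x ∈ Icc a b, 0 ≤ f' x) : f a ≤ f b := by
  have := sub_le_integral_of_deriv_le (f := fun x => - f x) (f' := fun x => - f' x)
    (g := fun _ => 0) hab (fun x hx => (hf x hx).neg) continuousOn_const
    (fun x hx => by linarith [h x hx])
  simp at this; linarith

theorem gronwall_forward {f f' : ℝ → ℝ} {a b c d : ℝ} (hab : a ≤ b) (hc : 0 ≤ c) (hd : 0 ≤ d)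
    (hf : ∀ x ∈ Icc a b, HasDerivAt f (f' x) x)
    (h : ∀ x ∈ Icc a b, f' x ≤ c * f x + d) :
    f b ≤ Real.exp (c * (b - a)) * (f a + d * (b - a)) := by
  have key := le_of_deriv_nonneg (f := fun x => d * (x - a) - Real.exp (-(c * (x - a))) * f x)
    (f' := fun x => d * 1 - (Real.exp (-(c * (x - a))) * (-(c * 1)) * f x
      + Real.exp (-(c * (x - a))) * f' x)) hab
    (fun x hx => by
      have h1 : HasDerivAt (fun x : ℝ => x - a) 1 x := (hasDerivAt_id x).sub_const a
      exact (h1.const_mul d).sub ((((h1.const_mul c).neg).exp).mul (hf x hx)))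
    (fun x hx => by
      have h1 := h x hx
      have h2 : Real.exp (-(c * (x - a))) ≤ 1 := by
        rw [Real.exp_le_one_iff]
        have := mul_nonneg hc (sub_nonneg.2 hx.1)
        linarith
      have h3 := Real.exp_pos (-(c * (x - a)))
      nlinarith [mul_le_mul_of_nonneg_left h1 h3.le, mul_nonneg hd (sub_nonneg.2 h2)])
  simp only [sub_self, mul_zero, neg_zero, Real.exp_zero, one_mul, zero_sub] at key
  have h4 : Real.exp (c * (b - a)) * Real.exp (-(c * (b - a))) = 1 := by
    rw [← Real.exp_add]; simp
  have h5 := mul_le_mul_of_nonneg_left key (Real.exp_pos (c * (b - a))).le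
  have h6 : Real.exp (c * (b - a)) * (Real.exp (-(c * (b - a))) * f b) = f b := by
    rw [← mul_assoc, h4, one_mul]
  nlinarith

theorem gronwall_backward {f f' : ℝ → ℝ} {a b c d : ℝ} (hab : a ≤ b) (hc : 0 ≤ c) (hd : 0 ≤ d)
    (hf : ∀ x ∈ Icc a b, HasDerivAt f (f' x) x)
    (h : ∀ x ∈ Icc a b, -(c * f x + d) ≤ f' x) :
    f a ≤ Real.exp (c * (b - a)) * (f b + d * (b - a)) := by
  have := gronwall_forward (f := fun x => f (-x)) (f' := fun x => - f' (-x)) (a := -b) (b := -a)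
    (by linarith) hc hd
    (fun x hx => by
      have h0 : HasDerivAt f (f' (-x)) (-x) := hf _ ⟨by linarith [hx.2], by linarith [hx.1]⟩
      have h1 := h0.scomp x (hasDerivAt_neg x)
      simpa [Function.comp_def] using h1)
    (fun x hx => by
      have := h (-x) ⟨by linarith [hx.2], by linarith [hx.1]⟩
      linarith)
  simp only [neg_neg] at this
  convert this using 3 <;> ring_nf

/-- The weighted integral bound behind the global solvability of linear equations. -/
theorem abs_integral_exp_le {g : ℝ → ℝ} (hg : Continuous g) {G c : ℝ} (hc : 0 < c)
    (hG : ∀ t, |g t| ≤ G) (s : ℝ) :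
    |∫ t in (0 : ℝ)..s, Real.exp (c * |t|) * g t| ≤ G / c * Real.exp (c * |s|) := by
  have hG0 : 0 ≤ G := (abs_nonneg _).trans (hG 0)
  have pos : ∀ (g : ℝ → ℝ), Continuous g → (∀ t, |g t| ≤ G) → ∀ s, 0 ≤ s →
      |∫ t in (0 : ℝ)..s, Real.exp (c * |t|) * g t| ≤ G / c * Real.exp (c * s) := by
    intro g hg hG s hs
    have h1 : |∫ t in (0 : ℝ)..s, Real.exp (c * |t|) * g t|
        ≤ ∫ t in (0 : ℝ)..s, G * Real.exp (c * t) := by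
      rw [← Real.norm_eq_abs]
      refine intervalIntegral.norm_integral_le_of_norm_le hs (ae_of_all _ fun t ht => ?_)
        (Continuous.intervalIntegrable (by fun_prop) _ _)
      rw [Real.norm_eq_abs, abs_mul, abs_of_pos (Real.exp_pos _), abs_of_pos ht.1, mul_comm]
      exact mul_le_mul_of_nonneg_right (hG t) (Real.exp_pos _).le
    have h2 : ∫ t in (0 : ℝ)..s, G * Real.exp (c * t)
        = G / c * Real.exp (c * s) - G / c * Real.exp (c * 0) := by
      apply intervalIntegral.integral_eq_sub_of_hasDerivAt (f := fun t => G / c * Real.exp (c * t))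
      · intro x _
        have := (((hasDerivAt_id x).const_mul c).exp).const_mul (G / c)
        refine this.congr_deriv ?_
        simp only [id]
        field_simp
      · exact Continuous.intervalIntegrable (by fun_prop) _ _
    have h3 : 0 ≤ G / c * Real.exp (c * 0) := by positivity
    linarith
  rcases le_total 0 s with hs | hs
  · rw [abs_of_nonneg hs]; exact pos g hg hG s hs
  · have h1 := pos (fun t => g (-t)) (by fun_prop) (fun t => hG _) (-s) (by linarith)
    rw [abs_of_nonpos hs]
    refine le_trans (le_of_eq ?_) h1
    have h2 := intervalIntegral.integral_comp_neg (a := 0) (b := -s)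
      (fun t => Real.exp (c * |t|) * g t)
    simp only [abs_neg, neg_neg, neg_zero] at h2
    rw [h2, intervalIntegral.integral_symm, abs_neg]

/-- `(y, z)` is a solution of `y'' = q y` on the real line, `z` being the derivative of `y`. -/
def IsSol (q y z : ℝ → ℝ) : Prop :=
  (∀ s, HasDerivAt y (z s) s) ∧ ∀ s, HasDerivAt z (q s * y s) s

theorem IsSol.continuous {q y z : ℝ → ℝ} (h : IsSol q y z) : Continuous y ∧ Continuous z :=
  ⟨continuous_iff_continuousAt.2 fun s => (h.1 s).continuousAt,
    continuous_iff_continuousAt.2 fun s => (h.2 s).continuousAt⟩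

open BoundedContinuousFunction in
theorem exists_isSol_zero {q : ℝ → ℝ} (hq : Continuous q) {K : ℝ} (hK : ∀ s, |q s| ≤ K)
    (y₀ z₀ : ℝ) : ∃ y z, IsSol q y z ∧ y 0 = y₀ ∧ z 0 = z₀ := by
  have hK0 : 0 ≤ K := (abs_nonneg _).trans (hK 0)
  set c : ℝ := 2 * (K + 1) with hc
  have hcpos : 0 < c := by positivity
  let D (w : ℝ →ᵇ ℝ × ℝ) : ℝ → ℝ × ℝ := fun s =>
    (∫ t in (0 : ℝ)..s, Real.exp (c * |t|) * (w t).2,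
      ∫ t in (0 : ℝ)..s, Real.exp (c * |t|) * (q t * (w t).1))
  have cont1 : ∀ w : ℝ →ᵇ ℝ × ℝ, Continuous fun t => Real.exp (c * |t|) * (w t).2 := fun w => by
    have := w.continuous; fun_prop
  have cont2 : ∀ w : ℝ →ᵇ ℝ × ℝ, Continuous fun t => Real.exp (c * |t|) * (q t * (w t).1) :=
    fun w => by have := w.continuous; fun_prop
  have hDc : ∀ w, Continuous (D w) := fun w =>
    (intervalIntegral.continuous_primitive (fun _ _ => (cont1 w).intervalIntegrable _ _) 0).prodMk
      (intervalIntegral.continuous_primitive (fun _ _ => (cont2 w).intervalIntegrable _ _) 0)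
  have hDb : ∀ w s, ‖D w s‖ ≤ 1 / 2 * ‖w‖ * Real.exp (c * |s|) := by
    intro w s
    have hw : ∀ t, |(w t).1| ≤ ‖w‖ ∧ |(w t).2| ≤ ‖w‖ := fun t =>
      ⟨(norm_fst_le (w t)).trans (w.norm_coe_le_norm t),
        (norm_snd_le (w t)).trans (w.norm_coe_le_norm t)⟩
    have hwc := w.continuous
    have e1 := abs_integral_exp_le (g := fun t => (w t).2) (by fun_prop) hcpos
      (fun t => (hw t).2) s
    have e2 := abs_integral_exp_le (g := fun t => q t * (w t).1) (by fun_prop) hcpos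
      (G := K * ‖w‖) (fun t => by
        rw [abs_mul]; exact mul_le_mul (hK t) (hw t).1 (abs_nonneg _) hK0) s
    have l1 : ‖w‖ / c ≤ 1 / 2 * ‖w‖ := by
      rw [div_le_iff₀ hcpos, hc]; nlinarith [norm_nonneg w, mul_nonneg hK0 (norm_nonneg w)]
    have l2 : K * ‖w‖ / c ≤ 1 / 2 * ‖w‖ := by
      rw [div_le_iff₀ hcpos, hc]; nlinarith [norm_nonneg w, mul_nonneg hK0 (norm_nonneg w)]
    have ep := (Real.exp_pos (c * |s|)).le
    refine max_le ?_ ?_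
    · exact e1.trans (mul_le_mul_of_nonneg_right l1 ep)
    · exact e2.trans (mul_le_mul_of_nonneg_right l2 ep)
  let T0 (w : ℝ →ᵇ ℝ × ℝ) : ℝ → ℝ × ℝ := fun s => Real.exp (-(c * |s|)) • ((y₀, z₀) + D w s)
  have hexp : ∀ s : ℝ, Real.exp (-(c * |s|)) * Real.exp (c * |s|) = 1 := fun s => by
    rw [← Real.exp_add]; simp
  have hexp1 : ∀ s : ℝ, Real.exp (-(c * |s|)) ≤ 1 := fun s => by
    rw [Real.exp_le_one_iff]; have := mul_nonneg hcpos.le (abs_nonneg s); linarith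
  let T (w : ℝ →ᵇ ℝ × ℝ) : ℝ →ᵇ ℝ × ℝ := BoundedContinuousFunction.ofNormedAddCommGroup (T0 w)
    (by have := hDc w; fun_prop) (‖(y₀, z₀)‖ + 1 / 2 * ‖w‖) (fun s => by
      simp only [T0]
      rw [norm_smul, Real.norm_eq_abs, abs_of_pos (Real.exp_pos _)]
      have h1 := hDb w s
      have h2 := norm_add_le (y₀, z₀) (D w s)
      have h3 := Real.exp_pos (-(c * |s|))
      calc Real.exp (-(c * |s|)) * ‖(y₀, z₀) + D w s‖
          ≤ Real.exp (-(c * |s|)) * (‖(y₀, z₀)‖ + 1 / 2 * ‖w‖ * Real.exp (c * |s|)) :=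
            mul_le_mul_of_nonneg_left (h2.trans (by linarith)) h3.le
        _ = Real.exp (-(c * |s|)) * ‖(y₀, z₀)‖ + 1 / 2 * ‖w‖ *
              (Real.exp (-(c * |s|)) * Real.exp (c * |s|)) := by ring
        _ ≤ _ := by
            rw [hexp]
            nlinarith [mul_le_mul_of_nonneg_right (hexp1 s) (norm_nonneg (y₀, z₀))])
  have hDsub : ∀ w w' s, D w s - D w' s = D (w - w') s := by
    intro w w' s
    simp only [D, Prod.mk_sub_mk]
    rw [← intervalIntegral.integral_sub ((cont1 w).intervalIntegrable _ _)
      ((cont1 w').intervalIntegrable _ _), ← intervalIntegral.integral_sub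
      ((cont2 w).intervalIntegrable _ _) ((cont2 w').intervalIntegrable _ _)]
    simp only [BoundedContinuousFunction.coe_sub, Pi.sub_apply, Prod.fst_sub, Prod.snd_sub]
    congr 2 <;> · ext t; ring
  have hT : ContractingWith (1 / 2) T := by
    refine ⟨by rw [← NNReal.coe_lt_coe]; norm_num, LipschitzWith.of_dist_le_mul fun w w' => ?_⟩
    rw [BoundedContinuousFunction.dist_le (by positivity)]
    intro s
    change dist (T0 w s) (T0 w' s) ≤ _
    simp only [T0]
    rw [dist_eq_norm, ← smul_sub, add_sub_add_left_eq_sub, hDsub, norm_smul, Real.norm_eq_abs,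
      abs_of_pos (Real.exp_pos _), dist_eq_norm]
    have h1 := mul_le_mul_of_nonneg_left (hDb (w - w') s) (Real.exp_pos (-(c * |s|))).le
    have h2 := hexp s
    calc _ ≤ _ := h1
      _ = 1 / 2 * ‖w - w'‖ * (Real.exp (-(c * |s|)) * Real.exp (c * |s|)) := by ring
      _ = _ := by rw [h2]; simp
  set w := ContractingWith.fixedPoint T hT with hw
  have hfix : T w = w := ContractingWith.fixedPoint_isFixedPt hT
  have hfix' : ∀ s, Real.exp (c * |s|) • w s = (y₀, z₀) + D w s := by
    intro s
    have h1 : w s = Real.exp (-(c * |s|)) • ((y₀, z₀) + D w s) := by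
      conv_lhs => rw [← hfix]
      rfl
    rw [h1, smul_smul, mul_comm, hexp, one_smul]
  have hy : ∀ s, Real.exp (c * |s|) * (w s).1
      = y₀ + ∫ t in (0 : ℝ)..s, Real.exp (c * |t|) * (w t).2 := fun s =>
    congrArg Prod.fst (hfix' s)
  have hz : ∀ s, Real.exp (c * |s|) * (w s).2
      = z₀ + ∫ t in (0 : ℝ)..s, Real.exp (c * |t|) * (q t * (w t).1) := fun s =>
    congrArg Prod.snd (hfix' s)
  refine ⟨fun s => Real.exp (c * |s|) * (w s).1, fun s => Real.exp (c * |s|) * (w s).2,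
    ⟨fun s => ?_, fun s => ?_⟩, by simpa using hy 0, by simpa using hz 0⟩
  · have := ((cont1 w).integral_hasStrictDerivAt 0 s).hasDerivAt.const_add y₀
    refine this.congr_of_eventuallyEq (Eventually.of_forall fun s => hy s)
  · have := ((cont2 w).integral_hasStrictDerivAt 0 s).hasDerivAt.const_add z₀
    rw [show q s * (Real.exp (c * |s|) * (w s).1) = Real.exp (c * |s|) * (q s * (w s).1) by ring]
    refine this.congr_of_eventuallyEq (Eventually.of_forall fun s => hz s)

theorem exists_isSol {q : ℝ → ℝ} (hq : Continuous q) {K : ℝ} (hK : ∀ s, |q s| ≤ K)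
    (a y₀ z₀ : ℝ) : ∃ y z, IsSol q y z ∧ y a = y₀ ∧ z a = z₀ := by
  obtain ⟨y, z, ⟨h1, h2⟩, h3, h4⟩ := exists_isSol_zero (q := fun s => q (s + a)) (by fun_prop)
    (fun s => hK _) y₀ z₀
  refine ⟨fun s => y (s - a), fun s => z (s - a), ⟨fun s => ?_, fun s => ?_⟩, by simpa, by simpa⟩
  · exact (h1 (s - a)).comp_sub_const s a
  · have := (h2 (s - a)).comp_sub_const s a
    simpa using this

/-- Two functions with nonnegative coefficient stay positive once they are positive. -/
theorem IsSol.pos_of_pos {q y z : ℝ → ℝ} (h : IsSol q y z) {Y : ℝ} (hq : ∀ s, Y ≤ s → 0 ≤ q s)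
    {a b : ℝ} (hYa : Y ≤ a) (hab : a ≤ b) (hy : 0 < y a) (hz : 0 < z a) : 0 < y b ∧ 0 < z b := by
  have key : ∀ c, a ≤ c → (∀ s ∈ Icc a c, 0 ≤ y s) → y a ≤ y c ∧ z a ≤ z c := by
    intro c hac hc
    have hz' : ∀ s ∈ Icc a c, z a ≤ z s := fun s hs =>
      le_of_deriv_nonneg hs.1 (fun x _ => h.2 x) fun x hx =>
        mul_nonneg (hq x (hYa.trans hx.1)) (hc x ⟨hx.1, hx.2.trans hs.2⟩)
    exact ⟨le_of_deriv_nonneg hac (fun x _ => h.1 x) fun x hx => hz.le.trans (hz' x hx),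
      hz' c ⟨hac, le_rfl⟩⟩
  have hpos : ∀ s ∈ Icc a b, 0 ≤ y s := by
    by_contra! hcon
    obtain ⟨s, hs, hys⟩ := hcon
    -- the first zero to the right of `a`
    let Z := Icc a s ∩ y ⁻¹' (Iic 0)
    have hZc : IsCompact Z := isCompact_Icc.inter_right (isClosed_Iic.preimage h.continuous.1)
    have hZne : Z.Nonempty := ⟨s, ⟨⟨hs.1, le_rfl⟩, hys.le⟩⟩
    obtain ⟨c, ⟨hc1, hc2⟩, hcmin⟩ := hZc.exists_isLeast hZne
    have hlt : ∀ x ∈ Icc a c, x ≠ c → 0 ≤ y x := by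
      intro x hx hxc
      by_contra! hneg
      exact hxc (le_antisymm hx.2 (hcmin ⟨⟨hx.1, hx.2.trans hc1.2⟩, hneg.le⟩))
    have hcne : c ≠ a := by rintro rfl; exact absurd hc2 (not_le.2 hy)
    have hac : a < c := lt_of_le_of_ne hc1.1 (Ne.symm hcne)
    have hlim : Tendsto y (nhdsWithin c (Iio c)) (nhds (y c)) :=
      h.continuous.1.continuousAt.tendsto.mono_left nhdsWithin_le_nhds
    have : y a ≤ y c := by
      refine ge_of_tendsto hlim ?_
      filter_upwards [Ioo_mem_nhdsLT hac] with x hx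
      exact (key x hx.1.le fun t ht =>
        hlt t ⟨ht.1, ht.2.trans hx.2.le⟩ (ne_of_lt (lt_of_le_of_lt ht.2 hx.2))).1
    have h2 : y c ≤ 0 := hc2
    linarith
  obtain ⟨h1, h2⟩ := key b hab hpos
  exact ⟨hy.trans_le h1, hz.trans_le h2⟩

theorem IsSol.lin {q y₁ z₁ y₂ z₂ : ℝ → ℝ} (h₁ : IsSol q y₁ z₁) (h₂ : IsSol q y₂ z₂) (c d : ℝ) :
    IsSol q (fun s => c * y₁ s + d * y₂ s) (fun s => c * z₁ s + d * z₂ s) :=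
  ⟨fun s => ((h₁.1 s).const_mul c).add ((h₂.1 s).const_mul d), fun s =>
    (((h₁.2 s).const_mul c).add ((h₂.2 s).const_mul d)).congr_deriv (by ring)⟩

theorem exists_isSol_shooting {q : ℝ → ℝ} (hq : Continuous q) {K : ℝ} (hK : ∀ s, |q s| ≤ K)
    {Y : ℝ} (hq0 : ∀ s, Y ≤ s → 0 ≤ q s) :
    ∃ y z, IsSol q y z ∧ (y Y ≠ 0 ∨ z Y ≠ 0) ∧ ∀ s, Y ≤ s → y s * z s ≤ 0 := by
  obtain ⟨y₁, z₁, h₁, hy₁, hz₁⟩ := exists_isSol hq hK Y 1 0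
  obtain ⟨y₂, z₂, h₂, hy₂, hz₂⟩ := exists_isSol hq hK Y 0 1
  have hsol := fun t : ℝ => h₁.lin h₂ (Real.cos t) (Real.sin t)
  let U : Set ℝ := {t | ∃ s, Y ≤ s ∧ 0 < Real.cos t * y₁ s + Real.sin t * y₂ s ∧
    0 < Real.cos t * z₁ s + Real.sin t * z₂ s}
  let N : Set ℝ := {t | ∃ s, Y ≤ s ∧ Real.cos t * y₁ s + Real.sin t * y₂ s < 0 ∧
    Real.cos t * z₁ s + Real.sin t * z₂ s < 0}
  have hop : ∀ c d : ℝ, IsOpen {t | 0 < Real.cos t * c + Real.sin t * d} := fun c d =>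
    isOpen_lt continuous_const (by fun_prop)
  have hon : ∀ c d : ℝ, IsOpen {t | Real.cos t * c + Real.sin t * d < 0} := fun c d =>
    isOpen_lt (by fun_prop) continuous_const
  have hU : IsOpen U := by
    have : U = ⋃ s ∈ Ici Y, {t | 0 < Real.cos t * y₁ s + Real.sin t * y₂ s ∧
        0 < Real.cos t * z₁ s + Real.sin t * z₂ s} := by
      ext t; simp [U, and_left_comm]
    rw [this]
    refine isOpen_biUnion fun s _ => ?_
    exact (hop (y₁ s) (y₂ s)).inter (hop (z₁ s) (z₂ s))
  have hN : IsOpen N := by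
    have : N = ⋃ s ∈ Ici Y, {t | Real.cos t * y₁ s + Real.sin t * y₂ s < 0 ∧
        Real.cos t * z₁ s + Real.sin t * z₂ s < 0} := by
      ext t; simp [N, and_left_comm]
    rw [this]
    refine isOpen_biUnion fun s _ => ?_
    exact (hon (y₁ s) (y₂ s)).inter (hon (z₁ s) (z₂ s))
  have hdisj : ∀ t, t ∈ U → t ∈ N → False := by
    rintro t ⟨s, hs, hs1, hs2⟩ ⟨s', hs', hs1', hs2'⟩
    have hneg := h₁.lin h₂ (-Real.cos t) (-Real.sin t)
    rcases le_total s s' with hle | hle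
    · have := (hsol t).pos_of_pos hq0 hs hle hs1 hs2
      linarith [this.1]
    · have := hneg.pos_of_pos hq0 hs' hle (by linarith) (by linarith)
      linarith [this.1]
  have hex : ∃ t, t ∉ U ∧ t ∉ N := by
    by_contra! hcon
    have hpc : IsPreconnected (univ : Set ℝ) := isPreconnected_univ
    obtain ⟨t, -, ht⟩ := hpc U N hU hN (fun t _ => by
        by_cases h : t ∈ U
        · exact Or.inl h
        · exact Or.inr (hcon t h))
      ⟨Real.pi / 4, mem_univ _, Y, le_rfl, by
        rw [hy₁, hy₂, Real.cos_pi_div_four]; simp, by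
        rw [hz₁, hz₂, Real.sin_pi_div_four]; simp⟩
      ⟨Real.pi / 4 + Real.pi, mem_univ _, Y, le_rfl, by
        rw [hy₁, hy₂, Real.cos_add_pi, Real.cos_pi_div_four]; simp, by
        rw [hz₁, hz₂, Real.sin_add_pi, Real.sin_pi_div_four]; simp⟩
    exact hdisj t ht.1 ht.2
  obtain ⟨t, htU, htN⟩ := hex
  refine ⟨_, _, hsol t, ?_, fun s hs => ?_⟩
  · simp only [hy₁, hy₂, hz₁, hz₂, mul_one, mul_zero, add_zero, zero_add]
    by_contra! hcon
    have := Real.cos_sq_add_sin_sq t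
    rw [hcon.1, hcon.2] at this
    norm_num at this
  · by_contra! hcon
    rcases pos_and_pos_or_neg_and_neg_of_mul_pos hcon with h | h
    · exact htU ⟨s, hs, h⟩
    · exact htN ⟨s, hs, h⟩

/-- A solution of `y'' = q y`, normalised by `y Y = 1`, that is nonnegative and
nonincreasing on `[Y, ∞)`. -/
def IsDecaying (q : ℝ → ℝ) (Y : ℝ) (y z : ℝ → ℝ) : Prop :=
  IsSol q y z ∧ y Y = 1 ∧ ∀ s, Y ≤ s → 0 ≤ y s ∧ z s ≤ 0

theorem exists_isDecaying {q : ℝ → ℝ} (hq : Continuous q) {K : ℝ} (hK : ∀ s, |q s| ≤ K)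
    {Y : ℝ} (hq0 : ∀ s, Y ≤ s → 0 ≤ q s) : ∃ y z, IsDecaying q Y y z := by
  obtain ⟨y, z, h, hne, hyz⟩ := exists_isSol_shooting hq hK hq0
  have hsq : ∀ a b, Y ≤ a → a ≤ b → y b ^ 2 ≤ y a ^ 2 := by
    intro a b ha hab
    have := le_of_deriv_nonneg (f := fun s => -(y s ^ 2)) (f' := fun s => -(2 * (y s * z s))) hab
      (fun x _ => (((h.1 x).pow 2).neg).congr_deriv (by ring))
      (fun x hx => by have := hyz x (ha.trans hx.1); linarith)
    linarith
  have hY : y Y ≠ 0 := by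
    intro h0
    have hz0 : ∀ s, Y ≤ s → y s = 0 := fun s hs => by
      have := hsq Y s le_rfl hs
      rw [h0] at this
      nlinarith [sq_nonneg (y s)]
    have hzY : z Y = 0 := by
      have h1 : HasDerivWithinAt y (z Y) (Ici Y) Y := (h.1 Y).hasDerivWithinAt
      have h2 : HasDerivWithinAt y 0 (Ici Y) Y :=
        (hasDerivWithinAt_const Y (Ici Y) (0 : ℝ)).congr (fun s hs => hz0 s hs) (hz0 Y le_rfl)
      exact (uniqueDiffWithinAt_Ici Y).eq_deriv _ h1 h2
    rcases hne with h' | h'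
    · exact h' h0
    · exact h' hzY
  obtain ⟨v, w, hvw, hvY, hvs⟩ : ∃ v w, IsSol q v w ∧ v Y = 1 ∧ ∀ s, Y ≤ s → v s * w s ≤ 0 := by
    refine ⟨_, _, h.lin h (y Y)⁻¹ 0, by simp [hY], fun s hs => ?_⟩
    have := mul_nonneg (sq_nonneg (y Y)⁻¹) (neg_nonneg.2 (hyz s hs))
    nlinarith
  have hvsq : ∀ a b, Y ≤ a → a ≤ b → v b ^ 2 ≤ v a ^ 2 := by
    intro a b ha hab
    have := le_of_deriv_nonneg (f := fun s => -(v s ^ 2)) (f' := fun s => -(2 * (v s * w s))) hab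
      (fun x _ => (((hvw.1 x).pow 2).neg).congr_deriv (by ring))
      (fun x hx => by have := hvs x (ha.trans hx.1); linarith)
    linarith
  have hv0 : ∀ s, Y ≤ s → 0 ≤ v s := by
    intro s hs
    by_contra! hneg
    obtain ⟨c, hc, hc0⟩ := intermediate_value_Icc' hs hvw.continuous.1.continuousOn
      (show (0 : ℝ) ∈ Icc (v s) (v Y) from ⟨hneg.le, by rw [hvY]; norm_num⟩)
    have := hvsq c s hc.1 hc.2
    rw [hc0] at this
    nlinarith
  refine ⟨v, w, hvw, hvY, fun s hs => ⟨hv0 s hs, ?_⟩⟩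
  by_contra! hpos
  have hmono : ∀ t, s ≤ t → w s ≤ w t := fun t ht =>
    le_of_deriv_nonneg ht (fun x _ => hvw.2 x) fun x hx =>
      mul_nonneg (hq0 x (hs.trans hx.1)) (hv0 x (hs.trans hx.1))
  have h1 : v s + w s * 1 ≤ v (s + 1) := by
    have := le_of_deriv_nonneg (f := fun t => v t - w s * t) (f' := fun t => w t - w s * 1)
      (show s ≤ s + 1 by linarith)
      (fun x _ => (hvw.1 x).sub ((hasDerivAt_id x).const_mul _))
      (fun x hx => by have := hmono x hx.1; linarith)
    nlinarith
  have h2 := hmono (s + 1) (by linarith)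
  have h3 := hvs (s + 1) (by linarith)
  have h4 := hv0 s hs
  nlinarith

namespace IsDecaying
variable {q y z : ℝ → ℝ} {Y : ℝ}

theorem antitone (h : IsDecaying q Y y z) {a b : ℝ} (ha : Y ≤ a) (hab : a ≤ b) : y b ≤ y a := by
  have := le_of_deriv_nonneg (f := fun s => -y s) (f' := fun s => -z s) hab
    (fun x _ => (h.1.1 x).neg) (fun x hx => by linarith [(h.2.2 x (ha.trans hx.1)).2])
  linarith

theorem le_one (h : IsDecaying q Y y z) {a : ℝ} (ha : Y ≤ a) : y a ≤ 1 :=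
  h.2.1 ▸ h.antitone le_rfl ha

theorem monotone (h : IsDecaying q Y y z) (hq : ∀ s, Y ≤ s → 0 ≤ q s) {a b : ℝ} (ha : Y ≤ a)
    (hab : a ≤ b) : z a ≤ z b :=
  le_of_deriv_nonneg hab (fun x _ => h.1.2 x) fun x hx =>
    mul_nonneg (hq x (ha.trans hx.1)) (h.2.2 x (ha.trans hx.1)).1

theorem neg_two_le (h : IsDecaying q Y y z) (hq1 : ∀ s ∈ Icc Y (Y + 1), q s ≤ 1) :
    -2 ≤ z Y := by
  obtain ⟨c, hc, hc'⟩ := exists_hasDerivAt_eq_slope y z (show Y < Y + 1 by linarith)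
    h.1.continuous.1.continuousOn (fun x _ => h.1.1 x)
  have h1 := (h.2.2 (Y + 1) (by linarith)).1
  have h2 := h.le_one (le_refl Y)
  have h3 : -1 ≤ z c := by rw [hc', h.2.1]; simp; linarith
  have h4 := le_of_deriv_nonneg (f := fun s => s - z s) (f' := fun s => 1 - q s * y s) hc.1.le
    (fun x _ => (hasDerivAt_id x).sub (h.1.2 x)) (fun x hx => by
      have e1 := h.le_one hx.1
      have e2 := (h.2.2 x hx.1).1
      have e3 := hq1 x ⟨hx.1, hx.2.trans hc.2.le⟩
      nlinarith)
  linarith [hc.1, hc.2]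

theorem abs_deriv_le (h : IsDecaying q Y y z) (hq : ∀ s, Y ≤ s → 0 ≤ q s) {T : ℝ} (hT : Y ≤ T) :
    -z T * (T - Y) ≤ 1 := by
  have := le_of_deriv_nonneg (f := fun s => z T * s - y s) (f' := fun s => z T * 1 - z s) hT
    (fun x _ => ((hasDerivAt_id x).const_mul _).sub (h.1.1 x))
    (fun x hx => by have := h.monotone hq hx.1 hx.2; linarith)
  have h1 := (h.2.2 T hT).1
  have h2 := h.2.1
  nlinarith

theorem integral_le (h : IsDecaying q Y y z) (hq : ∀ s, Y ≤ s → 0 ≤ q s) (hz : -2 ≤ z Y)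
    {Ym c T : ℝ} (hYm : Y ≤ Ym) (hc : 0 < c) (hqc : ∀ s, Ym ≤ s → c ≤ q s) (hT : Y ≤ T) :
    ∫ s in Y..T, y s ≤ (Ym - Y) + 2 / c := by
  have hcont := h.1.continuous.1
  have hnn : ∀ s, Y ≤ s → 0 ≤ y s := fun s hs => (h.2.2 s hs).1
  have key : ∀ T, Ym ≤ T → ∫ s in Y..T, y s ≤ (Ym - Y) + 2 / c := by
    intro T hT
    rw [← intervalIntegral.integral_add_adjacent_intervals (hcont.intervalIntegrable Y Ym)
      (hcont.intervalIntegrable Ym T)]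
    have h1 : ∫ s in Y..Ym, y s ≤ ∫ s in Y..Ym, (1 : ℝ) :=
      intervalIntegral.integral_mono_on hYm (hcont.intervalIntegrable _ _)
        (by simp) (fun s hs => h.le_one hs.1)
    rw [intervalIntegral.integral_const, smul_eq_mul, mul_one] at h1
    have h2 := sub_le_integral_of_deriv_le (f := fun s => -z s / c)
      (f' := fun s => -(q s * y s) / c) (g := fun s => -y s) hT
      (fun x _ => (h.1.2 x).neg.div_const c) (by fun_prop) (fun x hx => by
        rw [div_le_iff₀ hc]
        nlinarith [hqc x hx.1, hnn x (hYm.trans hx.1)])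
    rw [intervalIntegral.integral_neg] at h2
    have h3 := h.monotone hq le_rfl hYm
    have h4 := (h.2.2 T (hYm.trans hT)).2
    have h5 : -z Ym / c ≤ 2 / c := div_le_div_of_nonneg_right (by linarith) hc.le
    have h6 : 0 ≤ -z T / c := div_nonneg (by linarith) hc.le
    linarith
  rcases le_total Ym T with h' | h'
  · exact key T h'
  · refine le_trans ?_ (key Ym le_rfl)
    exact intervalIntegral.integral_mono_interval le_rfl hT h'
      ((ae_restrict_iff' measurableSet_Ioc).2 (ae_of_all _ fun s hs => hnn s hs.1.le))
      (hcont.intervalIntegrable _ _)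

end IsDecaying

theorem gronwall_sol {y z F q : ℝ → ℝ} {a b k η : ℝ} (hab : a ≤ b) (hk : 0 < k)
    (hy : ∀ x ∈ Icc a b, HasDerivAt y (z x) x)
    (hz : ∀ x ∈ Icc a b, HasDerivAt z (q x * y x + F x) x)
    (hq : ∀ x ∈ Icc a b, |q x| ≤ k ^ 2) (hF : ∀ x ∈ Icc a b, |F x| ≤ η) :
    k ^ 2 * y a ^ 2 + z a ^ 2 ≤
      Real.exp (3 * k * (b - a)) * (k ^ 2 * y b ^ 2 + z b ^ 2 + η ^ 2 / k * (b - a)) := by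
  refine gronwall_backward (f := fun x => k ^ 2 * y x ^ 2 + z x ^ 2)
    (f' := fun x => k ^ 2 * (2 * y x * z x) + 2 * z x * (q x * y x + F x)) hab
    (by positivity) (by positivity) (fun x hx => ?_) (fun x hx => ?_)
  · exact ((((hy x hx).pow 2).const_mul _).add ((hz x hx).pow 2)).congr_deriv (by simp)
  · have h1 := abs_le.1 (hq x hx)
    have h2 := abs_le.1 (hF x hx)
    have h3 : -(k * z x ^ 2 + η ^ 2 / k) ≤ 2 * z x * F x := by
      have e1 : F x ^ 2 / k ≤ η ^ 2 / k := div_le_div_of_nonneg_right (by nlinarith) hk.le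
      have e2 : 0 ≤ k * (z x + F x / k) ^ 2 := by positivity
      have e3 : k * (z x + F x / k) ^ 2 = k * z x ^ 2 + 2 * z x * F x + F x ^ 2 / k := by
        field_simp; ring
      linarith
    have h4 : -(2 * k * (k ^ 2 * y x ^ 2 + z x ^ 2)) ≤
        k ^ 2 * (2 * y x * z x) + 2 * z x * (q x * y x) := by
      have e1 : |y x * z x| * (2 * k) ≤ k ^ 2 * y x ^ 2 + z x ^ 2 := by
        rw [abs_mul]
        nlinarith [sq_nonneg (k * |y x| - |z x|), sq_abs (y x), sq_abs (z x)]
      have e2 : |(2 * k ^ 2 + 2 * q x) * (y x * z x)| ≤ 4 * k ^ 2 * |y x * z x| := by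
        rw [abs_mul]
        refine mul_le_mul_of_nonneg_right ?_ (abs_nonneg _)
        rw [abs_le]; constructor <;> linarith
      have e3 := neg_abs_le ((2 * k ^ 2 + 2 * q x) * (y x * z x))
      nlinarith
    have h5 : 0 ≤ k * (k ^ 2 * y x ^ 2) := by positivity
    nlinarith

theorem transfer_monotone {y z F q q' : ℝ → ℝ} {a b k η : ℝ} (hab : a ≤ b) (hk : 0 < k)
    (hk1 : k ^ 2 ≤ 1 / 2)
    (hy : ∀ x ∈ Icc a b, HasDerivAt y (z x) x)
    (hz : ∀ x ∈ Icc a b, HasDerivAt z (q x * y x + F x) x)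
    (hq' : ∀ x ∈ Icc a b, HasDerivAt q (q' x) x) (hq'0 : ∀ x ∈ Icc a b, 0 ≤ q' x)
    (hq : ∀ x ∈ Icc a b, q x ≤ k ^ 2 / 2) (hql : ∀ x ∈ Icc a b, -(1 / 2) ≤ q x)
    (hF : ∀ x ∈ Icc a b, |F x| ≤ η) :
    y a ^ 2 + z a ^ 2 ≤ 2 * Real.exp (3 * k * (b - a)) *
      (y b ^ 2 + 2 * z b ^ 2 / k ^ 2 + 2 * η ^ 2 / k ^ 3 * (b - a)) := by
  have key := gronwall_backward (f := fun x => y x ^ 2 + z x ^ 2 / (k ^ 2 - q x))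
    (f' := fun x => 2 * y x * z x + (2 * z x * (q x * y x + F x) * (k ^ 2 - q x)
      - z x ^ 2 * (- q' x)) / (k ^ 2 - q x) ^ 2) (c := 3 * k) (d := 2 * η ^ 2 / k ^ 3) hab
    (by positivity) (by positivity) (fun x hx => ?_) (fun x hx => ?_)
  · have ha := hq a ⟨le_rfl, hab⟩
    have ha' := hql a ⟨le_rfl, hab⟩
    have hb := hq b ⟨hab, le_rfl⟩
    have hkk : 0 < k ^ 2 := by positivity
    have e1 : z a ^ 2 ≤ z a ^ 2 / (k ^ 2 - q a) := by
      rw [le_div_iff₀ (by linarith)]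
      nlinarith [sq_nonneg (z a)]
    have e2 : z b ^ 2 / (k ^ 2 - q b) ≤ 2 * z b ^ 2 / k ^ 2 := by
      rw [div_le_div_iff₀ (by linarith) hkk]
      nlinarith [sq_nonneg (z b)]
    have e3 : 0 ≤ y a ^ 2 := sq_nonneg _
    have e4 := Real.exp_pos (3 * k * (b - a))
    have e5 := mul_le_mul_of_nonneg_left e2 e4.le
    have e6 : 0 ≤ z a ^ 2 := sq_nonneg _
    have e7 : (0:ℝ) ≤ y b ^ 2 + 2 * z b ^ 2 / k ^ 2 + 2 * η ^ 2 / k ^ 3 * (b - a) := by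
      have := sub_nonneg.2 hab
      positivity
    have e8 := mul_nonneg e4.le e7
    nlinarith
  · have hne : k ^ 2 - q x ≠ 0 := by
      have := hq x hx
      have : 0 < k ^ 2 := by positivity
      linarith
    refine (((hy x hx).pow 2).add (((hz x hx).pow 2).div ((hq' x hx).const_sub (k ^ 2)) hne)).congr_deriv ?_
    simp
  · set w := k ^ 2 - q x with hw
    have hwk : k ^ 2 / 2 ≤ w := by linarith [hq x hx]
    have hkk : 0 < k ^ 2 := by positivity
    have hwp : 0 < w := by linarith
    have h2 := abs_le.1 (hF x hx)
    have e0 : 2 * y x * z x + (2 * z x * (q x * y x + F x) * w - z x ^ 2 * (- q' x)) / w ^ 2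
        = 2 * (y x * z x) * k ^ 2 / w + 2 * z x * F x / w + z x ^ 2 * q' x / w ^ 2 := by
      have : q x = k ^ 2 - w := by rw [hw]; ring
      rw [this]; field_simp; ring
    rw [e0]
    have e1 : 0 ≤ z x ^ 2 * q' x / w ^ 2 :=
      div_nonneg (mul_nonneg (sq_nonneg _) (hq'0 x hx)) (sq_nonneg _)
    have e2 : -(k * (z x ^ 2 / w) + 2 * η ^ 2 / k ^ 3) ≤ 2 * z x * F x / w := by
      have f1 : F x ^ 2 / (k * w) ≤ 2 * η ^ 2 / k ^ 3 := by
        rw [div_le_div_iff₀ (by positivity) (by positivity)]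
        have : F x ^ 2 ≤ η ^ 2 := by nlinarith
        have f2 : F x ^ 2 * k ^ 3 ≤ η ^ 2 * k ^ 3 :=
          mul_le_mul_of_nonneg_right this (by positivity)
        have f3 : k * k ^ 2 ≤ k * (2 * w) := mul_le_mul_of_nonneg_left (by linarith) hk.le
        nlinarith [mul_le_mul_of_nonneg_left f3 (sq_nonneg η)]
      have f4 : 0 ≤ k / w * (z x + F x / k) ^ 2 := by positivity
      have f5 : k / w * (z x + F x / k) ^ 2
          = k * (z x ^ 2 / w) + 2 * z x * F x / w + F x ^ 2 / (k * w) := by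
        field_simp; ring
      linarith
    have e3 : -(2 * k * (y x ^ 2 + z x ^ 2 / w)) ≤ 2 * (y x * z x) * k ^ 2 / w := by
      rw [le_div_iff₀ hwp]
      have : (y x ^ 2 + z x ^ 2 / w) * w = y x ^ 2 * w + z x ^ 2 := by field_simp
      have f1 : -(2 * k * (y x ^ 2 * w + z x ^ 2)) ≤ 2 * (y x * z x) * k ^ 2 := by
        have f2 : 0 ≤ y x ^ 2 * w + z x ^ 2 + k * (y x * z x) := by
          nlinarith [sq_nonneg (k * y x + z x), mul_le_mul_of_nonneg_left hwk (sq_nonneg (y x))]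
        nlinarith
      calc _ = -(2 * k * ((y x ^ 2 + z x ^ 2 / w) * w)) := by ring
        _ ≤ _ := by rw [this]; exact f1
    nlinarith

theorem hasDerivAt_wronskian {q₁ q₂ y₁ z₁ y₂ z₂ : ℝ → ℝ} (h₁ : IsSol q₁ y₁ z₁)
    (h₂ : IsSol q₂ y₂ z₂) (s : ℝ) :
    HasDerivAt (fun s => z₁ s * y₂ s - y₁ s * z₂ s) ((q₁ s - q₂ s) * (y₁ s * y₂ s)) s :=
  (((h₁.2 s).mul (h₂.1 s)).sub ((h₁.1 s).mul (h₂.2 s))).congr_deriv (by ring)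

theorem wronskian_sub_eq {V y₁ z₁ y₂ z₂ : ℝ → ℝ} {h₁ h₂ : ℝ}
    (H₁ : IsSol (fun s => V s - h₁) y₁ z₁) (H₂ : IsSol (fun s => V s - h₂) y₂ z₂) (a b : ℝ) :
    (z₁ b * y₂ b - y₁ b * z₂ b) - (z₁ a * y₂ a - y₁ a * z₂ a)
      = (h₂ - h₁) * ∫ s in a..b, y₁ s * y₂ s := by
  have c1 := H₁.continuous.1
  have c2 := H₂.continuous.1
  rw [← intervalIntegral.integral_const_mul]
  have hc : Continuous fun s => (h₂ - h₁) * (y₁ s * y₂ s) := by fun_prop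
  refine (intervalIntegral.integral_eq_sub_of_hasDerivAt
    (f := fun s => z₁ s * y₂ s - y₁ s * z₂ s) (fun x _ => ?_) (hc.intervalIntegrable _ _)).symm
  exact (hasDerivAt_wronskian H₁ H₂ x).congr_deriv (by ring)

theorem exists_two_div_le {Y ε : ℝ} (hε : 0 < ε) (t₀ : ℝ) :
    ∃ t, Y < t ∧ t₀ ≤ t ∧ 2 / (t - Y) ≤ ε := by
  refine ⟨max t₀ (Y + 2 / ε), ?_, le_max_left _ _, ?_⟩
  · have : 0 < 2 / ε := by positivity
    exact lt_of_lt_of_le (by linarith) (le_max_right _ _)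
  · have h0 : 0 < 2 / ε := by positivity
    have h1 : 2 / ε ≤ max t₀ (Y + 2 / ε) - Y := by
      linarith [le_max_right t₀ (Y + 2 / ε)]
    rw [div_le_iff₀ (by linarith)]
    rw [div_le_iff₀ hε] at h1
    linarith

/-- Quantitative hypotheses on a potential in the far region: nonnegative beyond `Y`,
with a transfer bound on `[X, Y]` uniform in spectral shifts of size at most `e`. -/
structure FarData (V : ℝ → ℝ) (X Y Ym e c P T : ℝ) : Prop where
  cont : Continuous V
  bdd : ∃ K, ∀ s, |V s| ≤ K
  hXY : X ≤ Y
  hYm : Y ≤ Ym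
  he : 0 < e
  hV : ∀ s, Y ≤ s → e ≤ V s
  hV1 : ∀ s ∈ Icc Y (Y + 1), V s + e ≤ 1
  hc : 0 < c
  hVc : ∀ s, Ym ≤ s → c + e ≤ V s
  hP : Ym - Y + 2 / c ≤ P
  hT : 1 ≤ T
  transfer : ∀ h, |h| ≤ e → ∀ (y z F : ℝ → ℝ) (η : ℝ),
    (∀ s ∈ Icc X Y, HasDerivAt y (z s) s) →
    (∀ s ∈ Icc X Y, HasDerivAt z ((V s - h) * y s + F s) s) →
    (∀ s ∈ Icc X Y, |F s| ≤ η) →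
    ∀ s ∈ Icc X Y, y s ^ 2 + z s ^ 2 ≤ T * (y Y ^ 2 + z Y ^ 2 + η ^ 2)

namespace FarData
variable {V : ℝ → ℝ} {X Y Ym e c P T : ℝ}

theorem q_nonneg (D : FarData V X Y Ym e c P T) {h : ℝ} (hh : |h| ≤ e) (s : ℝ) (hs : Y ≤ s) :
    0 ≤ V s - h := by
  linarith [D.hV s hs, (abs_le.1 hh).2]

theorem exists_dec (D : FarData V X Y Ym e c P T) {h : ℝ} (hh : |h| ≤ e) :
    ∃ y z, IsDecaying (fun s => V s - h) Y y z := by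
  obtain ⟨K, hK⟩ := D.bdd
  have := D.cont
  exact exists_isDecaying (K := K + e) (by fun_prop)
    (fun s => (abs_sub _ _).trans (add_le_add (hK s) hh)) (D.q_nonneg hh)

variable {h h₁ h₂ : ℝ} {y z y₁ z₁ y₂ z₂ : ℝ → ℝ}

theorem P_nonneg (D : FarData V X Y Ym e c P T) : 0 ≤ P := by
  have h1 := D.hP
  have h2 := D.hYm
  have h3 : 0 ≤ 2 / c := div_nonneg (by norm_num) D.hc.le
  linarith

theorem neg_two_le (D : FarData V X Y Ym e c P T) (hh : |h| ≤ e)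
    (H : IsDecaying (fun s => V s - h) Y y z) : -2 ≤ z Y :=
  H.neg_two_le fun s hs => by linarith [D.hV1 s hs, (abs_le.1 hh).1]

theorem integral_le (D : FarData V X Y Ym e c P T) (hh : |h| ≤ e)
    (H : IsDecaying (fun s => V s - h) Y y z) {t : ℝ} (ht : Y ≤ t) : ∫ s in Y..t, y s ≤ P :=
  (H.integral_le (D.q_nonneg hh) (D.neg_two_le hh H) D.hYm D.hc
    (fun s hs => by linarith [D.hVc s hs, (abs_le.1 hh).2]) ht).trans D.hP

theorem wronskian_bound (D : FarData V X Y Ym e c P T) (hh₁ : |h₁| ≤ e) (hh₂ : |h₂| ≤ e)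
    (H₁ : IsDecaying (fun s => V s - h₁) Y y₁ z₁) (H₂ : IsDecaying (fun s => V s - h₂) Y y₂ z₂)
    {t : ℝ} (ht : Y < t) : |z₁ t * y₂ t - y₁ t * z₂ t| ≤ 2 / (t - Y) := by
  have ht' : 0 < t - Y := sub_pos.2 ht
  have b1 := H₁.abs_deriv_le (D.q_nonneg hh₁) ht.le
  have b2 := H₂.abs_deriv_le (D.q_nonneg hh₂) ht.le
  have p1 := H₁.2.2 t ht.le
  have p2 := H₂.2.2 t ht.le
  have l1 := H₁.le_one ht.le
  have l2 := H₂.le_one ht.le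
  rw [← le_div_iff₀ ht'] at b1 b2
  have e1 : 2 / (t - Y) = 1 / (t - Y) + 1 / (t - Y) := by ring
  rw [e1, abs_le]
  constructor <;> nlinarith

theorem slope_diff (D : FarData V X Y Ym e c P T) (hh₁ : |h₁| ≤ e) (hh₂ : |h₂| ≤ e)
    (H₁ : IsDecaying (fun s => V s - h₁) Y y₁ z₁) (H₂ : IsDecaying (fun s => V s - h₂) Y y₂ z₂) :
    |z₁ Y - z₂ Y| ≤ P * |h₁ - h₂| := by
  refine le_of_forall_pos_le_add fun ε hε => ?_
  obtain ⟨t, ht, -, hte⟩ := exists_two_div_le hε 0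
  have e1 := wronskian_sub_eq H₁.1 H₂.1 Y t
  have e2 := D.wronskian_bound hh₁ hh₂ H₁ H₂ ht
  rw [H₁.2.1, H₂.2.1, mul_one, one_mul] at e1
  have c1 := H₁.1.continuous.1
  have c2 := H₂.1.continuous.1
  have i1 : 0 ≤ ∫ s in Y..t, y₁ s * y₂ s := intervalIntegral.integral_nonneg ht.le fun s hs =>
    mul_nonneg (H₁.2.2 s hs.1).1 (H₂.2.2 s hs.1).1
  have i2 : ∫ s in Y..t, y₁ s * y₂ s ≤ P := by
    refine le_trans ?_ (D.integral_le hh₁ H₁ ht.le)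
    refine intervalIntegral.integral_mono_on ht.le
      (Continuous.intervalIntegrable (by fun_prop) _ _) (c1.intervalIntegrable _ _) fun s hs => ?_
    nlinarith [H₂.le_one hs.1, (H₁.2.2 s hs.1).1]
  have e3 : |(h₂ - h₁) * ∫ s in Y..t, y₁ s * y₂ s| ≤ P * |h₁ - h₂| := by
    rw [abs_mul, abs_of_nonneg i1, abs_sub_comm, mul_comm]
    exact mul_le_mul_of_nonneg_right i2 (abs_nonneg _)
  have e4 : z₁ Y - z₂ Y = (z₁ t * y₂ t - y₁ t * z₂ t)
      - (h₂ - h₁) * ∫ s in Y..t, y₁ s * y₂ s := by linarith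
  rw [e4]
  refine (abs_sub _ _).trans ?_
  linarith

theorem continuousOn_eval (D : FarData V X Y Ym e c P T) {S₀ : ℝ} (hS : S₀ ≤ Y)
    {ψ ζ : ℝ → ℝ → ℝ} (H : ∀ h, |h| ≤ e → IsDecaying (fun s => V s - h) Y (ψ h) (ζ h)) :
    ContinuousOn (fun h => ψ h S₀) (Icc (-e) e) := by
  intro g hg
  obtain ⟨K, hK⟩ := D.bdd
  have hg' : |g| ≤ e := abs_le.2 hg
  have hK0 : 0 ≤ K := (abs_nonneg _).trans (hK 0)
  have he := D.he
  have cg := (H g hg').1.continuous.1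
  obtain ⟨B, hB⟩ := isCompact_Icc.exists_bound_of_continuousOn
    (s := Icc S₀ Y) (f := ψ g) cg.continuousOn
  set k : ℝ := K + e + 1 with hk
  have hk1 : 1 ≤ k := by linarith
  set A : ℝ := Real.exp (3 * k * (Y - S₀)) * (P ^ 2 + B ^ 2 / k * (Y - S₀)) with hA
  have hA0 : 0 ≤ A := by have := sub_nonneg.2 hS; positivity
  have key : ∀ h ∈ Icc (-e) e, ‖ψ h S₀ - ψ g S₀‖ ≤ Real.sqrt A * |h - g| := by
    intro h hh
    have hh' : |h| ≤ e := abs_le.2 hh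
    have hd := D.slope_diff hh' hg' (H h hh') (H g hg')
    have e1 := gronwall_sol (y := fun s => ψ h s - ψ g s) (z := fun s => ζ h s - ζ g s)
      (q := fun s => V s - h) (F := fun s => -(h - g) * ψ g s) (η := |h - g| * B) hS
      (k := k) (by linarith)
      (fun x _ => ((H h hh').1.1 x).sub ((H g hg').1.1 x))
      (fun x _ => (((H h hh').1.2 x).sub ((H g hg').1.2 x)).congr_deriv (by ring))
      (fun x _ => by
        have := (abs_sub (V x) h).trans (add_le_add (hK x) hh')
        nlinarith)
      (fun x hx => by
        rw [abs_mul, abs_neg]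
        exact mul_le_mul_of_nonneg_left (hB x hx) (abs_nonneg _))
    simp only [(H h hh').2.1, (H g hg').2.1, sub_self] at e1
    have e2 : (ζ h Y - ζ g Y) ^ 2 ≤ P ^ 2 * |h - g| ^ 2 := by
      rw [← mul_pow, ← sq_abs]
      exact pow_le_pow_left₀ (abs_nonneg _) hd 2
    have e3 : (ψ h S₀ - ψ g S₀) ^ 2 ≤ A * |h - g| ^ 2 := by
      have e4 : (ψ h S₀ - ψ g S₀) ^ 2 ≤ k ^ 2 * (ψ h S₀ - ψ g S₀) ^ 2 :=
        le_mul_of_one_le_left (sq_nonneg _) (by nlinarith)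
      have e5 : k ^ 2 * (0:ℝ) ^ 2 + (ζ h Y - ζ g Y) ^ 2 + (|h - g| * B) ^ 2 / k * (Y - S₀)
          ≤ (P ^ 2 + B ^ 2 / k * (Y - S₀)) * |h - g| ^ 2 := by
        have : (|h - g| * B) ^ 2 / k * (Y - S₀) = B ^ 2 / k * (Y - S₀) * |h - g| ^ 2 := by ring
        rw [this]; nlinarith
      have e6 := mul_le_mul_of_nonneg_left e5 (Real.exp_pos (3 * k * (Y - S₀))).le
      rw [hA, mul_assoc]
      nlinarith [sq_nonneg (ζ h S₀ - ζ g S₀)]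
    rw [Real.norm_eq_abs, ← Real.sqrt_sq_eq_abs]
    rw [show Real.sqrt A * |h - g| = Real.sqrt (A * |h - g| ^ 2) by
      rw [Real.sqrt_mul hA0, Real.sqrt_sq (abs_nonneg _)]]
    exact Real.sqrt_le_sqrt e3
  have : Tendsto (fun h => Real.sqrt A * |h - g|) (nhdsWithin g (Icc (-e) e)) (nhds 0) := by
    have hc : Continuous fun h => Real.sqrt A * |h - g| := by fun_prop
    have := hc.tendsto g
    simp only [sub_self, abs_zero, mul_zero] at this
    exact this.mono_left nhdsWithin_le_nhds
  refine tendsto_iff_norm_sub_tendsto_zero.2 (squeeze_zero' (Eventually.of_forall fun h =>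
    norm_nonneg _) ?_ this)
  filter_upwards [self_mem_nhdsWithin] with h hh using key h hh

theorem bound (D : FarData V X Y Ym e c P T) (hh : |h| ≤ e)
    (H : IsDecaying (fun s => V s - h) Y y z) :
    ∀ s ∈ Icc X Y, y s ^ 2 + z s ^ 2 ≤ 5 * T := by
  intro s hs
  have h1 := D.transfer h hh y z (fun _ => 0) 0 (fun s _ => H.1.1 s)
    (fun s _ => (H.1.2 s).congr_deriv (by ring)) (by simp) s hs
  have h2 := D.neg_two_le hh H
  have h3 := (H.2.2 Y le_rfl).2
  have h4 : y Y ^ 2 + z Y ^ 2 + 0 ^ 2 ≤ 5 := by rw [H.2.1]; nlinarith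
  nlinarith [mul_le_mul_of_nonneg_left h4 (zero_le_one.trans D.hT)]

theorem diff_bound (D : FarData V X Y Ym e c P T) (hh : |h| ≤ e)
    (H : IsDecaying (fun s => V s - h) Y y z) (H₀ : IsDecaying (fun s => V s - 0) Y y₁ z₁) :
    ∀ s ∈ Icc X Y, (y s - y₁ s) ^ 2 ≤ T * (P ^ 2 + 5 * T) * e ^ 2 := by
  intro s hs
  have h0 : |(0:ℝ)| ≤ e := by simpa using D.he.le
  have hd := D.slope_diff hh h0 H H₀
  rw [sub_zero] at hd
  have hT := D.hT
  have hP := D.P_nonneg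
  have h1 := D.transfer h hh (fun s => y s - y₁ s) (fun s => z s - z₁ s) (fun s => -h * y₁ s)
    (e * Real.sqrt (5 * T)) (fun s _ => (H.1.1 s).sub (H₀.1.1 s))
    (fun s _ => ((H.1.2 s).sub (H₀.1.2 s)).congr_deriv (by ring)) (fun s hs => by
      rw [abs_mul, abs_neg]
      refine mul_le_mul hh ?_ (abs_nonneg _) D.he.le
      refine Real.abs_le_sqrt ?_
      nlinarith [D.bound h0 H₀ s hs, sq_nonneg (z₁ s)]) s hs
  simp only [H.2.1, H₀.2.1, sub_self] at h1
  have h2 : (z Y - z₁ Y) ^ 2 ≤ P ^ 2 * e ^ 2 := by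
    rw [← mul_pow, ← sq_abs]
    exact pow_le_pow_left₀ (abs_nonneg _) (hd.trans (mul_le_mul_of_nonneg_left hh hP)) 2
  have h3 : (e * Real.sqrt (5 * T)) ^ 2 = 5 * T * e ^ 2 := by
    rw [mul_pow, Real.sq_sqrt (by linarith)]; ring
  rw [h3] at h1
  have h4 := mul_le_mul_of_nonneg_left h2 (zero_le_one.trans hT)
  nlinarith [sq_nonneg (z s - z₁ s)]

/-- The overlap of two decaying solutions with nearby spectral parameters is bounded below. -/
theorem overlap (D : FarData V X Y Ym e c P T) (hh : |h| ≤ e)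
    (H : IsDecaying (fun s => V s - h) Y y z) (H₀ : IsDecaying (fun s => V s - 0) Y y₁ z₁)
    (hsmall : (Y - X) * (T * (P ^ 2 + 5 * T) * e ^ 2) ≤ 1 / 32) {t : ℝ} (ht : Y + 1 / 4 ≤ t) :
    1 / 32 ≤ ∫ s in X..t, y s * y₁ s := by
  have h0 : |(0:ℝ)| ≤ e := by simpa using D.he.le
  have c1 := H.1.continuous.1
  have c2 := H₀.1.continuous.1
  have ci : ∀ a b, IntervalIntegrable (fun s => y s * y₁ s) volume a b := fun a b =>
    Continuous.intervalIntegrable (by fun_prop) _ _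
  rw [← intervalIntegral.integral_add_adjacent_intervals (ci X Y) (ci Y t),
    ← intervalIntegral.integral_add_adjacent_intervals (ci Y (Y + 1 / 4)) (ci _ t)]
  have i3 : 0 ≤ ∫ s in (Y + 1 / 4)..t, y s * y₁ s :=
    intervalIntegral.integral_nonneg ht fun s hs => mul_nonneg
      (H.2.2 s (by linarith [hs.1])).1 (H₀.2.2 s (by linarith [hs.1])).1
  have half : ∀ {g : ℝ} {v w : ℝ → ℝ}, |g| ≤ e → IsDecaying (fun s => V s - g) Y v w →
      ∀ s ∈ Icc Y (Y + 1 / 4), 1 / 2 ≤ v s := by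
    intro g v w hg G s hs
    have := le_of_deriv_nonneg (f := fun x => v x + 2 * x) (f' := fun x => w x + 2 * 1) hs.1
      (fun x _ => (G.1.1 x).add ((hasDerivAt_id x).const_mul 2)) (fun x hx => by
        linarith [G.monotone (D.q_nonneg hg) le_rfl hx.1, D.neg_two_le hg G])
    have e1 := G.2.1
    linarith [hs.2]
  have i2 : 1 / 16 ≤ ∫ s in Y..(Y + 1 / 4), y s * y₁ s := by
    have : ∫ s in Y..(Y + 1 / 4), (1 / 4 : ℝ) ≤ ∫ s in Y..(Y + 1 / 4), y s * y₁ s :=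
      intervalIntegral.integral_mono_on (by linarith) (by simp) (ci _ _) fun s hs => by
        nlinarith [half hh H s hs, half h0 H₀ s hs]
    rw [intervalIntegral.integral_const, smul_eq_mul] at this
    linarith
  have i1 : -(1 / 32) ≤ ∫ s in X..Y, y s * y₁ s := by
    have : ∫ s in X..Y, (-(T * (P ^ 2 + 5 * T) * e ^ 2) : ℝ) ≤ ∫ s in X..Y, y s * y₁ s :=
      intervalIntegral.integral_mono_on D.hXY (by simp) (ci _ _) fun s hs => by
        nlinarith [D.diff_bound hh H H₀ s hs, sq_nonneg (y s + y₁ s), sq_nonneg (y s - y₁ s)]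
    rw [intervalIntegral.integral_const, smul_eq_mul] at this
    linarith
  linarith

end FarData

/-- The solution vanishing at `S` with unit slope is increasing. -/
theorem IsSol.regular_pos {q g g' : ℝ → ℝ} (h : IsSol q g g') {S X : ℝ}
    (hq : ∀ s ∈ Icc S X, 0 ≤ q s) (h0 : g S = 0) (h1 : g' S = 1) :
    ∀ s ∈ Icc S X, s - S ≤ g s ∧ 1 ≤ g' s := by
  have hgg : ∀ s ∈ Icc S X, 0 ≤ g s * g' s := fun s hs => by
    have := le_of_deriv_nonneg (f := fun s => g s * g' s)
      (f' := fun s => g' s * g' s + g s * (q s * g s)) hs.1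
      (fun x _ => (h.1 x).mul (h.2 x)) (fun x hx => by
        have := hq x ⟨hx.1, hx.2.trans hs.2⟩
        nlinarith [mul_self_nonneg (g' x), mul_nonneg this (mul_self_nonneg (g x))])
    simpa [h0] using this
  have hsq : ∀ a b, S ≤ a → a ≤ b → b ≤ X → g a ^ 2 ≤ g b ^ 2 := fun a b ha hab hb =>
    le_of_deriv_nonneg (f := fun s => g s ^ 2) (f' := fun s => 2 * (g s * g' s)) hab
      (fun x _ => ((h.1 x).pow 2).congr_deriv (by ring))
      (fun x hx => by have := hgg x ⟨ha.trans hx.1, hx.2.trans hb⟩; linarith)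
  have hpos : ∀ s ∈ Icc S X, 0 ≤ g s := by
    intro s hs
    by_contra! hneg
    have hSs : S < s := lt_of_le_of_ne hs.1 (by rintro rfl; linarith)
    have hev : ∀ᶠ x in nhds S, 1 / 2 < g' x :=
      h.continuous.2.continuousAt.eventually_const_lt (by rw [h1]; norm_num)
    obtain ⟨δ, hδ, hball⟩ := Metric.eventually_nhds_iff.1 hev
    set p := min s (S + δ / 2) with hp
    have hpS : S < p := lt_min hSs (by linarith)
    have hps : p ≤ s := min_le_left _ _
    have hpδ : p ≤ S + δ / 2 := min_le_right _ _
    have hgp : 0 < g p := by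
      have := le_of_deriv_nonneg (f := fun x => g x - 1 / 2 * x) (f' := fun x => g' x - 1 / 2 * 1)
        hpS.le (fun x _ => (h.1 x).sub ((hasDerivAt_id x).const_mul _)) (fun x hx => by
          have := @hball x (by
            rw [Real.dist_eq, abs_of_nonneg (by linarith [hx.1])]; linarith [hx.2])
          linarith)
      rw [h0] at this
      linarith
    obtain ⟨r, hr, hr0⟩ := intermediate_value_Icc' hps h.continuous.1.continuousOn
      (show (0 : ℝ) ∈ Icc (g s) (g p) from ⟨hneg.le, hgp.le⟩)
    have := hsq p r hpS.le hr.1 (hr.2.trans hs.2)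
    rw [hr0] at this
    nlinarith
  intro c hc
  have hz : ∀ s ∈ Icc S c, 1 ≤ g' s := fun s hs =>
    h1 ▸ le_of_deriv_nonneg hs.1 (fun x _ => h.2 x) fun x hx =>
      mul_nonneg (hq x ⟨hx.1, (hx.2.trans hs.2).trans hc.2⟩)
        (hpos x ⟨hx.1, (hx.2.trans hs.2).trans hc.2⟩)
  refine ⟨?_, hz c ⟨hc.1, le_rfl⟩⟩
  have := le_of_deriv_nonneg (f := fun s => g s - s) (f' := fun s => g' s - 1) hc.1
    (fun x _ => (h.1 x).sub (hasDerivAt_id x)) (fun x hx => by linarith [hz x hx])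
  rw [h0] at this
  linarith

/-- The arithmetic behind the sign of the boundary value of a shifted decaying solution. -/
theorem shifted_sign {e h p g Ψ ψ ψS ΨS I J W R E d d' : ℝ} (he : 0 < e) (hhe : |h| = e) (hp : 0 < p)
    (hg : 0 < g) (hWb : |W| ≤ e / 64) (hΨ : |Ψ| ≤ R) (hprod : -E / 4 ≤ Ψ * ψ) (hI0 : 0 ≤ I)
    (hI1 : I ≤ d * (p * g)) (hJ : 1 / 32 ≤ J) (hE0 : 0 ≤ E) (hdd : d ≤ d') (hE : d' * E ≤ 1 / 64)
    (hcon : 128 * R * |ψS| < e * g)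
    (id1 : ΨS * ψ * g = Ψ * p * ψS - h * (Ψ * ψ * I + g * p * J) + p * g * -W) :
    0 < -h * (ΨS * ψ) := by
  have hpg : 0 < p * g := mul_pos hp hg
  have hhsq : h * h = e ^ 2 := by rw [← abs_mul_abs_self, hhe]; ring
  have b1 : -(e * (R * |ψS|)) ≤ -h * (Ψ * ψS) := by
    have : |h * (Ψ * ψS)| ≤ e * (R * |ψS|) := by
      rw [abs_mul, abs_mul, hhe]
      exact mul_le_mul_of_nonneg_left (mul_le_mul_of_nonneg_right hΨ (abs_nonneg _)) he.le
    linarith [le_abs_self (h * (Ψ * ψS))]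
  have b2 : -(1 / 256) * (p * g) ≤ Ψ * ψ * I := by
    have e1 : -E / 4 * I ≤ Ψ * ψ * I := mul_le_mul_of_nonneg_right hprod hI0
    have e2 : E / 4 * I ≤ E / 4 * (d * (p * g)) :=
      mul_le_mul_of_nonneg_left hI1 (by positivity)
    have e3 : E / 4 * d ≤ 1 / 256 := by
      have := mul_le_mul_of_nonneg_right hdd hE0
      linarith
    have e4 := mul_le_mul_of_nonneg_right e3 hpg.le
    linarith
  have b3 : -(e * (e / 64)) ≤ h * W := by
    have : |h * W| ≤ e * (e / 64) := by
      rw [abs_mul, hhe]; exact mul_le_mul_of_nonneg_left hWb he.le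
    linarith [neg_abs_le (h * W)]
  have id2 : -h * (ΨS * ψ) * g = p * (-h * (Ψ * ψS))
      + (h * h) * (Ψ * ψ * I + g * p * J) + p * g * (h * W) := by
    linear_combination (-h) * id1
  rw [hhsq] at id2
  have he2 : 0 < e ^ 2 := by positivity
  have b4 : 1 / 32 * (p * g) ≤ g * p * J := by
    have := mul_le_mul_of_nonneg_left hJ hpg.le
    linarith
  have c1 : p * -(e * (R * |ψS|)) ≤ p * (-h * (Ψ * ψS)) :=
    mul_le_mul_of_nonneg_left b1 hp.le
  have c2 : e ^ 2 * (7 / 256 * (p * g)) ≤ e ^ 2 * (Ψ * ψ * I + g * p * J) :=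
    mul_le_mul_of_nonneg_left (by linarith) he2.le
  have c3 : p * g * -(e * (e / 64)) ≤ p * g * (h * W) :=
    mul_le_mul_of_nonneg_left b3 hpg.le
  have c4 : p * e * (128 * R * |ψS|) < p * e * (e * g) :=
    mul_lt_mul_of_pos_left hcon (by positivity)
  have c5 : 0 < p * e * (e * g) := by positivity
  have c6 : 0 < -h * (ΨS * ψ) * g := by
    rw [id2]
    linarith
  exact pos_of_mul_pos_left c6 hg.le

namespace FarData
variable {V : ℝ → ℝ} {S X Y Ym e c P T : ℝ}

/-- If no shifted decaying solution vanishes at `S`, the unshifted one is quantitatively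
nonzero there. -/
theorem boundary_lower (D : FarData V X Y Ym e c P T) (hSX : S < X)
    (hVS : ∀ s ∈ Icc S X, e ≤ V s)
    (hsmall : (Y - S) * (T * (P ^ 2 + 5 * T) * e ^ 2) ≤ 1 / 64)
    (hno : ∀ h, |h| ≤ e → ∀ y z, IsDecaying (fun s => V s - h) Y y z → y S ≠ 0)
    {ψ ζ : ℝ → ℝ} (H₀ : IsDecaying (fun s => V s - 0) Y ψ ζ)
    {g g' : ℝ → ℝ} (hg : IsSol (fun s => V s - 0) g g') (hg0 : g S = 0) (hg1 : g' S = 1) :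
    e * g X ≤ 128 * Real.sqrt (5 * T) * |ψ S| := by
  have he := D.he
  have h0e : |(0:ℝ)| ≤ e := by simpa using he.le
  have hT := D.hT
  have hXY := D.hXY
  by_contra! hcon
  choose! Ψ Z hΨ using fun (h : ℝ) (hh : |h| ≤ e) => D.exists_dec hh
  have hXm : X ∈ Icc S X := ⟨hSX.le, le_rfl⟩
  have gpos := hg.regular_pos (X := X) (fun s hs => by linarith [hVS s hs]) hg0 hg1
  have hgX : 0 < g X := lt_of_lt_of_le (by linarith) (gpos X hXm).1
  obtain ⟨E, hE⟩ : ∃ E, E = T * (P ^ 2 + 5 * T) * e ^ 2 := ⟨_, rfl⟩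
  have hE0 : 0 ≤ E := by rw [hE]; positivity
  rw [← hE] at hsmall
  have hYXE : (Y - X) * E ≤ 1 / 32 := by
    have := mul_le_mul_of_nonneg_right (show Y - X ≤ Y - S by linarith) hE0
    linarith
  have main : ∀ h, |h| = e → 0 < -h * (Ψ h S * ψ X) := by
    intro h hhe
    have hh : |h| ≤ e := hhe.le
    have H := hΨ h hh
    obtain ⟨K, hK⟩ := D.bdd
    have hVc := D.cont
    obtain ⟨p, p', hp, hp0, hp1⟩ := exists_isSol (q := fun s => V s - h) (K := K + e)
      (by fun_prop) (fun s => (abs_sub _ _).trans (add_le_add (hK s) hh)) S 0 1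
    have ppos := hp.regular_pos (X := X) (fun s hs => by
      linarith [hVS s hs, (abs_le.1 hh).2]) hp0 hp1
    have hpX : 0 < p X := lt_of_lt_of_le (by linarith) (ppos X hXm).1
    -- Wronskian identities
    have w1 := wronskian_sub_eq hp H.1 S X
    have w2 := wronskian_sub_eq hg H₀.1 S X
    have w3 := wronskian_sub_eq hp hg S X
    rw [hp0, hp1] at w1
    rw [hg0, hg1] at w2
    rw [hp0, hp1, hg0, hg1] at w3
    simp only [sub_self, zero_mul, one_mul, sub_zero] at w1 w2 w3
    have monoP : ∀ a ∈ Icc S X, p a ≤ p X := fun a ha =>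
      le_of_deriv_nonneg ha.2 (fun x _ => hp.1 x) fun x hx => by
        linarith [(ppos x ⟨ha.1.trans hx.1, hx.2⟩).2]
    have monoG : ∀ a ∈ Icc S X, g a ≤ g X := fun a ha =>
      le_of_deriv_nonneg ha.2 (fun x _ => hg.1 x) fun x hx => by
        linarith [(gpos x ⟨ha.1.trans hx.1, hx.2⟩).2]
    have cp := hp.continuous.1
    have cg := hg.continuous.1
    have hI0 : 0 ≤ ∫ s in S..X, p s * g s := intervalIntegral.integral_nonneg hSX.le fun s hs =>
      mul_nonneg (by linarith [(ppos s hs).1, hs.1]) (by linarith [(gpos s hs).1, hs.1])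
    have hI1 : (∫ s in S..X, p s * g s) ≤ (X - S) * (p X * g X) := by
      have : (∫ s in S..X, p s * g s) ≤ ∫ s in S..X, p X * g X := by
        refine intervalIntegral.integral_mono_on hSX.le
          (Continuous.intervalIntegrable (by fun_prop) _ _) (by simp) fun s hs => ?_
        exact mul_le_mul (monoP s hs) (monoG s hs) (by linarith [(gpos s hs).1, hs.1]) hpX.le
      rwa [intervalIntegral.integral_const, smul_eq_mul] at this
    generalize (∫ s in S..X, p s * g s) = I at hI0 hI1 w3
    obtain ⟨t, htY, ht, hte⟩ := exists_two_div_le (Y := Y) (ε := e / 64) (by positivity) (Y + 1 / 4)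
    have w4 := wronskian_sub_eq H.1 H₀.1 X t
    have w4b := abs_le.1 (D.wronskian_bound hh h0e H H₀ htY)
    have hJ := D.overlap hh H H₀ (hE ▸ hYXE) ht
    generalize (∫ s in X..t, Ψ h s * ψ s) = J at hJ w4
    have hprod : -E / 4 ≤ Ψ h X * ψ X := by
      have := D.diff_bound hh H H₀ X ⟨le_rfl, hXY⟩
      rw [← hE] at this
      nlinarith [sq_nonneg (Ψ h X + ψ X)]
    have hΨX : |Ψ h X| ≤ Real.sqrt (5 * T) := Real.abs_le_sqrt (by
      nlinarith [D.bound hh H X ⟨le_rfl, hXY⟩, sq_nonneg (Z h X)])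
    -- the combined identity
    obtain ⟨W, hW⟩ : ∃ W, W = Z h t * ψ t - Ψ h t * ζ t := ⟨_, rfl⟩
    rw [← hW] at w4 w4b
    have id1 : Ψ h S * ψ X * g X = Ψ h X * p X * ψ S
        - h * (Ψ h X * ψ X * I + g X * p X * J) + p X * g X * -W := by
      linear_combination (-(ψ X * g X)) * w1 + (Ψ h X * p X) * w2 + (Ψ h X * ψ X) * w3
        + (p X * g X) * w4
    exact shifted_sign he hhe hpX hgX (abs_le.2 ⟨by linarith [w4b.1], w4b.2.trans hte⟩) hΨX hprod
      hI0 hI1 hJ hE0 (by linarith) hsmall hcon id1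
  have m1 := main e (abs_of_pos he)
  have m2 := main (-e) (by rw [abs_neg, abs_of_pos he])
  have m1' : Ψ e S * ψ X < 0 := by nlinarith
  have m2' : 0 < Ψ (-e) S * ψ X := by nlinarith
  have hcont : ContinuousOn (fun h => Ψ h S * ψ X) (Icc (-e) e) :=
    (D.continuousOn_eval (hSX.le.trans hXY) hΨ).mul continuousOn_const
  obtain ⟨h, hh, hh0⟩ := intermediate_value_Icc' (show -e ≤ e by linarith) hcont
    (show (0 : ℝ) ∈ Icc _ _ from ⟨m1'.le, m2'.le⟩)
  have hh' : |h| ≤ e := abs_le.2 hh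
  have hψX : ψ X ≠ 0 := by rintro h0; rw [h0] at m1'; simp at m1'
  rcases mul_eq_zero.1 hh0 with h1 | h1
  · exact hno h hh' _ _ (hΨ h hh') h1
  · exact hψX h1

end FarData

theorem IsSol.growth {q g g' : ℝ → ℝ} (h : IsSol q g g') {S X : ℝ} (hS : 0 < S) (hX : 2 * S ≤ X)
    (n : ℕ) (hq : ∀ s ∈ Icc S X, ((n : ℝ) + 2) * (n + 1) ≤ s ^ 2 * q s)
    (h0 : g S = 0) (h1 : g' S = 1) : S * (X / (4 * S)) ^ (n + 2) ≤ g X := by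
  have hq0 : ∀ s ∈ Icc S X, 0 ≤ q s := fun s hs => by
    have e1 := hq s hs
    have e2 : 0 < s ^ 2 := pow_pos (hS.trans_le hs.1) 2
    have e3 : (0:ℝ) ≤ ((n : ℝ) + 2) * (n + 1) := by positivity
    exact nonneg_of_mul_nonneg_right (e3.trans e1) e2
  have gp := h.regular_pos hq0 h0 h1
  let W : ℝ → ℝ := fun s => g' s * s ^ (n + 2) - (n + 2) * g s * s ^ (n + 1)
  have hW : ∀ s ∈ Icc S X, S ^ (n + 2) ≤ W s := by
    intro s hs
    have := le_of_deriv_nonneg (f := W)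
      (f' := fun s => s ^ n * g s * (s ^ 2 * q s - ((n : ℝ) + 2) * (n + 1))) hs.1
      (fun x _ => by
        have e1 := (h.2 x).mul (hasDerivAt_pow (n + 2) x)
        have e2 := ((h.1 x).const_mul ((n : ℝ) + 2)).mul (hasDerivAt_pow (n + 1) x)
        refine (e1.sub e2).congr_deriv ?_
        simp only [Nat.add_sub_cancel, show n + 2 - 1 = n + 1 from rfl]
        push_cast
        ring)
      (fun x hx => by
        have hx' : x ∈ Icc S X := ⟨hx.1, hx.2.trans hs.2⟩
        have e1 : 0 ≤ x ^ n := pow_nonneg (hS.le.trans hx.1) n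
        have e2 : 0 ≤ g x := by linarith [(gp x hx').1, hx.1]
        exact mul_nonneg (mul_nonneg e1 e2) (sub_nonneg.2 (hq x hx')))
    simp only [W, h0, h1] at this
    simpa using this
  have hv : ∀ s ∈ Icc S X, HasDerivAt (fun s => g s / s ^ (n + 2)) (W s / (s ^ (n + 2)) ^ 2) s := by
    intro s hs
    have hs0 : s ^ (n + 2) ≠ 0 := (pow_pos (hS.trans_le hs.1) _).ne'
    refine ((h.1 s).div (hasDerivAt_pow (n + 2) s) hs0).congr_deriv ?_
    simp only [W, show n + 2 - 1 = n + 1 from rfl]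
    push_cast
    ring
  have h2S : 2 * S ∈ Icc S X := ⟨by linarith, hX⟩
  have s1 : S / (4 * S) ^ (n + 2) ≤ g (2 * S) / (2 * S) ^ (n + 2) := by
    have := le_of_deriv_nonneg (f := fun s => g s / s ^ (n + 2) - 1 / (4 * S) ^ (n + 2) * s)
      (f' := fun s => W s / (s ^ (n + 2)) ^ 2 - 1 / (4 * S) ^ (n + 2) * 1) h2S.1
      (fun x hx => (hv x ⟨hx.1, hx.2.trans hX⟩).sub ((hasDerivAt_id x).const_mul _))
      (fun x hx => by
        have hx0 : 0 < x := hS.trans_le hx.1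
        have e1 := hW x ⟨hx.1, hx.2.trans hX⟩
        have e2 : (x ^ (n + 2)) ^ 2 ≤ ((2 * S) ^ (n + 2)) ^ 2 :=
          pow_le_pow_left₀ (by positivity) (pow_le_pow_left₀ hx0.le hx.2 _) 2
        have e3 : 1 / (4 * S) ^ (n + 2) * ((2 * S) ^ (n + 2)) ^ 2 = S ^ (n + 2) := by
          have : ((2 * S) ^ (n + 2)) ^ 2 = (4 * S) ^ (n + 2) * S ^ (n + 2) := by
            rw [← pow_mul, mul_comm (n + 2) 2, pow_mul, ← mul_pow]; ring
          rw [this]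
          have : (4 * S) ^ (n + 2) ≠ 0 := by positivity
          field_simp
        rw [mul_one, sub_nonneg, le_div_iff₀ (by positivity)]
        refine le_trans ?_ e1
        rw [← e3]
        exact mul_le_mul_of_nonneg_left e2 (by positivity))
    rw [h0, zero_div] at this
    have e : S / (4 * S) ^ (n + 2) = 1 / (4 * S) ^ (n + 2) * (2 * S) - 1 / (4 * S) ^ (n + 2) * S := by
      ring
    rw [e]
    linarith
  have s2 : g (2 * S) / (2 * S) ^ (n + 2) ≤ g X / X ^ (n + 2) :=
    le_of_deriv_nonneg hX (fun x hx => hv x ⟨h2S.1.trans hx.1, hx.2⟩) fun x hx =>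
      div_nonneg ((pow_nonneg hS.le _).trans (hW x ⟨h2S.1.trans hx.1, hx.2⟩)) (sq_nonneg _)
  have hX0 : 0 < X := by linarith
  have s3 := s1.trans s2
  rw [div_le_div_iff₀ (by positivity) (by positivity)] at s3
  rw [div_pow, mul_div_assoc', div_le_iff₀ (by positivity)]
  exact s3

namespace FarData
variable {V : ℝ → ℝ} {S X Y Ym e c P T : ℝ}

theorem integral_sq_le (D : FarData V X Y Ym e c P T) {ψ ζ : ℝ → ℝ}
    (H : IsDecaying (fun s => V s - 0) Y ψ ζ) {t : ℝ} (ht : X ≤ t) :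
    ∫ s in X..t, ψ s ^ 2 ≤ (Y - X) * (5 * T) + P := by
  have h0e : |(0:ℝ)| ≤ e := by simpa using D.he.le
  have cψ := H.1.continuous.1
  have ci : ∀ a b, IntervalIntegrable (fun s => ψ s ^ 2) volume a b := fun a b =>
    Continuous.intervalIntegrable (by fun_prop) _ _
  have i1 : ∫ s in X..Y, ψ s ^ 2 ≤ (Y - X) * (5 * T) := by
    have : ∫ s in X..Y, ψ s ^ 2 ≤ ∫ s in X..Y, (5 * T) :=
      intervalIntegral.integral_mono_on D.hXY (ci _ _) (by simp) fun s hs => by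
        nlinarith [D.bound h0e H s hs, sq_nonneg (ζ s)]
    rwa [intervalIntegral.integral_const, smul_eq_mul] at this
  have key : ∀ t, Y ≤ t → ∫ s in X..t, ψ s ^ 2 ≤ (Y - X) * (5 * T) + P := by
    intro t ht
    rw [← intervalIntegral.integral_add_adjacent_intervals (ci X Y) (ci Y t)]
    have : ∫ s in Y..t, ψ s ^ 2 ≤ ∫ s in Y..t, ψ s :=
      intervalIntegral.integral_mono_on ht (ci _ _) (cψ.intervalIntegrable _ _) fun s hs => by
        nlinarith [H.le_one hs.1, (H.2.2 s hs.1).1]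
    linarith [D.integral_le h0e H ht]
  rcases le_total Y t with h | h
  · exact key t h
  · refine le_trans ?_ (key Y le_rfl)
    exact intervalIntegral.integral_mono_interval le_rfl ht h (ae_of_all _ fun s => sq_nonneg _)
      (ci _ _)

set_option maxHeartbeats 800000 in
/-- Concentration of the decaying solution near the left end of the barrier. -/
theorem concentration (D : FarData V X Y Ym e c P T) {ψ ζ : ℝ → ℝ}
    (H : IsDecaying (fun s => V s - 0) Y ψ ζ) {b k Λ B K : ℝ} (hS : 0 < S) (hSb : S ≤ b)
    (hbX : b + 1 ≤ X) (hk : 1 ≤ k) (hVk : ∀ s ∈ Icc S (b + 1), V s ≤ k ^ 2)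
    (hΛ : 4 < Λ) (hVΛ : ∀ s ∈ Icc S X, Λ / 4 ≤ s ^ 2 * V s)
    (hB : 0 < B) (hB1 : 5 * T ≤ B ^ 2) (hB2 : X ^ 2 * (5 * T) ≤ B ^ 2)
    (hB3 : (Y - X) * (5 * T) + P ≤ B ^ 2)
    (hbig : Real.exp (3 * k * (b - S)) * (10 * k ^ 4) * B ^ 2 < ψ S ^ 2)
    (hK : 1 + b ^ 2 * (2 + k ^ 2) + b ≤ (Λ / 4 - 1) * (K - 1)) :
    B < |ψ b| ∧ ψ b * ζ b ≤ 0 ∧ ∀ t, b ≤ t → ∫ s in b..t, ψ s ^ 2 ≤ K * ψ b ^ 2 := by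
  have h0e : |(0:ℝ)| ≤ e := by simpa using D.he.le
  have hV0 : ∀ s ∈ Icc S X, 0 ≤ V s := fun s hs => by
    have e1 := hVΛ s hs
    have e2 : 0 < s ^ 2 := pow_pos (hS.trans_le hs.1) 2
    exact nonneg_of_mul_nonneg_right (by linarith : 0 ≤ s ^ 2 * V s) e2
  have hbS : 0 < b := hS.trans_le hSb
  have hbX' : b ≤ X := by linarith
  have hXX := D.bound h0e H X ⟨le_rfl, D.hXY⟩
  have hψX : ψ X ^ 2 ≤ B ^ 2 := by nlinarith [sq_nonneg (ζ X)]
  have cψ := H.1.continuous.1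
  have cζ := H.1.continuous.2
  -- monotonicity of `ψ ζ` and `ψ ^ 2`
  have mono1 : ∀ a c, S ≤ a → a ≤ c → c ≤ X → ψ a * ζ a ≤ ψ c * ζ c := fun a c ha hac hc =>
    le_of_deriv_nonneg (f' := fun s => ζ s * ζ s + ψ s * ((V s - 0) * ψ s)) hac
      (fun x _ => (H.1.1 x).mul (H.1.2 x)) fun x hx => by
        have := hV0 x ⟨ha.trans hx.1, hx.2.trans hc⟩
        nlinarith [mul_self_nonneg (ζ x), mul_nonneg this (mul_self_nonneg (ψ x))]
  have conv : ∀ s ∈ Icc b X, ψ s ^ 2 ≤ max (ψ b ^ 2) (ψ X ^ 2) := by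
    intro s hs
    rcases le_total (ψ s * ζ s) 0 with h | h
    · refine le_trans ?_ (le_max_left _ _)
      have := le_of_deriv_nonneg (f := fun s => -(ψ s ^ 2)) (f' := fun s => -(2 * (ψ s * ζ s))) hs.1
        (fun x _ => (((H.1.1 x).pow 2).neg).congr_deriv (by ring))
        (fun x hx => by linarith [mono1 x s (hSb.trans hx.1) hx.2 hs.2])
      linarith
    · refine le_trans ?_ (le_max_right _ _)
      exact le_of_deriv_nonneg (f' := fun s => 2 * (ψ s * ζ s)) hs.2
        (fun x _ => ((H.1.1 x).pow 2).congr_deriv (by ring))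
        (fun x hx => by linarith [mono1 s x (hSb.trans hs.1) hx.1 hx.2])
  set m := max |ψ b| B with hm
  have hm0 : 0 < m := lt_max_of_lt_right hB
  have hψm : ∀ s ∈ Icc b X, |ψ s| ≤ m := by
    intro s hs
    refine abs_le_of_sq_le_sq ((conv s hs).trans (max_le ?_ ?_)) hm0.le
    · rw [← sq_abs]; exact pow_le_pow_left₀ (abs_nonneg _) (le_max_left _ _) 2
    · exact hψX.trans (pow_le_pow_left₀ hB.le (le_max_right _ _) 2)
  have hζb : |ζ b| ≤ (2 + k ^ 2) * m := by
    obtain ⟨ξ, hξ, hξ'⟩ := exists_hasDerivAt_eq_slope ψ ζ (show b < b + 1 by linarith)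
      cψ.continuousOn (fun x _ => H.1.1 x)
    have e1 := abs_le.1 (hψm b ⟨le_rfl, hbX'⟩)
    have e2 := abs_le.1 (hψm (b + 1) ⟨by linarith, hbX⟩)
    have e3 : ζ ξ = ψ (b + 1) - ψ b := by rw [hξ']; simp
    have e4 : ∀ x ∈ Icc b ξ, |(V x - 0) * ψ x| ≤ k ^ 2 * m := fun x hx => by
      rw [abs_mul, sub_zero, abs_of_nonneg (hV0 x ⟨hSb.trans hx.1, by linarith [hx.2, hξ.2]⟩)]
      exact mul_le_mul (hVk x ⟨hSb.trans hx.1, by linarith [hx.2, hξ.2]⟩)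
        (hψm x ⟨hx.1, by linarith [hx.2, hξ.2]⟩) (abs_nonneg _) (by positivity)
    have e5 := le_of_deriv_nonneg (f := fun x => ζ x + k ^ 2 * m * x)
      (f' := fun x => (V x - 0) * ψ x + k ^ 2 * m * 1) hξ.1.le
      (fun x _ => (H.1.2 x).add ((hasDerivAt_id x).const_mul _))
      (fun x hx => by linarith [(abs_le.1 (e4 x hx)).1])
    have e6 := le_of_deriv_nonneg (f := fun x => k ^ 2 * m * x - ζ x)
      (f' := fun x => k ^ 2 * m * 1 - (V x - 0) * ψ x) hξ.1.le
      (fun x _ => ((hasDerivAt_id x).const_mul _).sub (H.1.2 x))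
      (fun x hx => by linarith [(abs_le.1 (e4 x hx)).2])
    have hkm : 0 ≤ k ^ 2 * m := by positivity
    have e7 : k ^ 2 * m * (ξ - b) ≤ k ^ 2 * m := by nlinarith [hξ.2]
    rw [abs_le]
    constructor <;> linarith
  have hmain : ψ S ^ 2 ≤ Real.exp (3 * k * (b - S)) * (10 * k ^ 4) * m ^ 2 := by
    have e1 := gronwall_sol (y := ψ) (z := ζ) (q := fun s => V s - 0) (F := fun _ => 0) (η := 0)
      (k := k) hSb (by linarith) (fun x _ => H.1.1 x)
      (fun x _ => (H.1.2 x).congr_deriv (by ring))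
      (fun x hx => by
        rw [sub_zero, abs_of_nonneg (hV0 x ⟨hx.1, hx.2.trans hbX'⟩)]
        exact hVk x ⟨hx.1, by linarith [hx.2]⟩) (by simp)
    have e2 : ζ b ^ 2 ≤ ((2 + k ^ 2) * m) ^ 2 := by
      rw [← sq_abs]; exact pow_le_pow_left₀ (abs_nonneg _) hζb 2
    have e3 : ψ b ^ 2 ≤ m ^ 2 := by
      rw [← sq_abs]; exact pow_le_pow_left₀ (abs_nonneg _) (le_max_left _ _) 2
    have hk2 : 1 ≤ k ^ 2 := one_le_pow₀ hk
    have e4 : k ^ 2 * ψ b ^ 2 + ζ b ^ 2 + 0 ^ 2 / k * (b - S) ≤ 10 * k ^ 4 * m ^ 2 := by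
      have : (k ^ 2 + (2 + k ^ 2) ^ 2) * m ^ 2 ≤ 10 * k ^ 4 * m ^ 2 :=
        mul_le_mul_of_nonneg_right (by nlinarith) (sq_nonneg m)
      have := mul_le_mul_of_nonneg_left e3 (sq_nonneg k)
      simp only [ne_eq, OfNat.ofNat_ne_zero, not_false_eq_true, zero_pow, zero_div, zero_mul]
      nlinarith
    have e5 := mul_le_mul_of_nonneg_left e4 (Real.exp_pos (3 * k * (b - S))).le
    have e6 : ψ S ^ 2 ≤ k ^ 2 * ψ S ^ 2 := le_mul_of_one_le_left (sq_nonneg _) hk2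
    rw [mul_assoc]
    exact (e6.trans (le_add_of_nonneg_right (sq_nonneg (ζ S)))).trans (e1.trans e5)
  have hBψ : B < |ψ b| := by
    by_contra! hcon
    have : m = B := max_eq_right hcon
    rw [this] at hmain
    linarith
  have hmψ : m = |ψ b| := max_eq_left hBψ.le
  have hBsq : B ^ 2 < ψ b ^ 2 := by
    rw [← sq_abs (ψ b)]; exact pow_lt_pow_left₀ hBψ hB.le (by norm_num)
  have hneg : ψ b * ζ b ≤ 0 := by
    by_contra! hpos
    have : ψ b ^ 2 ≤ ψ X ^ 2 := le_of_deriv_nonneg (f' := fun s => 2 * (ψ s * ζ s)) hbX'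
        (fun x _ => ((H.1.1 x).pow 2).congr_deriv (by ring))
        (fun x hx => by linarith [mono1 b x hSb hx.1 hx.2])
    linarith
  refine ⟨hBψ, hneg, ?_⟩
  have ci : ∀ a b, IntervalIntegrable (fun s => ψ s ^ 2) volume a b := fun a b =>
    Continuous.intervalIntegrable (by fun_prop) _ _
  have barrier : (Λ / 4 - 1) * ∫ s in b..X, ψ s ^ 2 ≤ (Λ / 4 - 1) * ((K - 1) * ψ b ^ 2) := by
    have e1 := sub_le_integral_of_deriv_le (f := fun s => -(s ^ 2 * (ψ s * ζ s) - s * ψ s ^ 2))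
      (f' := fun s => -(s ^ 2 * ζ s ^ 2 + s ^ 2 * V s * ψ s ^ 2 - ψ s ^ 2))
      (g := fun s => -((Λ / 4 - 1) * ψ s ^ 2)) hbX'
      (fun x _ => by
        have d1 := (hasDerivAt_pow 2 x).mul ((H.1.1 x).mul (H.1.2 x))
        have d2 := (hasDerivAt_id x).mul ((H.1.1 x).pow 2)
        refine ((d1.sub d2).neg).congr_deriv ?_
        simp only [id, Pi.mul_apply, Pi.pow_apply]
        push_cast
        ring)
      (by fun_prop)
      (fun x hx => by
        have := hVΛ x ⟨hSb.trans hx.1, hx.2⟩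
        nlinarith [mul_le_mul_of_nonneg_right this (sq_nonneg (ψ x)),
          mul_nonneg (sq_nonneg x) (sq_nonneg (ζ x))])
    rw [intervalIntegral.integral_neg, intervalIntegral.integral_const_mul] at e1
    have e2 : ψ X * ζ X ≤ 5 * T := by nlinarith [sq_nonneg (ψ X - ζ X), sq_nonneg (ψ X)]
    have e3 : X ^ 2 * (ψ X * ζ X) ≤ ψ b ^ 2 := by
      have := mul_le_mul_of_nonneg_left e2 (sq_nonneg X)
      linarith
    have e4 : -(ψ b * ζ b) ≤ (2 + k ^ 2) * ψ b ^ 2 := by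
      rw [hmψ] at hζb
      have : |ψ b * ζ b| ≤ |ψ b| * ((2 + k ^ 2) * |ψ b|) := by
        rw [abs_mul]; exact mul_le_mul_of_nonneg_left hζb (abs_nonneg _)
      nlinarith [neg_abs_le (ψ b * ζ b), sq_abs (ψ b)]
    have e5 := mul_le_mul_of_nonneg_left e4 (sq_nonneg b)
    have e6 := mul_le_mul_of_nonneg_right hK (sq_nonneg (ψ b))
    have hX0 : 0 ≤ X * ψ X ^ 2 := mul_nonneg (by linarith) (sq_nonneg _)
    linarith
  have barrier' : ∫ s in b..X, ψ s ^ 2 ≤ (K - 1) * ψ b ^ 2 :=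
    le_of_mul_le_mul_left barrier (by linarith)
  have key : ∀ t, X ≤ t → ∫ s in b..t, ψ s ^ 2 ≤ K * ψ b ^ 2 := by
    intro t ht
    rw [← intervalIntegral.integral_add_adjacent_intervals (ci b X) (ci X t)]
    linarith [D.integral_sq_le H ht]
  intro t ht
  rcases le_total X t with h | h
  · exact key t h
  · refine le_trans ?_ (key X le_rfl)
    exact intervalIntegral.integral_mono_interval le_rfl ht h (ae_of_all _ fun s => sq_nonneg _)
      (ci _ _)

end FarData

theorem integral_mul_sq_le {f g : ℝ → ℝ} (hf : Continuous f) (hg : Continuous g) {a b : ℝ}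
    (hab : a ≤ b) :
    (∫ s in a..b, f s * g s) ^ 2 ≤ (∫ s in a..b, f s ^ 2) * ∫ s in a..b, g s ^ 2 := by
  have key : ∀ t : ℝ, 0 ≤ (∫ s in a..b, f s ^ 2) * (t * t) + (2 * ∫ s in a..b, f s * g s) * t
      + ∫ s in a..b, g s ^ 2 := by
    intro t
    have h1 : 0 ≤ ∫ s in a..b, (t * f s + g s) ^ 2 :=
      intervalIntegral.integral_nonneg hab fun s _ => sq_nonneg _
    have h2 : ∫ s in a..b, (t * f s + g s) ^ 2
        = ∫ s in a..b, ((t * t) * f s ^ 2 + (2 * t) * (f s * g s) + g s ^ 2) := by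
      congr 1; ext s; ring
    rw [h2, intervalIntegral.integral_add, intervalIntegral.integral_add,
      intervalIntegral.integral_const_mul, intervalIntegral.integral_const_mul] at h1
    · linarith
    all_goals exact Continuous.intervalIntegrable (by fun_prop) _ _
  have := discrim_le_zero key
  rw [discrim] at this
  nlinarith

theorem robin_of_decay {V ψ ζ a a₁ h : ℝ → ℝ} {b K A N : ℝ} (hψ : IsSol (fun s => V s - 0) ψ ζ)
    (ha : ∀ s, HasDerivAt a (a₁ s) s) (ha₁ : ∀ s, HasDerivAt a₁ (V s * a s + h s) s)
    (hh : Continuous h) (hA : ∀ t, b ≤ t → ∫ s in b..t, h s ^ 2 ≤ A)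
    (hK : ∀ t, b ≤ t → ∫ s in b..t, ψ s ^ 2 ≤ K * ψ b ^ 2)
    (hN : ∀ᶠ t in atTop, |ψ t| ≤ N ∧ |ζ t| ≤ N)
    (la : Tendsto a atTop (nhds 0)) (la₁ : Tendsto a₁ atTop (nhds 0)) (hb : ψ b ≠ 0) :
    (a₁ b - ζ b / ψ b * a b) ^ 2 ≤ A * K := by
  have cψ := hψ.continuous.1
  have key : ∀ᶠ t in atTop, |a₁ b * ψ b - a b * ζ b| ≤
      (|a₁ t| + |a t|) * N + Real.sqrt (A * (K * ψ b ^ 2)) := by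
    filter_upwards [hN, eventually_ge_atTop b] with t ht hbt
    have e1 : ∫ s in b..t, h s * ψ s = (a₁ t * ψ t - a t * ζ t) - (a₁ b * ψ b - a b * ζ b) :=
      intervalIntegral.integral_eq_sub_of_hasDerivAt (f := fun s => a₁ s * ψ s - a s * ζ s)
        (fun x _ => (((ha₁ x).mul (hψ.1 x)).sub ((ha x).mul (hψ.2 x))).congr_deriv (by ring))
        (Continuous.intervalIntegrable (by fun_prop) _ _)
    have e2 : |∫ s in b..t, h s * ψ s| ≤ Real.sqrt (A * (K * ψ b ^ 2)) := by
      refine Real.abs_le_sqrt ((integral_mul_sq_le hh cψ hbt).trans ?_)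
      exact mul_le_mul (hA t hbt) (hK t hbt)
        (intervalIntegral.integral_nonneg hbt fun s _ => sq_nonneg _)
        ((intervalIntegral.integral_nonneg hbt fun s _ => sq_nonneg _).trans (hA t hbt))
    have e3 : |a₁ t * ψ t - a t * ζ t| ≤ (|a₁ t| + |a t|) * N := by
      calc |a₁ t * ψ t - a t * ζ t| ≤ |a₁ t * ψ t| + |a t * ζ t| := abs_sub _ _
        _ ≤ |a₁ t| * N + |a t| * N := by
          rw [abs_mul, abs_mul]
          exact add_le_add (mul_le_mul_of_nonneg_left ht.1 (abs_nonneg _))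
            (mul_le_mul_of_nonneg_left ht.2 (abs_nonneg _))
        _ = _ := by ring
    have e4 : a₁ b * ψ b - a b * ζ b = (a₁ t * ψ t - a t * ζ t) - ∫ s in b..t, h s * ψ s := by
      rw [e1]; ring
    rw [e4]
    exact (abs_sub _ _).trans (add_le_add e3 e2)
  have lim : Tendsto (fun t => (|a₁ t| + |a t|) * N + Real.sqrt (A * (K * ψ b ^ 2))) atTop
      (nhds ((|0| + |0|) * N + Real.sqrt (A * (K * ψ b ^ 2)))) :=
    ((la₁.abs.add la.abs).mul_const N).add_const _
  have fin := ge_of_tendsto lim key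
  simp only [abs_zero, add_zero, zero_mul, zero_add] at fin
  have hA0 : 0 ≤ A := by simpa using hA b le_rfl
  have hK0 : 0 ≤ K * ψ b ^ 2 := by simpa using hK b le_rfl
  have sq : (a₁ b * ψ b - a b * ζ b) ^ 2 ≤ A * (K * ψ b ^ 2) := by
    rw [← sq_abs, ← Real.sq_sqrt (mul_nonneg hA0 hK0)]
    exact pow_le_pow_left₀ (abs_nonneg _) fin 2
  have e : a₁ b - ζ b / ψ b * a b = (a₁ b * ψ b - a b * ζ b) / ψ b := by field_simp
  rw [e, div_pow, div_le_iff₀ (by positivity)]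
  linarith

theorem lintegral_lt_top_of_integral_le {f : ℝ → ℝ} (hf : Continuous f) (hf0 : ∀ s, 0 ≤ f s)
    {S Y K : ℝ} (hK : ∀ t, Y ≤ t → ∫ s in Y..t, f s ≤ K) :
    ∫⁻ x in Ioi S, ENNReal.ofReal (f x) < ⊤ := by
  have : IntegrableOn f (Ioi S) := by
    refine integrableOn_Ioi_of_intervalIntegral_norm_bounded ((∫ s in S..Y, f s) + K) S
      (fun i : ℝ => hf.integrableOn_Ioc) tendsto_id ?_
    filter_upwards [eventually_ge_atTop Y] with t ht
    simp only [Real.norm_of_nonneg (hf0 _), id]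
    rw [← intervalIntegral.integral_add_adjacent_intervals (hf.intervalIntegrable S Y)
      (hf.intervalIntegrable Y t)]
    linarith [hK t ht]
  exact this.lintegral_lt_top

namespace FarData
variable {V : ℝ → ℝ} {S X Y Ym e c P T : ℝ}

theorem isDirichletEV (D : FarData V X Y Ym e c P T) {M m E : ℝ} {rofs : ℝ → ℝ} {L : ℕ} {μ h : ℝ}
    (hW : ∀ s, V s = W0 M m E rofs L s + μ) (hSY : S < Y) (hh : |h| ≤ e) {ψ ζ : ℝ → ℝ}
    (H : IsDecaying (fun s => V s - h) Y ψ ζ) (h0 : ψ S = 0) :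
    IsDirichletEV M m E rofs L S (h - μ) := by
  have cψ := H.1.continuous.1
  have cζ := H.1.continuous.2
  have cV := D.cont
  have d1 : deriv ψ = ζ := funext fun s => (H.1.1 s).deriv
  have d2 : deriv ζ = fun s => (V s - h) * ψ s := funext fun s => (H.1.2 s).deriv
  have hψ2 : ∀ t, Y ≤ t → ∫ s in Y..t, ψ s ^ 2 ≤ P := fun t ht => by
    refine le_trans ?_ (D.integral_le hh H ht)
    exact intervalIntegral.integral_mono_on ht (Continuous.intervalIntegrable (by fun_prop) _ _)
      (cψ.intervalIntegrable _ _) fun s hs => by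
        nlinarith [H.le_one hs.1, (H.2.2 s hs.1).1]
  refine ⟨ψ, ⟨Y, hSY, by simp [H.2.1]⟩, ?_, ?_, ?_, ?_, ?_, ?_⟩
  · have : ContDiff ℝ 2 ψ := by
      rw [show (2 : WithTop ℕ∞) = 1 + 1 from rfl, contDiff_succ_iff_deriv]
      refine ⟨fun s => (H.1.1 s).differentiableAt, by simp, ?_⟩
      rw [d1, contDiff_one_iff_deriv, d2]
      exact ⟨fun s => (H.1.2 s).differentiableAt, by fun_prop⟩
    exact this.contDiffOn
  · exact lintegral_lt_top_of_integral_le (by fun_prop) (fun _ => sq_nonneg _) hψ2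
  · rw [d1]
    refine lintegral_lt_top_of_integral_le (K := 2) (Y := Y) (by fun_prop) (fun _ => sq_nonneg _)
      fun t ht => ?_
    have e1 : ∫ s in Y..t, ζ s ^ 2 ≤ ∫ s in Y..t, -2 * ζ s :=
      intervalIntegral.integral_mono_on ht (Continuous.intervalIntegrable (by fun_prop) _ _)
        (Continuous.intervalIntegrable (by fun_prop) _ _) fun s hs => by
          have := (D.neg_two_le hh H).trans (H.monotone (D.q_nonneg hh) le_rfl hs.1)
          nlinarith [(H.2.2 s hs.1).2]
    rw [intervalIntegral.integral_const_mul, intervalIntegral.integral_eq_sub_of_hasDerivAt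
      (fun x _ => H.1.1 x) (cζ.intervalIntegrable _ _), H.2.1] at e1
    linarith [(H.2.2 t ht).1]
  · rw [d1, d2]
    obtain ⟨K, hK⟩ := D.bdd
    have hK0 : 0 ≤ K := (abs_nonneg _).trans (hK 0)
    refine lintegral_lt_top_of_integral_le (K := (K + e) ^ 2 * P) (Y := Y) (by fun_prop)
      (fun _ => sq_nonneg _) fun t ht => ?_
    have e1 : ∫ s in Y..t, ((V s - h) * ψ s) ^ 2 ≤ ∫ s in Y..t, (K + e) ^ 2 * ψ s ^ 2 :=
      intervalIntegral.integral_mono_on ht (Continuous.intervalIntegrable (by fun_prop) _ _)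
        (Continuous.intervalIntegrable (by fun_prop) _ _) fun s hs => by
          rw [mul_pow]
          refine mul_le_mul_of_nonneg_right ?_ (sq_nonneg _)
          rw [← sq_abs]
          exact pow_le_pow_left₀ (abs_nonneg _) ((abs_sub _ _).trans (add_le_add (hK s) hh)) 2
    rw [intervalIntegral.integral_const_mul] at e1
    exact e1.trans (mul_le_mul_of_nonneg_left (hψ2 t ht) (sq_nonneg _))
  · rw [← h0]
    exact cψ.continuousAt.mono_left nhdsWithin_le_nhds
  · intro x _
    rw [d1, d2]
    have := hW x
    have e2 : W0 M m E rofs L x = V x - μ := by linarith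
    simp only [e2]
    ring

/-- Under a quantitative non-resonance condition, solutions decaying at infinity satisfy a
dissipative Robin condition at `b`, up to an error controlled by the source. -/
theorem robin (D : FarData V X Y Ym e c P T) {b k Λ B K G : ℝ} (n : ℕ)
    (hS : 0 < S) (hSX : 2 * S ≤ X) (hSb : S ≤ b) (hbX : b + 1 ≤ X) (hk : 1 ≤ k)
    (hVk : ∀ s ∈ Icc S (b + 1), V s ≤ k ^ 2)
    (hΛ : 4 < Λ) (hVΛ : ∀ s ∈ Icc S X, Λ / 4 ≤ s ^ 2 * V s)
    (hVe : ∀ s ∈ Icc S X, e ≤ V s)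
    (hn : ((n : ℝ) + 2) * (n + 1) ≤ Λ / 4)
    (hsmall : (Y - S) * (T * (P ^ 2 + 5 * T) * e ^ 2) ≤ 1 / 64)
    (hno : ∀ h, |h| ≤ e → ∀ y z, IsDecaying (fun s => V s - h) Y y z → y S ≠ 0)
    (hB : 0 < B) (hB1 : 5 * T ≤ B ^ 2) (hB2 : X ^ 2 * (5 * T) ≤ B ^ 2)
    (hB3 : (Y - X) * (5 * T) + P ≤ B ^ 2) (hG : G ≤ S * (X / (4 * S)) ^ (n + 2)) (hG0 : 0 ≤ G)
    (hbig : Real.exp (3 * k * (b - S)) * (10 * k ^ 4) * B ^ 4 * 128 ^ 2 < (e * G) ^ 2)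
    (hK : 1 + b ^ 2 * (2 + k ^ 2) + b ≤ (Λ / 4 - 1) * (K - 1)) :
    ∃ θ ≤ 0, ∀ (a a₁ h : ℝ → ℝ) (A : ℝ), (∀ s, HasDerivAt a (a₁ s) s) →
      (∀ s, HasDerivAt a₁ (V s * a s + h s) s) → Continuous h →
      (∀ t, b ≤ t → ∫ s in b..t, h s ^ 2 ≤ A) → Tendsto a atTop (nhds 0) →
      Tendsto a₁ atTop (nhds 0) → (a₁ b - θ * a b) ^ 2 ≤ A * K := by
  have h0e : |(0:ℝ)| ≤ e := by simpa using D.he.le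
  obtain ⟨ψ, ζ, H⟩ := D.exists_dec h0e
  obtain ⟨K₀, hK₀⟩ := D.bdd
  have cV := D.cont
  obtain ⟨g, g', hg, hg0, hg1⟩ := exists_isSol (q := fun s => V s - 0) (by fun_prop)
    (K := K₀) (by simpa using hK₀) S 0 1
  have low := D.boundary_lower (by linarith) hVe hsmall hno H hg hg0 hg1
  have gro := hg.growth hS hSX n (fun s hs => by
    rw [sub_zero]; exact hn.trans (hVΛ s hs)) hg0 hg1
  have hbig' : Real.exp (3 * k * (b - S)) * (10 * k ^ 4) * B ^ 2 < ψ S ^ 2 := by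
    have e1 : e * G ≤ 128 * Real.sqrt (5 * T) * |ψ S| :=
      (mul_le_mul_of_nonneg_left (hG.trans gro) D.he.le).trans low
    have e2 : (e * G) ^ 2 ≤ (128 * Real.sqrt (5 * T) * |ψ S|) ^ 2 :=
      pow_le_pow_left₀ (mul_nonneg D.he.le hG0) e1 2
    have hT := D.hT
    rw [mul_pow (128 * Real.sqrt (5 * T)), mul_pow 128, Real.sq_sqrt (by linarith), sq_abs] at e2
    have e3 : 128 ^ 2 * (5 * T) * ψ S ^ 2 ≤ 128 ^ 2 * B ^ 2 * ψ S ^ 2 := by gcongr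
    have e4 := (hbig.trans_le e2).trans_le e3
    have hB2 : 0 < 128 ^ 2 * B ^ 2 := by positivity
    refine lt_of_mul_lt_mul_left ?_ hB2.le
    calc _ = _ := by ring
      _ < _ := e4
  obtain ⟨c1, c2, c3⟩ := D.concentration H hS hSb hbX hk hVk hΛ hVΛ hB hB1 hB2 hB3 hbig' hK
  have hb0 : ψ b ≠ 0 := fun h => by rw [h, abs_zero] at c1; linarith
  refine ⟨ζ b / ψ b, ?_, ?_⟩
  · rw [show ζ b / ψ b = ψ b * ζ b / ψ b ^ 2 by field_simp]
    exact div_nonpos_of_nonpos_of_nonneg c2 (sq_nonneg _)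
  · intro a a₁ h A ha ha₁ hh hA la la₁
    refine robin_of_decay (N := 2) H.1 ha ha₁ hh hA c3 ?_ la la₁ hb0
    filter_upwards [eventually_ge_atTop Y] with t ht
    have m1 := (D.neg_two_le h0e H).trans (H.monotone (D.q_nonneg h0e) le_rfl ht)
    have m2 := H.2.2 t ht
    have m3 := H.le_one ht
    rw [abs_le, abs_le]
    exact ⟨⟨by linarith, by linarith⟩, m1, by linarith⟩

end FarData

/-- Geometric data near the horizon: `x` is the distance to the horizon, `F` the part of the
potential vanishing there and `w` the weight. -/
structure NearData (m c C k Λ ω σ s₁ b : ℝ) (F F' x x' w : ℝ → ℝ) : Prop where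
  m_pos : 0 < m
  c_pos : 0 < c
  one_le_C : 1 ≤ C
  one_le_Λ : 1 ≤ Λ
  k_pos : 0 < k
  half_le : m / 2 ≤ ω
  le_m : ω ≤ m
  hσ : σ ≤ s₁
  hs₁ : s₁ + 1 ≤ b
  dF : ∀ s, HasDerivAt F (F' s) s
  dx : ∀ s, HasDerivAt x (x' s) s
  cx' : Continuous x'
  cw : Continuous w
  x_pos : ∀ s, 0 < x s
  x'_ge : ∀ s, s ≤ s₁ → c * x s ≤ x' s
  F_ge : ∀ s, s ≤ s₁ → c * Λ * x s ≤ F s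
  F_le : ∀ s, s ≤ s₁ → F s ≤ C * Λ * x s
  F'_ge : ∀ s, s ≤ s₁ → c * F s ≤ F' s
  w_ge : ∀ s, s ≤ s₁ → 1 ≤ C * w s * x s
  w_le : ∀ s, s ≤ s₁ → w s * x s ≤ C
  one_le_w : ∀ s, 1 ≤ w s
  w_le' : ∀ s ∈ Icc s₁ b, w s ≤ C
  xσ : Λ * x σ ≤ k
  barrier : ∀ s ∈ Icc σ b, 2 * m ^ 2 ≤ F s
  lim : Tendsto x atBot (nhds 0)

/-- Real and imaginary parts of an outgoing solution, with total weighted source `A` and squared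
horizon amplitude `I`. -/
structure Outgoing (ω I A : ℝ) (F w p p₁ q q₁ h g : ℝ → ℝ) : Prop where
  dp : ∀ s, HasDerivAt p (p₁ s) s
  dq : ∀ s, HasDerivAt q (q₁ s) s
  dp₁ : ∀ s, HasDerivAt p₁ ((F s - ω ^ 2) * p s + h s) s
  dq₁ : ∀ s, HasDerivAt q₁ ((F s - ω ^ 2) * q s + g s) s
  ch : Continuous h
  cg : Continuous g
  A_nonneg : 0 ≤ A
  hA : ∀ a t, a ≤ t → ∫ s in a..t, w s * (h s ^ 2 + g s ^ 2) ≤ A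
  lim_v₁ : Tendsto (fun s => p₁ s - ω * q s) atBot (nhds 0)
  lim_v₂ : Tendsto (fun s => q₁ s + ω * p s) atBot (nhds 0)
  lim_U : Tendsto (fun s => p s ^ 2 + q s ^ 2) atBot (nhds I)

namespace NearData
variable {m c C k Λ ω σ s₁ b : ℝ} {F F' x x' w : ℝ → ℝ}

theorem x_mono (D : NearData m c C k Λ ω σ s₁ b F F' x x' w) {s t : ℝ} (hst : s ≤ t)
    (ht : t ≤ s₁) : x s ≤ x t :=
  le_of_deriv_nonneg hst (fun y _ => D.dx y) fun y hy =>
    (mul_nonneg D.c_pos.le (D.x_pos y).le).trans (D.x'_ge y (hy.2.trans ht))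

theorem F_pos (D : NearData m c C k Λ ω σ s₁ b F F' x x' w) {s : ℝ} (hs : s ≤ s₁) : 0 < F s :=
  (mul_pos (mul_pos D.c_pos (zero_lt_one.trans_le D.one_le_Λ)) (D.x_pos s)).trans_le (D.F_ge s hs)

end NearData

namespace Outgoing
variable {m c C k Λ ω σ s₁ b I A : ℝ} {F F' x x' w p p₁ q q₁ h g : ℝ → ℝ}

theorem cp (S : Outgoing ω I A F w p p₁ q q₁ h g) : Continuous p :=
  continuous_iff_continuousAt.2 fun s => (S.dp s).continuousAt
theorem cq (S : Outgoing ω I A F w p p₁ q q₁ h g) : Continuous q :=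
  continuous_iff_continuousAt.2 fun s => (S.dq s).continuousAt
theorem cp₁ (S : Outgoing ω I A F w p p₁ q q₁ h g) : Continuous p₁ :=
  continuous_iff_continuousAt.2 fun s => (S.dp₁ s).continuousAt
theorem cq₁ (S : Outgoing ω I A F w p p₁ q q₁ h g) : Continuous q₁ :=
  continuous_iff_continuousAt.2 fun s => (S.dq₁ s).continuousAt

theorem I_nonneg (S : Outgoing ω I A F w p p₁ q q₁ h g) : 0 ≤ I :=
  ge_of_tendsto' S.lim_U fun _ => add_nonneg (sq_nonneg _) (sq_nonneg _)

theorem dv₁ (S : Outgoing ω I A F w p p₁ q q₁ h g) (s : ℝ) :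
    HasDerivAt (fun s => p₁ s - ω * q s) (F s * p s + h s - ω * (q₁ s + ω * p s)) s :=
  ((S.dp₁ s).sub ((S.dq s).const_mul ω)).congr_deriv (by ring)

theorem dv₂ (S : Outgoing ω I A F w p p₁ q q₁ h g) (s : ℝ) :
    HasDerivAt (fun s => q₁ s + ω * p s) (F s * q s + g s + ω * (p₁ s - ω * q s)) s :=
  ((S.dq₁ s).add ((S.dp s).const_mul ω)).congr_deriv (by ring)

theorem dU (S : Outgoing ω I A F w p p₁ q q₁ h g) (s : ℝ) :
    HasDerivAt (fun s => p s ^ 2 + q s ^ 2)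
      (2 * (p s * (p₁ s - ω * q s) + q s * (q₁ s + ω * p s))) s :=
  (((S.dp s).pow 2).add ((S.dq s).pow 2)).congr_deriv (by push_cast; ring)

theorem dR (S : Outgoing ω I A F w p p₁ q q₁ h g) (s : ℝ) :
    HasDerivAt (fun s => (p₁ s - ω * q s) ^ 2 + (q₁ s + ω * p s) ^ 2)
      (2 * F s * (p s * (p₁ s - ω * q s) + q s * (q₁ s + ω * p s))
        + 2 * (h s * (p₁ s - ω * q s) + g s * (q₁ s + ω * p s))) s :=
  (((S.dv₁ s).pow 2).add ((S.dv₂ s).pow 2)).congr_deriv (by push_cast; ring)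

theorem exists_bound (S : Outgoing ω I A F w p p₁ q q₁ h g) (s₁ : ℝ) :
    ∃ B, 0 ≤ B ∧ ∀ s ≤ s₁, p s ^ 2 + q s ^ 2 ≤ B := by
  have cp := S.cp
  have cq := S.cq
  obtain ⟨t, ht⟩ := eventually_atBot.1 (S.lim_U.eventually_lt_const (lt_add_one I))
  obtain ⟨B, hB⟩ := (isCompact_Icc (a := t) (b := s₁)).bddAbove_image
    (f := fun s => p s ^ 2 + q s ^ 2) (by fun_prop)
  refine ⟨max (I + 1) B, le_max_of_le_left (by linarith [S.I_nonneg]), fun s hs => ?_⟩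
  rcases le_total s t with h | h
  · exact (ht s h).le.trans (le_max_left _ _)
  · exact (hB (mem_image_of_mem _ ⟨h, hs⟩)).trans (le_max_right _ _)

/-- `R / F` is controlled near the horizon by the source alone, up to a vanishing error. -/
theorem R_le (S : Outgoing ω I A F w p p₁ q q₁ h g)
    (D : NearData m c C k Λ ω σ s₁ b F F' x x' w) :
    ∃ B, 0 ≤ B ∧ ∀ s ≤ s₁, (p₁ s - ω * q s) ^ 2 + (q₁ s + ω * p s) ^ 2 ≤
      (B * x s + Real.exp (2 / c) * C / c * (A / Λ)) * F s := by
  obtain ⟨B, hB0, hB⟩ := S.exists_bound s₁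
  have hc := D.c_pos
  have hC : 0 < C := zero_lt_one.trans_le D.one_le_C
  have hΛ : 0 < Λ := zero_lt_one.trans_le D.one_le_Λ
  refine ⟨Real.exp (2 / c) * (C ^ 2 * Λ * B / c) / c, by positivity, fun s hs => ?_⟩
  set X := x s with hX
  have hX0 : 0 < X := D.x_pos s
  let R : ℝ → ℝ := fun s => (p₁ s - ω * q s) ^ 2 + (q₁ s + ω * p s) ^ 2
  have cw := D.cw
  have cx' := D.cx'
  have ch := S.ch
  have cg := S.cg
  have key : ∀ a ≤ s, R s ≤ Real.exp (2 / c) * (R a + X * (C ^ 2 * Λ ^ 2 * B / c * X + C * A)) := by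
    intro a ha
    let Φ : ℝ → ℝ := fun t => R t * Real.exp (-(2 / (c * X)) * x t)
    have dΦ : ∀ t, HasDerivAt Φ
        ((2 * F t * (p t * (p₁ t - ω * q t) + q t * (q₁ t + ω * p t))
          + 2 * (h t * (p₁ t - ω * q t) + g t * (q₁ t + ω * p t))
          - 2 / (c * X) * x' t * R t) * Real.exp (-(2 / (c * X)) * x t)) t := fun t =>
      ((S.dR t).mul (((D.dx t).const_mul (-(2 / (c * X)))).exp)).congr_deriv (by
        simp only [R]; ring)
    have est := sub_le_integral_of_deriv_le ha (fun t _ => dΦ t)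
      (g := fun t => X * (C ^ 2 * Λ ^ 2 * B / c) * x' t + X * C * (w t * (h t ^ 2 + g t ^ 2)))
      (by fun_prop) (fun t ht => by
        have ht1 : t ≤ s₁ := ht.2.trans hs
        have hxt := D.x_pos t
        have hcx := D.x'_ge t ht1
        have hFC := D.F_le t ht1
        have hF0 := D.F_pos ht1
        have hw := D.w_ge t ht1
        have hw1 : 0 ≤ w t := zero_le_one.trans (D.one_le_w t)
        have hU := hB t ht1
        set v₁ := p₁ t - ω * q t
        set v₂ := q₁ t + ω * p t
        have hR : R t = v₁ ^ 2 + v₂ ^ 2 := rfl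
        have hR0 : 0 ≤ R t := by rw [hR]; positivity
        have a1 : 2 * F t * (p t * v₁ + q t * v₂) ≤
            X * (F t ^ 2 / x t * (p t ^ 2 + q t ^ 2)) + x t / X * R t := by
          have : X * (F t ^ 2 / x t * (p t ^ 2 + q t ^ 2)) + x t / X * R t
              - 2 * F t * (p t * v₁ + q t * v₂)
              = x t / X * ((X * F t / x t * p t - v₁) ^ 2 + (X * F t / x t * q t - v₂) ^ 2) := by
            rw [hR]; field_simp; ring
          have h2 : 0 ≤ x t / X * ((X * F t / x t * p t - v₁) ^ 2
            + (X * F t / x t * q t - v₂) ^ 2) := by positivity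
          linarith
        have a2 : 2 * (h t * v₁ + g t * v₂) ≤ X / x t * (h t ^ 2 + g t ^ 2) + x t / X * R t := by
          have : X / x t * (h t ^ 2 + g t ^ 2) + x t / X * R t - 2 * (h t * v₁ + g t * v₂)
              = x t / X * ((X / x t * h t - v₁) ^ 2 + (X / x t * g t - v₂) ^ 2) := by
            rw [hR]; field_simp; ring
          have h2 : 0 ≤ x t / X * ((X / x t * h t - v₁) ^ 2 + (X / x t * g t - v₂) ^ 2) := by
            positivity
          linarith
        have a3 : x t / X * R t + x t / X * R t ≤ 2 / (c * X) * x' t * R t := by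
          have : 2 / (c * X) * (c * x t) * R t ≤ 2 / (c * X) * x' t * R t := by gcongr
          refine le_trans (le_of_eq ?_) this
          field_simp
          ring
        have a4 : X * (F t ^ 2 / x t * (p t ^ 2 + q t ^ 2)) ≤
            X * (C ^ 2 * Λ ^ 2 * B / c) * x' t := by
          have e1 : F t ^ 2 ≤ (C * Λ * x t) ^ 2 := pow_le_pow_left₀ hF0.le hFC 2
          have e2 : F t ^ 2 / x t ≤ C ^ 2 * Λ ^ 2 * x t := by
            rw [div_le_iff₀ hxt]
            refine e1.trans (le_of_eq (by ring))
          have e3 : F t ^ 2 / x t * (p t ^ 2 + q t ^ 2) ≤ C ^ 2 * Λ ^ 2 * x t * B := by gcongr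
          have e4 : C ^ 2 * Λ ^ 2 * x t * B = C ^ 2 * Λ ^ 2 * B / c * (c * x t) := by field_simp
          have e5 : C ^ 2 * Λ ^ 2 * B / c * (c * x t) ≤ C ^ 2 * Λ ^ 2 * B / c * x' t := by gcongr
          rw [mul_assoc]
          exact mul_le_mul_of_nonneg_left (e3.trans (e4.le.trans e5)) hX0.le
        have a5 : X / x t * (h t ^ 2 + g t ^ 2) ≤ X * C * (w t * (h t ^ 2 + g t ^ 2)) := by
          have e1 : 1 / x t ≤ C * w t := by rw [div_le_iff₀ hxt]; exact hw
          calc X / x t * (h t ^ 2 + g t ^ 2) = X * (1 / x t) * (h t ^ 2 + g t ^ 2) := by ring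
            _ ≤ X * (C * w t) * (h t ^ 2 + g t ^ 2) := by gcongr
            _ = _ := by ring
        have hx'0 : 0 ≤ x' t := le_trans (by positivity) hcx
        have a6 : 0 ≤ X * (C ^ 2 * Λ ^ 2 * B / c) * x' t + X * C * (w t * (h t ^ 2 + g t ^ 2)) := by
          positivity
        have a7 : Real.exp (-(2 / (c * X)) * x t) ≤ 1 := by
          rw [Real.exp_le_one_iff, neg_mul, neg_nonpos]; positivity
        refine (mul_le_mul_of_nonneg_right ?_ (Real.exp_pos _).le).trans
          (mul_le_of_le_one_right a6 a7)
        linarith)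
    have i1 : ∫ t in a..s, (X * (C ^ 2 * Λ ^ 2 * B / c) * x' t
        + X * C * (w t * (h t ^ 2 + g t ^ 2))) ≤ X * (C ^ 2 * Λ ^ 2 * B / c * X + C * A) := by
      rw [intervalIntegral.integral_add (Continuous.intervalIntegrable (by fun_prop) _ _)
        (Continuous.intervalIntegrable (by fun_prop) _ _), intervalIntegral.integral_const_mul,
        intervalIntegral.integral_const_mul, intervalIntegral.integral_eq_sub_of_hasDerivAt
        (fun t _ => D.dx t) (cx'.intervalIntegrable _ _)]
      have e1 := mul_le_mul_of_nonneg_left (S.hA a s ha) (show 0 ≤ X * C by positivity)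
      have e2 : 0 ≤ X * (C ^ 2 * Λ ^ 2 * B / c) * x a :=
        mul_nonneg (by positivity) (D.x_pos a).le
      rw [← hX]
      nlinarith
    have hRa : 0 ≤ R a := by simp only [R]; positivity
    have e1 : Φ a ≤ R a := by
      refine mul_le_of_le_one_right hRa ?_
      rw [Real.exp_le_one_iff, neg_mul, neg_nonpos]
      have := D.x_pos a
      positivity
    have e2 : Φ s = R s * Real.exp (-(2 / c)) := by
      simp only [Φ, ← hX]
      congr 2
      field_simp
    have e3 : R s * Real.exp (-(2 / c)) ≤ R a + X * (C ^ 2 * Λ ^ 2 * B / c * X + C * A) := by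
      rw [← e2]; linarith
    have e4 := mul_le_mul_of_nonneg_left e3 (Real.exp_pos (2 / c)).le
    rwa [mul_comm (R s), ← mul_assoc, ← Real.exp_add, add_neg_cancel, Real.exp_zero, one_mul] at e4
  have lim : Tendsto (fun a => Real.exp (2 / c) * (R a
      + X * (C ^ 2 * Λ ^ 2 * B / c * X + C * A))) atBot
      (nhds (Real.exp (2 / c) * (0 ^ 2 + 0 ^ 2 + X * (C ^ 2 * Λ ^ 2 * B / c * X + C * A)))) :=
    ((((S.lim_v₁.pow 2).add (S.lim_v₂.pow 2)).add_const _).const_mul _)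
  have fin := ge_of_tendsto lim (eventually_le_atBot s |>.mono key)
  refine fin.trans ?_
  have e1 := D.F_ge s hs
  have hA0 := S.A_nonneg
  have e2 : (Real.exp (2 / c) * (C ^ 2 * Λ * B / c) / c * X
      + Real.exp (2 / c) * C / c * (A / Λ)) * (c * Λ * X) ≤
      (Real.exp (2 / c) * (C ^ 2 * Λ * B / c) / c * X
      + Real.exp (2 / c) * C / c * (A / Λ)) * F s := by gcongr
  refine le_trans (le_of_eq ?_) e2
  field_simp
  ring

end Outgoing

namespace Outgoing
variable {m c C k Λ ω σ s₁ b I A : ℝ} {F F' x x' w p p₁ q q₁ h g : ℝ → ℝ}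

theorem dRF (S : Outgoing ω I A F w p p₁ q q₁ h g)
    (D : NearData m c C k Λ ω σ s₁ b F F' x x' w) {s : ℝ} (hs : s ≤ s₁) :
    HasDerivAt (fun s => ((p₁ s - ω * q s) ^ 2 + (q₁ s + ω * p s) ^ 2) / F s)
      (2 * (p s * (p₁ s - ω * q s) + q s * (q₁ s + ω * p s))
        + 2 * (h s * (p₁ s - ω * q s) + g s * (q₁ s + ω * p s)) / F s
        - F' s / F s ^ 2 * ((p₁ s - ω * q s) ^ 2 + (q₁ s + ω * p s) ^ 2)) s := by
  have hF := (D.F_pos hs).ne'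
  refine ((S.dR s).div (D.dF s) hF).congr_deriv ?_
  field_simp

/-- `R / F` is eventually controlled by the source. -/
theorem eventually_RF_le (S : Outgoing ω I A F w p p₁ q q₁ h g)
    (D : NearData m c C k Λ ω σ s₁ b F F' x x' w) {η : ℝ} (hη : 0 < η) :
    ∀ᶠ s in atBot, ((p₁ s - ω * q s) ^ 2 + (q₁ s + ω * p s) ^ 2) / F s ≤
      Real.exp (2 / c) * C / c * (A / Λ) + η := by
  obtain ⟨B, hB0, hB⟩ := S.R_le D
  have lim : Tendsto (fun s => B * x s) atBot (nhds (B * 0)) := D.lim.const_mul B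
  rw [mul_zero] at lim
  filter_upwards [eventually_le_atBot s₁, lim.eventually_le_const hη] with s hs h1
  rw [div_le_iff₀ (D.F_pos hs)]
  refine (hB s hs).trans (mul_le_mul_of_nonneg_right (by linarith) (D.F_pos hs).le)

theorem Q_le (S : Outgoing ω I A F w p p₁ q q₁ h g)
    (D : NearData m c C k Λ ω σ s₁ b F F' x x' w) {s : ℝ} (hs : s ≤ σ) :
    p s ^ 2 + q s ^ 2 + ((p₁ s - ω * q s) ^ 2 + (q₁ s + ω * p s) ^ 2) / F s ≤
      Real.exp (16 * C * k / c ^ 2) * (I + (Real.exp (2 / c) * C / c + 4 * C / c ^ 2) * A) := by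
  have hc := D.c_pos
  have hC : 0 < C := zero_lt_one.trans_le D.one_le_C
  have hΛ : 0 < Λ := zero_lt_one.trans_le D.one_le_Λ
  have hss : s ≤ s₁ := hs.trans D.hσ
  have hA0 := S.A_nonneg
  let Q : ℝ → ℝ := fun s => p s ^ 2 + q s ^ 2 + ((p₁ s - ω * q s) ^ 2 + (q₁ s + ω * p s) ^ 2) / F s
  have cw := D.cw
  have ch := S.ch
  have cg := S.cg
  set Γ := 16 * C * Λ / c ^ 2 with hΓ
  have key : ∀ a ≤ s, Q s ≤ Real.exp (16 * C * k / c ^ 2) * (Q a + 4 * C / c ^ 2 * (A / Λ)) := by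
    intro a ha
    let Φ : ℝ → ℝ := fun t => Q t * Real.exp (-Γ * x t)
    have est := sub_le_integral_of_deriv_le (f := Φ) ha (fun t ht =>
      ((S.dU t).add (S.dRF D (ht.2.trans hss))).mul (((D.dx t).const_mul (-Γ)).exp))
      (g := fun t => 4 * C / (c ^ 2 * Λ) * (w t * (h t ^ 2 + g t ^ 2)))
      (by fun_prop) (fun t ht => by
        have ht1 : t ≤ s₁ := ht.2.trans hss
        have hxt := D.x_pos t
        have hcx := D.x'_ge t ht1
        have hFc := D.F_ge t ht1
        have hFC := D.F_le t ht1
        have hF0 := D.F_pos ht1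
        have hF' := D.F'_ge t ht1
        have hw := D.w_ge t ht1
        have hw1 : 0 ≤ w t := zero_le_one.trans (D.one_le_w t)
        simp only [Pi.add_apply]
        set v₁ := p₁ t - ω * q t
        set v₂ := q₁ t + ω * p t
        set f := F t
        have a1 : 4 * (p t * v₁ + q t * v₂) ≤ 16 * f / c * (p t ^ 2 + q t ^ 2)
            + c / (4 * f) * (v₁ ^ 2 + v₂ ^ 2) := by
          have : 16 * f / c * (p t ^ 2 + q t ^ 2) + c / (4 * f) * (v₁ ^ 2 + v₂ ^ 2)
              - 4 * (p t * v₁ + q t * v₂)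
              = c / (4 * f) * ((8 * f / c * p t - v₁) ^ 2 + (8 * f / c * q t - v₂) ^ 2) := by
            field_simp; ring
          have h2 : 0 ≤ c / (4 * f) * ((8 * f / c * p t - v₁) ^ 2 + (8 * f / c * q t - v₂) ^ 2) := by
            positivity
          linarith
        have a2 : 2 * (h t * v₁ + g t * v₂) / f ≤ 4 / (c * f) * (h t ^ 2 + g t ^ 2)
            + c / (4 * f) * (v₁ ^ 2 + v₂ ^ 2) := by
          have : 4 / (c * f) * (h t ^ 2 + g t ^ 2) + c / (4 * f) * (v₁ ^ 2 + v₂ ^ 2)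
              - 2 * (h t * v₁ + g t * v₂) / f
              = c / (4 * f) * ((4 / c * h t - v₁) ^ 2 + (4 / c * g t - v₂) ^ 2) := by
            field_simp; ring
          have h2 : 0 ≤ c / (4 * f) * ((4 / c * h t - v₁) ^ 2 + (4 / c * g t - v₂) ^ 2) := by
            positivity
          linarith
        have a3 : c / (4 * f) * (v₁ ^ 2 + v₂ ^ 2) + c / (4 * f) * (v₁ ^ 2 + v₂ ^ 2) ≤
            F' t / f ^ 2 * (v₁ ^ 2 + v₂ ^ 2) := by
          rw [← add_mul]
          refine mul_le_mul_of_nonneg_right ?_ (by positivity)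
          rw [le_div_iff₀ (by positivity)]
          have : (c / (4 * f) + c / (4 * f)) * f ^ 2 = c * f / 2 := by field_simp; ring
          rw [this]
          have : 0 < c * f := by positivity
          linarith
        have hx'0 : 0 ≤ x' t := le_trans (by positivity) hcx
        have a4 : 16 * f / c * (p t ^ 2 + q t ^ 2) ≤ Γ * x' t * Q t := by
          have e1 : 16 * f / c ≤ Γ * x' t := by
            calc 16 * f / c ≤ 16 * (C * Λ * x t) / c := by gcongr
              _ = Γ * (c * x t) := by rw [hΓ]; field_simp
              _ ≤ Γ * x' t := by gcongr
          have e2 : p t ^ 2 + q t ^ 2 ≤ Q t := by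
            simp only [Q]
            have : 0 ≤ (v₁ ^ 2 + v₂ ^ 2) / f := by positivity
            exact le_add_of_nonneg_right this
          exact mul_le_mul e1 e2 (by positivity) (by positivity)
        have a5 : 4 / (c * f) * (h t ^ 2 + g t ^ 2) ≤
            4 * C / (c ^ 2 * Λ) * (w t * (h t ^ 2 + g t ^ 2)) := by
          have e1 : 4 / (c * f) ≤ 4 * C / (c ^ 2 * Λ) * w t := by
            rw [div_le_iff₀ (by positivity)]
            calc (4:ℝ) = 4 * 1 := by ring
              _ ≤ 4 * (C * w t * x t) := by gcongr
              _ = 4 * C / (c ^ 2 * Λ) * w t * (c * (c * Λ * x t)) := by field_simp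
              _ ≤ 4 * C / (c ^ 2 * Λ) * w t * (c * f) := by gcongr
          rw [← mul_assoc]
          exact mul_le_mul_of_nonneg_right e1 (by positivity)
        have a6 : 0 ≤ 4 * C / (c ^ 2 * Λ) * (w t * (h t ^ 2 + g t ^ 2)) := by positivity
        have a7 : Real.exp (-Γ * x t) ≤ 1 := by
          rw [Real.exp_le_one_iff, neg_mul, neg_nonpos]; positivity
        refine le_trans (le_of_eq ?_) ((mul_le_mul_of_nonneg_right (b :=
          2 * (p t * v₁ + q t * v₂) + (2 * (p t * v₁ + q t * v₂)
            + 2 * (h t * v₁ + g t * v₂) / f - F' t / f ^ 2 * (v₁ ^ 2 + v₂ ^ 2))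
            - Γ * x' t * Q t) ?_ (Real.exp_pos (-Γ * x t)).le).trans
          (mul_le_of_le_one_right a6 a7))
        · simp only [Q]; ring
        · linarith)
    rw [intervalIntegral.integral_const_mul] at est
    have hQ0 : ∀ t ≤ s₁, 0 ≤ Q t := fun t ht => by
      have := D.F_pos ht
      simp only [Q]; positivity
    have e1 : Φ a ≤ Q a := by
      refine mul_le_of_le_one_right (hQ0 a (ha.trans hss)) ?_
      rw [Real.exp_le_one_iff, neg_mul, neg_nonpos]
      have := D.x_pos a
      positivity
    have e2 : 4 * C / (c ^ 2 * Λ) * ∫ t in a..s, w t * (h t ^ 2 + g t ^ 2) ≤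
        4 * C / c ^ 2 * (A / Λ) := by
      refine (mul_le_mul_of_nonneg_left (S.hA a s ha) (by positivity)).trans (le_of_eq ?_)
      field_simp
    have e3 : Q s * Real.exp (-Γ * x s) ≤ Q a + 4 * C / c ^ 2 * (A / Λ) := by
      have : Φ s - Φ a ≤ _ := est
      have h2 : Φ s = Q s * Real.exp (-Γ * x s) := rfl
      linarith
    have e4 := mul_le_mul_of_nonneg_left e3 (Real.exp_pos (Γ * x s)).le
    rw [mul_comm (Q s), ← mul_assoc, ← Real.exp_add, neg_mul, add_neg_cancel, Real.exp_zero,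
      one_mul] at e4
    refine e4.trans (mul_le_mul_of_nonneg_right (Real.exp_le_exp.2 ?_) ?_)
    · have h1 : Λ * x s ≤ k :=
        (mul_le_mul_of_nonneg_left (D.x_mono hs D.hσ) hΛ.le).trans D.xσ
      calc Γ * x s = 16 * C / c ^ 2 * (Λ * x s) := by rw [hΓ]; ring
        _ ≤ 16 * C / c ^ 2 * k := by gcongr
        _ = _ := by ring
    · have := hQ0 a (ha.trans hss)
      positivity
  refine le_of_forall_pos_le_add fun η hη => ?_
  set Z := Real.exp (16 * C * k / c ^ 2)
  have hZ : 0 < Z := Real.exp_pos _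
  obtain ⟨a, ha1, ha2, ha3⟩ := ((eventually_le_atBot s).and
    ((S.eventually_RF_le D (η := η / (2 * Z)) (by positivity)).and
    (S.lim_U.eventually_le_const (lt_add_of_pos_right I (show 0 < η / (2 * Z) by positivity))))).exists
  have h1 := key a ha1
  have hAΛ : A / Λ ≤ A := div_le_self hA0 D.one_le_Λ
  have h3 : Real.exp (2 / c) * C / c * (A / Λ) ≤ Real.exp (2 / c) * C / c * A := by gcongr
  have h4 : 4 * C / c ^ 2 * (A / Λ) ≤ 4 * C / c ^ 2 * A := by gcongr
  have h2 : Q a + 4 * C / c ^ 2 * (A / Λ) ≤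
      I + (Real.exp (2 / c) * C / c + 4 * C / c ^ 2) * A + η / Z := by
    have : η / Z = η / (2 * Z) + η / (2 * Z) := by field_simp; norm_num
    simp only [Q]
    rw [this]
    linarith
  refine h1.trans ((mul_le_mul_of_nonneg_left h2 hZ.le).trans (le_of_eq ?_))
  field_simp

end Outgoing

theorem absorb {α β γ μ ε α₂ Y : ℝ} (hα : 0 < α) (hβ : 0 < β) (hγ : 0 < γ) (hμ : 0 < μ)
    (hε : 0 < ε) (hα₂ : 0 < α₂) (hY : 0 < Y) :
    ∃ G, 0 < G ∧ ∀ I J A : ℝ, 0 ≤ A →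
      (∀ τ, 0 < τ → J ≤ τ * α * J + β * A / τ + γ * (I + Y * A)) →
      (∀ τ, 0 < τ → μ * I ≤ τ * (ε * (I + Y * A) + α₂ * J) + β * A / τ) →
      J ≤ G * A ∧ I ≤ G * A := by
  set t := μ / (2 * (ε + 2 * α₂ * γ)) with ht
  have ht0 : 0 < t := by positivity
  set G₁ := 2 / μ * (t * (ε * Y + α₂ * (4 * α * β + 2 * γ * Y)) + β / t) with hG₁
  have hG₁0 : 0 < G₁ := by positivity
  refine ⟨G₁ + (4 * α * β + 2 * γ * Y + 2 * γ * G₁), by positivity, fun I J A hA h1 h2 => ?_⟩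
  have e1 := h1 (1 / (2 * α)) (by positivity)
  have e2 : J ≤ 4 * α * β * A + 2 * γ * (I + Y * A) := by
    have a1 : 1 / (2 * α) * α * J = J / 2 := by field_simp
    have a2 : β * A / (1 / (2 * α)) = 2 * α * β * A := by field_simp
    rw [a1, a2] at e1
    linarith
  have e3 := h2 t ht0
  have e4 : μ * I ≤ t * (ε * (I + Y * A) + α₂ * (4 * α * β * A + 2 * γ * (I + Y * A)))
      + β * A / t := by
    refine e3.trans ?_
    gcongr
  have e5 : t * (ε * (I + Y * A) + α₂ * (4 * α * β * A + 2 * γ * (I + Y * A)))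
      + β * A / t = μ / 2 * I + μ / 2 * (G₁ * A) := by
    have : t * (ε + 2 * α₂ * γ) = μ / 2 := by rw [ht]; field_simp
    have h3 : μ / 2 * (G₁ * A) = (t * (ε * Y + α₂ * (4 * α * β + 2 * γ * Y)) + β / t) * A := by
      rw [hG₁]; field_simp
    rw [h3, ← this]
    ring
  have hI : I ≤ G₁ * A := by
    rw [e5] at e4
    have : μ / 2 * I ≤ μ / 2 * (G₁ * A) := by linarith
    exact le_of_mul_le_mul_left this (by positivity)
  have h0 : 0 ≤ (4 * α * β + 2 * γ * Y + 2 * γ * G₁) * A := by positivity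
  have h00 : 0 ≤ G₁ * A := by positivity
  constructor
  · have := mul_le_mul_of_nonneg_left hI (show 0 ≤ 2 * γ by positivity)
    nlinarith
  · linarith

theorem two_mul_le_of_one_le {τ c w a e : ℝ} (hτ : 0 < τ) (hc : 0 < c) (h : 1 ≤ c * w) :
    a * e ≤ (1 / 2) * (τ * c * a ^ 2 + w / τ * e ^ 2) := by
  have h1 : 1 / c ≤ w := by rw [div_le_iff₀ hc]; linarith
  have h2 : 1 / c / τ * e ^ 2 ≤ w / τ * e ^ 2 := by gcongr
  have h3 : τ * c * a ^ 2 + 1 / c / τ * e ^ 2 - 2 * (a * e) = τ * c * (a - e / (τ * c)) ^ 2 := by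
    field_simp; ring
  have h4 : 0 ≤ τ * c * (a - e / (τ * c)) ^ 2 := by positivity
  linarith

namespace Outgoing
variable {m c C k Λ ω σ s₁ b I A : ℝ} {F F' x x' w p p₁ q q₁ h g : ℝ → ℝ}

/-- Energy density on the barrier region. -/
def energy (ω : ℝ) (F p p₁ q q₁ : ℝ → ℝ) (s : ℝ) : ℝ :=
  p₁ s ^ 2 + q₁ s ^ 2 + (F s - ω ^ 2) * (p s ^ 2 + q s ^ 2)

theorem continuous_energy (S : Outgoing ω I A F w p p₁ q q₁ h g)
    (D : NearData m c C k Λ ω σ s₁ b F F' x x' w) : Continuous (energy ω F p p₁ q q₁) := by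
  have cp := S.cp
  have cq := S.cq
  have cp₁ := S.cp₁
  have cq₁ := S.cq₁
  have cF : Continuous F := continuous_iff_continuousAt.2 fun s => (D.dF s).continuousAt
  unfold energy
  fun_prop

theorem energy_ge (D : NearData m c C k Λ ω σ s₁ b F F' x x' w) {s : ℝ} (hs : s ∈ Icc σ b) :
    p₁ s ^ 2 + q₁ s ^ 2 + m ^ 2 * (p s ^ 2 + q s ^ 2) ≤ energy ω F p p₁ q q₁ s := by
  have h1 := D.barrier s hs
  have hω : 0 ≤ ω := le_trans (by have := D.m_pos; positivity) D.half_le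
  have h2 : ω ^ 2 ≤ m ^ 2 := pow_le_pow_left₀ hω D.le_m 2
  unfold energy
  have : m ^ 2 * (p s ^ 2 + q s ^ 2) ≤ (F s - ω ^ 2) * (p s ^ 2 + q s ^ 2) :=
    mul_le_mul_of_nonneg_right (by linarith) (by positivity)
  linarith

theorem energy_nonneg (D : NearData m c C k Λ ω σ s₁ b F F' x x' w) {s : ℝ} (hs : s ∈ Icc σ b) :
    0 ≤ energy ω F p p₁ q q₁ s :=
  le_trans (by positivity) (energy_ge D hs)

theorem integral_energy_mono (S : Outgoing ω I A F w p p₁ q q₁ h g)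
    (D : NearData m c C k Λ ω σ s₁ b F F' x x' w) {s t : ℝ} (hs : σ ≤ s) (hst : s ≤ t)
    (ht : t ≤ b) : ∫ y in s..t, energy ω F p p₁ q q₁ y ≤ ∫ y in σ..b, energy ω F p p₁ q q₁ y := by
  refine intervalIntegral.integral_mono_interval hs hst ht ?_
    ((S.continuous_energy D).intervalIntegrable _ _)
  filter_upwards [ae_restrict_mem measurableSet_Ioc] with y hy
  exact energy_nonneg D ⟨hy.1.le, hy.2⟩

theorem U_le (S : Outgoing ω I A F w p p₁ q q₁ h g)
    (D : NearData m c C k Λ ω σ s₁ b F F' x x' w) {s : ℝ} (hs : σ ≤ s) (hsb : s + 1 ≤ b) :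
    p s ^ 2 + q s ^ 2 ≤ (2 / m ^ 2 + 1) * ∫ y in σ..b, energy ω F p p₁ q q₁ y ∧
    p (s + 1) ^ 2 + q (s + 1) ^ 2 ≤ (2 / m ^ 2 + 1) * ∫ y in σ..b, energy ω F p p₁ q q₁ y := by
  have hm := D.m_pos
  have cE := S.continuous_energy D
  have est : ∀ t ∈ Icc s (s + 1), 2 * (p t ^ 2 + q t ^ 2) + (p₁ t ^ 2 + q₁ t ^ 2) ≤
      (2 / m ^ 2 + 1) * energy ω F p p₁ q q₁ t := fun t ht => by
    have h1 := energy_ge (p := p) (p₁ := p₁) (q := q) (q₁ := q₁) D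
      (s := t) ⟨hs.trans ht.1, ht.2.trans hsb⟩
    have h2 : 0 ≤ p₁ t ^ 2 + q₁ t ^ 2 := by positivity
    have h3 : 0 ≤ m ^ 2 * (p t ^ 2 + q t ^ 2) := by positivity
    have h4 : 2 * (p t ^ 2 + q t ^ 2) = 2 / m ^ 2 * (m ^ 2 * (p t ^ 2 + q t ^ 2)) := by field_simp
    have h5 : 2 / m ^ 2 * (m ^ 2 * (p t ^ 2 + q t ^ 2)) ≤ 2 / m ^ 2 * energy ω F p p₁ q q₁ t := by
      gcongr; linarith
    rw [h4]
    linarith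
  have dU : ∀ t, HasDerivAt (fun s => p s ^ 2 + q s ^ 2) (2 * (p t * p₁ t + q t * q₁ t)) t :=
    fun t => (((S.dp t).pow 2).add ((S.dq t).pow 2)).congr_deriv (by push_cast; ring)
  have young : ∀ t, |2 * (p t * p₁ t + q t * q₁ t)| ≤ p t ^ 2 + q t ^ 2 + (p₁ t ^ 2 + q₁ t ^ 2) := by
    intro t
    rw [abs_le]
    constructor <;> nlinarith [sq_nonneg (p t - p₁ t), sq_nonneg (q t - q₁ t),
      sq_nonneg (p t + p₁ t), sq_nonneg (q t + q₁ t)]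
  have hmono := mul_le_mul_of_nonneg_left (S.integral_energy_mono D hs (show s ≤ s + 1 by linarith)
    hsb) (show 0 ≤ 2 / m ^ 2 + 1 by positivity)
  constructor
  · have := sub_le_integral_of_deriv_le (a := s) (b := s + 1)
      (f := fun t => -((s + 1 - t) * (p t ^ 2 + q t ^ 2)))
      (f' := fun t => -((-1) * (p t ^ 2 + q t ^ 2) + (s + 1 - t) * (2 * (p t * p₁ t + q t * q₁ t))))
      (g := fun t => (2 / m ^ 2 + 1) * energy ω F p p₁ q q₁ t) (by linarith)
      (fun t _ => (((hasDerivAt_id t).const_sub (s + 1)).mul (dU t)).neg) (by fun_prop)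
      (fun t ht => by
        have h1 := est t ht
        have h2 := (abs_le.1 (young t)).1
        have h3 : 0 ≤ p t ^ 2 + q t ^ 2 + (p₁ t ^ 2 + q₁ t ^ 2) := by positivity
        have h4 : 0 ≤ s + 1 - t := by linarith [ht.2]
        have h5 : s + 1 - t ≤ 1 := by linarith [ht.1]
        nlinarith [mul_le_mul_of_nonneg_left h2 h4, mul_le_mul_of_nonneg_right h5 h3])
    rw [intervalIntegral.integral_const_mul] at this
    simp only [sub_self, zero_mul, neg_zero, add_sub_cancel_left, one_mul] at this
    linarith
  · have := sub_le_integral_of_deriv_le (a := s) (b := s + 1)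
      (f := fun t => (t - s) * (p t ^ 2 + q t ^ 2))
      (f' := fun t => 1 * (p t ^ 2 + q t ^ 2) + (t - s) * (2 * (p t * p₁ t + q t * q₁ t)))
      (g := fun t => (2 / m ^ 2 + 1) * energy ω F p p₁ q q₁ t) (by linarith)
      (fun t _ => ((hasDerivAt_id t).sub_const s).mul (dU t)) (by fun_prop)
      (fun t ht => by
        have h1 := est t ht
        have h2 := (abs_le.1 (young t)).2
        have h3 : 0 ≤ p t ^ 2 + q t ^ 2 + (p₁ t ^ 2 + q₁ t ^ 2) := by positivity
        have h4 : 0 ≤ t - s := by linarith [ht.1]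
        have h5 : t - s ≤ 1 := by linarith [ht.2]
        nlinarith [mul_le_mul_of_nonneg_left h2 h4, mul_le_mul_of_nonneg_right h5 h3])
    rw [intervalIntegral.integral_const_mul] at this
    simp only [sub_self, zero_mul, add_sub_cancel_left, one_mul] at this
    linarith

theorem energy_le (S : Outgoing ω I A F w p p₁ q q₁ h g)
    (D : NearData m c C k Λ ω σ s₁ b F F' x x' w) {θ K Z Y τ : ℝ} (hθ : θ ≤ 0)
    (hRp : (p₁ b - θ * p b) ^ 2 ≤ A * K) (hRq : (q₁ b - θ * q b) ^ 2 ≤ A * K)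
    (hZ : p σ ^ 2 + q σ ^ 2 + ((p₁ σ - ω * q σ) ^ 2 + (q₁ σ + ω * p σ) ^ 2) / F σ ≤ Z * (I + Y * A))
    (hτ : 0 < τ) :
    ∫ s in σ..b, energy ω F p p₁ q q₁ s ≤
      τ * ((2 / m ^ 2 + 1) / 2 + 1 / (2 * m ^ 2)) * (∫ s in σ..b, energy ω F p p₁ q q₁ s)
      + (K + 1 / 2) * A / τ + (1 + C * k) * Z / 2 * (I + Y * A) := by
  have hm := D.m_pos
  have cE := S.continuous_energy D
  have cw := D.cw
  have ch := S.ch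
  have cg := S.cg
  have hC : 0 < C := zero_lt_one.trans_le D.one_le_C
  have hσb : σ ≤ b := by linarith [D.hσ, D.hs₁]
  have hUb := (S.U_le D (s := b - 1) (by linarith [D.hσ, D.hs₁]) (by linarith)).2
  rw [sub_add_cancel] at hUb
  set J := ∫ s in σ..b, energy ω F p p₁ q q₁ s with hJ
  have est := sub_le_integral_of_deriv_le (a := σ) (b := b) hσb
    (f := fun s => -(p s * p₁ s + q s * q₁ s))
    (g := fun s => (τ / (2 * m ^ 2) - 1) * energy ω F p p₁ q q₁ s
      + 1 / (2 * τ) * (w s * (h s ^ 2 + g s ^ 2)))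
    (fun s _ => (((S.dp s).mul (S.dp₁ s)).add ((S.dq s).mul (S.dq₁ s))).neg) (by fun_prop)
    (fun s hs => by
      have h1 := energy_ge (p := p) (p₁ := p₁) (q := q) (q₁ := q₁) D hs
      have hw := D.one_le_w s
      have h2 := two_mul_le_of_one_le (a := -p s) (e := h s) hτ one_pos (by simpa using hw)
      have h3 := two_mul_le_of_one_le (a := -q s) (e := g s) hτ one_pos (by simpa using hw)
      have h4 : p s ^ 2 + q s ^ 2 ≤ 1 / m ^ 2 * energy ω F p p₁ q q₁ s := by
        have : m ^ 2 * (p s ^ 2 + q s ^ 2) ≤ energy ω F p p₁ q q₁ s := by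
          have : 0 ≤ p₁ s ^ 2 + q₁ s ^ 2 := by positivity
          linarith
        rw [one_div, ← div_eq_inv_mul, le_div_iff₀ (by positivity)]
        linarith
      have h5 : τ / 2 * (p s ^ 2 + q s ^ 2) ≤ τ / (2 * m ^ 2) * energy ω F p p₁ q q₁ s := by
        refine (mul_le_mul_of_nonneg_left h4 (by positivity)).trans (le_of_eq ?_)
        field_simp
      have h6 : 1 / (2 * τ) * (w s * (h s ^ 2 + g s ^ 2))
          = 1 / 2 * (w s / τ * h s ^ 2) + 1 / 2 * (w s / τ * g s ^ 2) := by field_simp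
      have h7 : energy ω F p p₁ q q₁ s
        = p₁ s ^ 2 + q₁ s ^ 2 + (F s - ω ^ 2) * (p s ^ 2 + q s ^ 2) := rfl
      rw [h6]
      have h8 : -(p₁ s * p₁ s + p s * ((F s - ω ^ 2) * p s + h s)
          + (q₁ s * q₁ s + q s * ((F s - ω ^ 2) * q s + g s)))
          = -energy ω F p p₁ q q₁ s + -p s * h s + -q s * g s := by rw [h7]; ring
      rw [h8]
      linarith)
  rw [intervalIntegral.integral_add (Continuous.intervalIntegrable (by fun_prop) _ _)
    (Continuous.intervalIntegrable (by fun_prop) _ _), intervalIntegral.integral_const_mul,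
    intervalIntegral.integral_const_mul, ← hJ] at est
  have hAb := mul_le_mul_of_nonneg_left (S.hA σ b hσb) (show 0 ≤ 1 / (2 * τ) by positivity)
  -- boundary term at `b`
  have b1 : p b * p₁ b + q b * q₁ b ≤ τ / 2 * (p b ^ 2 + q b ^ 2) + A * K / τ := by
    have h2 := two_mul_le_of_one_le (w := 1) (a := p b) (e := p₁ b - θ * p b) hτ one_pos (by simp)
    have h3 := two_mul_le_of_one_le (w := 1) (a := q b) (e := q₁ b - θ * q b) hτ one_pos (by simp)
    have h4 : 1 / τ * (p₁ b - θ * p b) ^ 2 ≤ 1 / τ * (A * K) := by gcongr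
    have h5 : 1 / τ * (q₁ b - θ * q b) ^ 2 ≤ 1 / τ * (A * K) := by gcongr
    have h6 : A * K / τ = 1 / τ * (A * K) := by ring
    rw [h6]
    nlinarith [mul_nonneg_of_nonpos_of_nonpos hθ (neg_nonpos.2 (sq_nonneg (p b))),
      mul_nonneg_of_nonpos_of_nonpos hθ (neg_nonpos.2 (sq_nonneg (q b)))]
  -- boundary term at `σ`
  have b2 : -(p σ * p₁ σ + q σ * q₁ σ) ≤ (1 + C * k) * Z / 2 * (I + Y * A) := by
    have hF := D.F_pos D.hσ
    set R := (p₁ σ - ω * q σ) ^ 2 + (q₁ σ + ω * p σ) ^ 2 with hR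
    have h1 : -(p σ * p₁ σ + q σ * q₁ σ) ≤ (1 / 2) * (p σ ^ 2 + q σ ^ 2 + R) := by
      rw [hR]
      nlinarith [sq_nonneg (p σ + (p₁ σ - ω * q σ)), sq_nonneg (q σ + (q₁ σ + ω * p σ))]
    have hRF : 0 ≤ R / F σ := by positivity
    have hU0 : 0 ≤ p σ ^ 2 + q σ ^ 2 := by positivity
    have h2 : R ≤ C * k * (Z * (I + Y * A)) := by
      have e1 : F σ ≤ C * k := by
        refine (D.F_le σ D.hσ).trans ?_
        rw [mul_assoc]
        exact mul_le_mul_of_nonneg_left D.xσ hC.le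
      calc R = F σ * (R / F σ) := by field_simp
        _ ≤ C * k * (Z * (I + Y * A)) :=
          mul_le_mul e1 (by linarith) hRF (hF.le.trans e1)
    have h3 : p σ ^ 2 + q σ ^ 2 ≤ Z * (I + Y * A) := by linarith
    nlinarith
  have b3 : τ / 2 * (p b ^ 2 + q b ^ 2) ≤ τ / 2 * ((2 / m ^ 2 + 1) * J) := by gcongr
  have e1 : (K + 1 / 2) * A / τ = A * K / τ + 1 / (2 * τ) * A := by field_simp
  have e2 : τ * ((2 / m ^ 2 + 1) / 2 + 1 / (2 * m ^ 2)) * J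
    = τ / 2 * ((2 / m ^ 2 + 1) * J) + τ / (2 * m ^ 2) * J := by ring
  rw [e1, e2]
  linarith

end Outgoing

namespace Outgoing
variable {m c C k Λ ω σ s₁ b I A : ℝ} {F F' x x' w p p₁ q q₁ h g : ℝ → ℝ}

theorem amplitude_le (S : Outgoing ω I A F w p p₁ q q₁ h g)
    (D : NearData m c C k Λ ω σ s₁ b F F' x x' w) {θ K Q τ : ℝ}
    (hRp : (p₁ b - θ * p b) ^ 2 ≤ A * K) (hRq : (q₁ b - θ * q b) ^ 2 ≤ A * K)
    (hQ : ∀ s ≤ σ, p s ^ 2 + q s ^ 2 ≤ Q) (hτ : 0 < τ) :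
    m / 4 * I ≤ τ * (C / (2 * c) * k * Q + ((2 / m ^ 2 + 1) / 2 + 1 / (2 * m ^ 2)) *
      ∫ s in σ..b, energy ω F p p₁ q q₁ s) + (K + 1 / 2) * A / τ := by
  have hm := D.m_pos
  have hc := D.c_pos
  have hω : 0 < ω := lt_of_lt_of_le (by positivity) D.half_le
  have cE := S.continuous_energy D
  have cw := D.cw
  have cx' := D.cx'
  have ch := S.ch
  have cg := S.cg
  have hC : 0 < C := zero_lt_one.trans_le D.one_le_C
  have hσb : σ ≤ b := by linarith [D.hσ, D.hs₁]
  have hUb := (S.U_le D (s := b - 1) (by linarith [D.hσ, D.hs₁]) (by linarith)).2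
  rw [sub_add_cancel] at hUb
  set J := ∫ s in σ..b, energy ω F p p₁ q q₁ s with hJ
  have hQ0 : 0 ≤ Q := le_trans (by positivity) (hQ σ le_rfl)
  have dΦ : ∀ s, HasDerivAt (fun s => p s * q₁ s - q s * p₁ s) (p s * g s - q s * h s) s := fun s =>
    (((S.dp s).mul (S.dq₁ s)).sub ((S.dq s).mul (S.dp₁ s))).congr_deriv (by ring)
  have estb := sub_le_integral_of_deriv_le (a := σ) (b := b) hσb
    (f := fun s => p s * q₁ s - q s * p₁ s)
    (g := fun s => τ / (2 * m ^ 2) * energy ω F p p₁ q q₁ s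
      + 1 / (2 * τ) * (w s * (h s ^ 2 + g s ^ 2)))
    (fun s _ => dΦ s) (by fun_prop)
    (fun s hs => by
      have h1 := energy_ge (p := p) (p₁ := p₁) (q := q) (q₁ := q₁) D hs
      have hw := D.one_le_w s
      have h2 := two_mul_le_of_one_le (a := p s) (e := g s) hτ one_pos (by simpa using hw)
      have h3 := two_mul_le_of_one_le (a := -q s) (e := h s) hτ one_pos (by simpa using hw)
      have h4 : p s ^ 2 + q s ^ 2 ≤ 1 / m ^ 2 * energy ω F p p₁ q q₁ s := by
        have : m ^ 2 * (p s ^ 2 + q s ^ 2) ≤ energy ω F p p₁ q q₁ s := by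
          have : 0 ≤ p₁ s ^ 2 + q₁ s ^ 2 := by positivity
          linarith
        rw [one_div, ← div_eq_inv_mul, le_div_iff₀ (by positivity)]
        linarith
      have h5 : τ / 2 * (p s ^ 2 + q s ^ 2) ≤ τ / (2 * m ^ 2) * energy ω F p p₁ q q₁ s := by
        refine (mul_le_mul_of_nonneg_left h4 (by positivity)).trans (le_of_eq ?_)
        field_simp
      have h6 : 1 / (2 * τ) * (w s * (h s ^ 2 + g s ^ 2))
          = 1 / 2 * (w s / τ * h s ^ 2) + 1 / 2 * (w s / τ * g s ^ 2) := by field_simp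
      rw [h6]
      linarith)
  rw [intervalIntegral.integral_add (Continuous.intervalIntegrable (by fun_prop) _ _)
    (Continuous.intervalIntegrable (by fun_prop) _ _), intervalIntegral.integral_const_mul,
    intervalIntegral.integral_const_mul, ← hJ] at estb
  have b1 : -(p b * q₁ b - q b * p₁ b) ≤ τ / 2 * (p b ^ 2 + q b ^ 2) + A * K / τ := by
    have h2 := two_mul_le_of_one_le (w := 1) (a := q b) (e := p₁ b - θ * p b) hτ one_pos (by simp)
    have h3 := two_mul_le_of_one_le (w := 1) (a := -p b) (e := q₁ b - θ * q b) hτ one_pos (by simp)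
    have h4 : 1 / τ * (p₁ b - θ * p b) ^ 2 ≤ 1 / τ * (A * K) := by gcongr
    have h5 : 1 / τ * (q₁ b - θ * q b) ^ 2 ≤ 1 / τ * (A * K) := by gcongr
    have h6 : A * K / τ = 1 / τ * (A * K) := by ring
    rw [h6]
    linarith
  have key : ∀ a ≤ σ, ω / 2 * (p a ^ 2 + q a ^ 2) -
      1 / (2 * ω) * ((p₁ a - ω * q a) ^ 2 + (q₁ a + ω * p a) ^ 2) ≤
      τ * (C / (2 * c) * k * Q + ((2 / m ^ 2 + 1) / 2 + 1 / (2 * m ^ 2)) * J)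
        + (K + 1 / 2) * A / τ := by
    intro a ha
    have esta := sub_le_integral_of_deriv_le (a := a) (b := σ) ha
      (f := fun s => p s * q₁ s - q s * p₁ s)
      (g := fun s => τ * (C / (2 * c) * Q) * x' s + 1 / (2 * τ) * (w s * (h s ^ 2 + g s ^ 2)))
      (fun s _ => dΦ s) (by fun_prop)
      (fun s hs => by
        have hs1 : s ≤ s₁ := hs.2.trans D.hσ
        have hx := D.x_pos s
        have hw : 1 ≤ C * x s * w s := by linarith [D.w_ge s hs1]
        have h2 := two_mul_le_of_one_le (a := p s) (e := g s) hτ (by positivity) hw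
        have h3 := two_mul_le_of_one_le (a := -q s) (e := h s) hτ (by positivity) hw
        have h4 : τ * (C * x s) / 2 * (p s ^ 2 + q s ^ 2) ≤ τ * (C / (2 * c) * Q) * x' s := by
          calc τ * (C * x s) / 2 * (p s ^ 2 + q s ^ 2) ≤ τ * (C * x s) / 2 * Q := by
                have := hQ s hs.2
                gcongr
            _ = τ * (C / (2 * c) * Q) * (c * x s) := by field_simp
            _ ≤ _ := by
                have := D.x'_ge s hs1
                gcongr
        have h6 : 1 / (2 * τ) * (w s * (h s ^ 2 + g s ^ 2))
            = 1 / 2 * (w s / τ * h s ^ 2) + 1 / 2 * (w s / τ * g s ^ 2) := by field_simp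
        rw [h6]
        linarith)
    rw [intervalIntegral.integral_add (Continuous.intervalIntegrable (by fun_prop) _ _)
      (Continuous.intervalIntegrable (by fun_prop) _ _), intervalIntegral.integral_const_mul,
      intervalIntegral.integral_const_mul, intervalIntegral.integral_eq_sub_of_hasDerivAt
        (fun t _ => D.dx t) (cx'.intervalIntegrable _ _)] at esta
    have hAA : 1 / (2 * τ) * (∫ s in a..σ, w s * (h s ^ 2 + g s ^ 2))
        + 1 / (2 * τ) * (∫ s in σ..b, w s * (h s ^ 2 + g s ^ 2)) ≤ 1 / (2 * τ) * A := by
      rw [← mul_add, intervalIntegral.integral_add_adjacent_intervals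
        (Continuous.intervalIntegrable (by fun_prop) _ _)
        (Continuous.intervalIntegrable (by fun_prop) _ _)]
      exact mul_le_mul_of_nonneg_left (S.hA a b (ha.trans hσb)) (by positivity)
    have hxk : τ * (C / (2 * c) * Q) * (x σ - x a) ≤ τ * (C / (2 * c) * Q) * k := by
      have h1 : x σ - x a ≤ k := by
        have := D.xσ
        have h2 : x σ ≤ Λ * x σ := le_mul_of_one_le_left (D.x_pos σ).le D.one_le_Λ
        linarith [D.x_pos a]
      gcongr
    have b0 : ω / 2 * (p a ^ 2 + q a ^ 2) -
        1 / (2 * ω) * ((p₁ a - ω * q a) ^ 2 + (q₁ a + ω * p a) ^ 2) ≤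
        -(p a * q₁ a - q a * p₁ a) := by
      have : -(p a * q₁ a - q a * p₁ a) - (ω / 2 * (p a ^ 2 + q a ^ 2) -
        1 / (2 * ω) * ((p₁ a - ω * q a) ^ 2 + (q₁ a + ω * p a) ^ 2)) =
          1 / (2 * ω) * ((p₁ a - ω * q a + ω * q a) ^ 2 + (q₁ a + ω * p a - ω * p a) ^ 2) := by
        field_simp; ring
      have h2 : 0 ≤ 1 / (2 * ω) *
        ((p₁ a - ω * q a + ω * q a) ^ 2 + (q₁ a + ω * p a - ω * p a) ^ 2) := by positivity
      linarith
    have b3 : τ / 2 * (p b ^ 2 + q b ^ 2) ≤ τ / 2 * ((2 / m ^ 2 + 1) * J) := by gcongr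
    have e1 : (K + 1 / 2) * A / τ = A * K / τ + 1 / (2 * τ) * A := by field_simp
    have e2 : τ * (C / (2 * c) * k * Q + ((2 / m ^ 2 + 1) / 2 + 1 / (2 * m ^ 2)) * J)
      = τ * (C / (2 * c) * Q) * k + τ / 2 * ((2 / m ^ 2 + 1) * J) + τ / (2 * m ^ 2) * J := by ring
    rw [e1, e2]
    linarith
  have lim : Tendsto (fun a => ω / 2 * (p a ^ 2 + q a ^ 2) -
      1 / (2 * ω) * ((p₁ a - ω * q a) ^ 2 + (q₁ a + ω * p a) ^ 2)) atBot
      (nhds (ω / 2 * I - 1 / (2 * ω) * (0 ^ 2 + 0 ^ 2))) :=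
    (S.lim_U.const_mul _).sub (((S.lim_v₁.pow 2).add (S.lim_v₂.pow 2)).const_mul _)
  have fin := le_of_tendsto lim (eventually_le_atBot σ |>.mono key)
  have hI := S.I_nonneg
  have : m / 4 * I ≤ ω / 2 * I := mul_le_mul_of_nonneg_right (by linarith [D.half_le]) hI
  refine this.trans (le_trans (le_of_eq ?_) fin)
  ring

/-- The closed estimate: amplitude and energy are controlled by the source. -/
theorem exists_energy_bound {m c C k K : ℝ} (hm : 0 < m) (hc : 0 < c) (hC : 1 ≤ C) (hk : 0 < k)
    (hK : 0 ≤ K) : ∃ G, 0 < G ∧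
    ∀ (Λ ω σ s₁ b I A θ : ℝ) (F F' x x' w p p₁ q q₁ h g : ℝ → ℝ),
      NearData m c C k Λ ω σ s₁ b F F' x x' w → Outgoing ω I A F w p p₁ q q₁ h g →
      θ ≤ 0 → (p₁ b - θ * p b) ^ 2 ≤ A * K → (q₁ b - θ * q b) ^ 2 ≤ A * K →
      (∫ s in σ..b, energy ω F p p₁ q q₁ s) ≤ G * A ∧ ∀ s ≤ σ, p s ^ 2 + q s ^ 2 ≤ G * A := by
  have hC0 : 0 < C := zero_lt_one.trans_le hC
  set Z := Real.exp (16 * C * k / c ^ 2)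
  have hZ : 0 < Z := Real.exp_pos _
  set Y := Real.exp (2 / c) * C / c + 4 * C / c ^ 2 with hY
  have hY0 : 0 < Y := by positivity
  obtain ⟨G, hG, hGG⟩ := absorb (α := (2 / m ^ 2 + 1) / 2 + 1 / (2 * m ^ 2)) (β := K + 1 / 2)
    (γ := (1 + C * k) * Z / 2) (μ := m / 4) (ε := C / (2 * c) * k * Z)
    (α₂ := (2 / m ^ 2 + 1) / 2 + 1 / (2 * m ^ 2)) (Y := Y) (by positivity) (by positivity)
    (by positivity) (by positivity) (by positivity) (by positivity) hY0
  refine ⟨G + Z * (G + Y), by positivity, ?_⟩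
  intro Λ ω σ s₁ b I A θ F F' x x' w p p₁ q q₁ h g D S hθ hRp hRq
  have hA := S.A_nonneg
  have hQ : ∀ s ≤ σ, p s ^ 2 + q s ^ 2
      + ((p₁ s - ω * q s) ^ 2 + (q₁ s + ω * p s) ^ 2) / F s ≤ Z * (I + Y * A) := fun s hs => S.Q_le D hs
  have hQ' : ∀ s ≤ σ, p s ^ 2 + q s ^ 2 ≤ Z * (I + Y * A) := fun s hs => by
    refine le_trans (le_add_of_nonneg_right ?_) (hQ s hs)
    have := D.F_pos (hs.trans D.hσ)
    positivity
  obtain ⟨h1, h2⟩ := hGG I (∫ s in σ..b, energy ω F p p₁ q q₁ s) A hA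
    (fun τ hτ => S.energy_le D hθ hRp hRq (hQ σ le_rfl) hτ)
    (fun τ hτ => by
      refine (S.amplitude_le D hRp hRq hQ' hτ).trans (le_of_eq ?_)
      ring)
  refine ⟨h1.trans ?_, fun s hs => (hQ' s hs).trans ?_⟩
  · have : 0 ≤ Z * (G + Y) * A := by positivity
    linarith
  · calc Z * (I + Y * A) ≤ Z * (G * A + Y * A) := by gcongr
      _ = Z * (G + Y) * A := by ring
      _ ≤ _ := by
        have : 0 ≤ G * A := by positivity
        linarith

end Outgoing

namespace Outgoing
variable {m c C k Λ ω σ s₁ b I A : ℝ} {F F' x x' w p p₁ q q₁ h g : ℝ → ℝ}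

/-- The redshift estimate. -/
theorem redshift (S : Outgoing ω I A F w p p₁ q q₁ h g)
    (D : NearData m c C k Λ ω σ s₁ b F F' x x' w) {a : ℝ} (ha : a ≤ s₁) :
    ∫ s in a..s₁, w s * ((p₁ s - ω * q s) ^ 2 + (q₁ s + ω * p s) ^ 2) ≤
      2 * C ^ 2 * Λ / c * (((p₁ a - ω * q a) ^ 2 + (q₁ a + ω * p a) ^ 2) / F a
        + (p s₁ ^ 2 + q s₁ ^ 2) + 2 * C / (c ^ 2 * Λ) * A) := by
  have hc := D.c_pos
  have hC : 0 < C := zero_lt_one.trans_le D.one_le_C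
  have hΛ : 0 < Λ := zero_lt_one.trans_le D.one_le_Λ
  have cw := D.cw
  have ch := S.ch
  have cg := S.cg
  have cp := S.cp
  have cq := S.cq
  have cp₁ := S.cp₁
  have cq₁ := S.cq₁
  have est := sub_le_integral_of_deriv_le ha (fun t ht => (S.dRF D ht.2).sub (S.dU t))
    (g := fun s => -(c / (2 * C ^ 2 * Λ)) *
      (w s * ((p₁ s - ω * q s) ^ 2 + (q₁ s + ω * p s) ^ 2))
      + 2 * C / (c ^ 2 * Λ) * (w s * (h s ^ 2 + g s ^ 2)))
    (by fun_prop) (fun t ht => by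
      have ht1 : t ≤ s₁ := ht.2
      have hxt := D.x_pos t
      have hFc := D.F_ge t ht1
      have hFC := D.F_le t ht1
      have hF0 := D.F_pos ht1
      have hF' := D.F'_ge t ht1
      have hw := D.w_ge t ht1
      have hw' := D.w_le t ht1
      have hw1 : 0 < w t := zero_lt_one.trans_le (D.one_le_w t)
      set v₁ := p₁ t - ω * q t
      set v₂ := q₁ t + ω * p t
      set f := F t
      have a2 : 2 * (h t * v₁ + g t * v₂) / f ≤ 2 / (c * f) * (h t ^ 2 + g t ^ 2)
          + c / (2 * f) * (v₁ ^ 2 + v₂ ^ 2) := by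
        have : 2 / (c * f) * (h t ^ 2 + g t ^ 2) + c / (2 * f) * (v₁ ^ 2 + v₂ ^ 2)
            - 2 * (h t * v₁ + g t * v₂) / f
            = c / (2 * f) * ((2 / c * h t - v₁) ^ 2 + (2 / c * g t - v₂) ^ 2) := by
          field_simp; ring
        have h2 : 0 ≤ c / (2 * f) * ((2 / c * h t - v₁) ^ 2 + (2 / c * g t - v₂) ^ 2) := by
          positivity
        linarith
      have a3 : c / (2 * f) * (v₁ ^ 2 + v₂ ^ 2) + c / (2 * f) * (v₁ ^ 2 + v₂ ^ 2) ≤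
          F' t / f ^ 2 * (v₁ ^ 2 + v₂ ^ 2) := by
        rw [← add_mul]
        refine mul_le_mul_of_nonneg_right ?_ (by positivity)
        rw [le_div_iff₀ (by positivity)]
        have : (c / (2 * f) + c / (2 * f)) * f ^ 2 = c * f := by field_simp; ring
        rw [this]
        exact hF'
      have a4 : c / (2 * C ^ 2 * Λ) * (w t * (v₁ ^ 2 + v₂ ^ 2)) ≤
          c / (2 * f) * (v₁ ^ 2 + v₂ ^ 2) := by
        rw [← mul_assoc]
        refine mul_le_mul_of_nonneg_right ?_ (by positivity)
        rw [le_div_iff₀ (by positivity)]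
        calc c / (2 * C ^ 2 * Λ) * w t * (2 * f) ≤ c / (2 * C ^ 2 * Λ) * w t * (2 * (C * Λ * x t)) := by
              gcongr
          _ = c / C * (w t * x t) := by field_simp
          _ ≤ c / C * C := by gcongr
          _ = c := by field_simp
      have a5 : 2 / (c * f) * (h t ^ 2 + g t ^ 2) ≤
          2 * C / (c ^ 2 * Λ) * (w t * (h t ^ 2 + g t ^ 2)) := by
        have e1 : 2 / (c * f) ≤ 2 * C / (c ^ 2 * Λ) * w t := by
          rw [div_le_iff₀ (by positivity)]
          calc (2:ℝ) = 2 * 1 := by ring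
            _ ≤ 2 * (C * w t * x t) := by gcongr
            _ = 2 * C / (c ^ 2 * Λ) * w t * (c * (c * Λ * x t)) := by field_simp
            _ ≤ 2 * C / (c ^ 2 * Λ) * w t * (c * f) := by gcongr
        rw [← mul_assoc]
        exact mul_le_mul_of_nonneg_right e1 (by positivity)
      linarith)
  rw [intervalIntegral.integral_add (Continuous.intervalIntegrable (by fun_prop) _ _)
      (Continuous.intervalIntegrable (by fun_prop) _ _), intervalIntegral.integral_const_mul,
      intervalIntegral.integral_const_mul] at est
  simp only [Pi.sub_apply] at est
  have h1 : 0 ≤ ((p₁ s₁ - ω * q s₁) ^ 2 + (q₁ s₁ + ω * p s₁) ^ 2) / F s₁ := by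
    have := D.F_pos le_rfl
    positivity
  have h2 : 0 ≤ p a ^ 2 + q a ^ 2 := by positivity
  have h3 := mul_le_mul_of_nonneg_left (S.hA a s₁ ha)
    (show 0 ≤ 2 * C / (c ^ 2 * Λ) by positivity)
  set W := ∫ s in a..s₁, w s * ((p₁ s - ω * q s) ^ 2 + (q₁ s + ω * p s) ^ 2)
  have h4 : c / (2 * C ^ 2 * Λ) * W ≤ ((p₁ a - ω * q a) ^ 2 + (q₁ a + ω * p a) ^ 2) / F a
        + (p s₁ ^ 2 + q s₁ ^ 2) + 2 * C / (c ^ 2 * Λ) * A := by linarith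
  have h5 : W = 2 * C ^ 2 * Λ / c * (c / (2 * C ^ 2 * Λ) * W) := by field_simp
  rw [h5]
  exact mul_le_mul_of_nonneg_left h4 (by positivity)

theorem exists_total_bound {m c C k K Gφ : ℝ} (hm : 0 < m) (hc : 0 < c) (hC : 1 ≤ C) (hk : 0 < k)
    (hK : 0 ≤ K) (hGφ : 0 ≤ Gφ) : ∃ G, 0 < G ∧
    ∀ (Λ ω σ s₁ b I A θ : ℝ) (F F' x x' w p p₁ q q₁ h g φ : ℝ → ℝ),
      NearData m c C k Λ ω σ s₁ b F F' x x' w → Outgoing ω I A F w p p₁ q q₁ h g →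
      θ ≤ 0 → (p₁ b - θ * p b) ^ 2 ≤ A * K → (q₁ b - θ * q b) ^ 2 ≤ A * K →
      Continuous φ → (∀ s, 0 ≤ φ s) → (∀ s, φ s ≤ 1) → (∀ a ≤ σ, ∫ s in a..σ, φ s ≤ Gφ) →
      ∀ t ≤ b, ∫ s in t..b, (w s * ((p₁ s - ω * q s) ^ 2 + (q₁ s + ω * p s) ^ 2)
        + φ s * (p₁ s ^ 2 + q₁ s ^ 2 + (p s ^ 2 + q s ^ 2))) ≤ G * Λ * A := by
  have hC0 : 0 < C := zero_lt_one.trans_le hC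
  obtain ⟨G₀, hG₀, hGG⟩ := exists_energy_bound hm hc hC hk hK
  set Y := Real.exp (2 / c) * C / c with hY
  have hY0 : 0 < Y := by positivity
  set E₁ := 2 * C + 1 + (2 * C + 1 / m ^ 2) with hE₁
  refine ⟨6 * C ^ 2 / c * (Y + (2 / m ^ 2 + 1) * G₀ + 2 * C / c ^ 2)
    + (2 * m ^ 2 + 1) * (G₀ * Gφ + G₀ / m ^ 2) + E₁ * G₀, by positivity, ?_⟩
  intro Λ ω σ s₁ b I A θ F F' x x' w p p₁ q q₁ h g φ D S hθ hRp hRq cφ hφ0 hφ1 hφ t htb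
  obtain ⟨hJ, hU⟩ := hGG _ _ _ _ _ _ _ _ _ _ _ _ _ _ _ _ _ _ _ D S hθ hRp hRq
  have hA := S.A_nonneg
  have hΛ := D.one_le_Λ
  have hΛ0 : 0 < Λ := zero_lt_one.trans_le hΛ
  have hω : 0 < ω := lt_of_lt_of_le (by positivity) D.half_le
  have hω2 : ω ^ 2 ≤ m ^ 2 := pow_le_pow_left₀ hω.le D.le_m 2
  have cw := D.cw
  have cp := S.cp
  have cq := S.cq
  have cp₁ := S.cp₁
  have cq₁ := S.cq₁
  have cE := S.continuous_energy D
  set J := ∫ s in σ..b, energy ω F p p₁ q q₁ s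
  let R : ℝ → ℝ := fun s => (p₁ s - ω * q s) ^ 2 + (q₁ s + ω * p s) ^ 2
  let U : ℝ → ℝ := fun s => p s ^ 2 + q s ^ 2
  let T : ℝ → ℝ := fun s => w s * R s + φ s * (p₁ s ^ 2 + q₁ s ^ 2 + U s)
  have cR : Continuous R := by fun_prop
  have cU : Continuous U := by fun_prop
  have cT : Continuous T := by fun_prop
  have hR0 : ∀ s, 0 ≤ R s := fun s => by simp only [R]; positivity
  have hU0 : ∀ s, 0 ≤ U s := fun s => by simp only [U]; positivity
  have hw0 : ∀ s, 0 ≤ w s := fun s => zero_le_one.trans (D.one_le_w s)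
  have hT0 : ∀ s, 0 ≤ T s := fun s => by
    have := hR0 s; have := hU0 s; have := hw0 s; have := hφ0 s
    simp only [T]; positivity
  have ii : ∀ {f : ℝ → ℝ}, Continuous f → ∀ a b, IntervalIntegrable f volume a b :=
    fun hf a b => hf.intervalIntegrable a b
  have split : ∀ s, p₁ s ^ 2 + q₁ s ^ 2 ≤ 2 * R s + 2 * m ^ 2 * U s := fun s => by
    have h1 : p₁ s ^ 2 + q₁ s ^ 2 ≤ 2 * R s + 2 * ω ^ 2 * U s := by
      have : 2 * R s + 2 * ω ^ 2 * U s - (p₁ s ^ 2 + q₁ s ^ 2)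
          = (p₁ s - 2 * ω * q s) ^ 2 + (q₁ s + 2 * ω * p s) ^ 2 := by simp only [R, U]; ring
      have h2 : 0 ≤ (p₁ s - 2 * ω * q s) ^ 2 + (q₁ s + 2 * ω * p s) ^ 2 := by positivity
      linarith
    have h2 : 2 * ω ^ 2 * U s ≤ 2 * m ^ 2 * U s := by have := hU0 s; gcongr
    linarith
  have split' : ∀ s, R s ≤ 2 * (p₁ s ^ 2 + q₁ s ^ 2) + 2 * m ^ 2 * U s := fun s => by
    have h1 : R s ≤ 2 * (p₁ s ^ 2 + q₁ s ^ 2) + 2 * ω ^ 2 * U s := by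
      have : 2 * (p₁ s ^ 2 + q₁ s ^ 2) + 2 * ω ^ 2 * U s - R s
          = (p₁ s + ω * q s) ^ 2 + (q₁ s - ω * p s) ^ 2 := by simp only [R, U]; ring
      have h2 : 0 ≤ (p₁ s + ω * q s) ^ 2 + (q₁ s - ω * p s) ^ 2 := by positivity
      linarith
    have h2 : 2 * ω ^ 2 * U s ≤ 2 * m ^ 2 * U s := by have := hU0 s; gcongr
    linarith
  have hEU : ∀ s ∈ Icc σ b, U s ≤ 1 / m ^ 2 * energy ω F p p₁ q q₁ s := fun s hs => by
    have h1 := energy_ge (p := p) (p₁ := p₁) (q := q) (q₁ := q₁) D hs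
    have h2 : 0 ≤ p₁ s ^ 2 + q₁ s ^ 2 := by positivity
    rw [one_div, ← div_eq_inv_mul, le_div_iff₀ (by positivity)]
    simp only [U]
    linarith
  have hEP : ∀ s ∈ Icc σ b, p₁ s ^ 2 + q₁ s ^ 2 + m ^ 2 * U s ≤ energy ω F p p₁ q q₁ s :=
    fun s hs => energy_ge D hs
  have hσ := D.hσ
  have hs₁ := D.hs₁
  have key : ∀ a ≤ σ, ∫ s in a..b, T s ≤
      3 * (2 * C ^ 2 * Λ / c * (R a / F a + (2 / m ^ 2 + 1) * J + 2 * C / (c ^ 2 * Λ) * A))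
      + (2 * m ^ 2 + 1) * (G₀ * A * Gφ + J / m ^ 2) + E₁ * J := by
    intro a ha
    have i1 : ∫ s in a..s₁, T s ≤ 3 * (∫ s in a..s₁, w s * R s)
        + (2 * m ^ 2 + 1) * ∫ s in a..s₁, φ s * U s := by
      rw [← intervalIntegral.integral_const_mul, ← intervalIntegral.integral_const_mul,
        ← intervalIntegral.integral_add (ii (by fun_prop) _ _) (ii (by fun_prop) _ _)]
      refine intervalIntegral.integral_mono_on (ha.trans hσ) (ii cT _ _) (ii (by fun_prop) _ _)
        fun s _ => ?_
      have h1 := mul_le_mul_of_nonneg_left (split s) (hφ0 s)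
      have h2 : φ s * R s ≤ w s * R s :=
        mul_le_mul_of_nonneg_right ((hφ1 s).trans (D.one_le_w s)) (hR0 s)
      simp only [T]
      linarith
    have i2 : ∫ s in a..σ, φ s * U s ≤ G₀ * A * Gφ := by
      have : ∫ s in a..σ, φ s * U s ≤ ∫ s in a..σ, G₀ * A * φ s :=
        intervalIntegral.integral_mono_on ha (ii (by fun_prop) _ _) (ii (by fun_prop) _ _)
          fun s hs => by
            rw [mul_comm (φ s)]
            exact mul_le_mul_of_nonneg_right (hU s hs.2) (hφ0 s)
      rw [intervalIntegral.integral_const_mul] at this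
      exact this.trans (mul_le_mul_of_nonneg_left (hφ a ha) (by positivity))
    have i3 : ∫ s in σ..s₁, φ s * U s ≤ J / m ^ 2 := by
      have h1 : ∫ s in σ..s₁, φ s * U s ≤ ∫ s in σ..s₁, 1 / m ^ 2 * energy ω F p p₁ q q₁ s :=
        intervalIntegral.integral_mono_on hσ (ii (by fun_prop) _ _) (ii (by fun_prop) _ _)
          fun s hs => (mul_le_of_le_one_left (hU0 s) (hφ1 s)).trans
            (hEU s ⟨hs.1, by linarith [hs.2]⟩)
      rw [intervalIntegral.integral_const_mul] at h1
      have h2 := mul_le_mul_of_nonneg_left (S.integral_energy_mono D le_rfl hσ (by linarith))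
        (show 0 ≤ 1 / m ^ 2 by positivity)
      rw [div_eq_inv_mul, ← one_div]
      exact h1.trans h2
    have i4 : ∫ s in s₁..b, T s ≤ E₁ * J := by
      have h1 : ∫ s in s₁..b, T s ≤ ∫ s in s₁..b, E₁ * energy ω F p p₁ q q₁ s :=
        intervalIntegral.integral_mono_on (by linarith) (ii cT _ _) (ii (by fun_prop) _ _)
          fun s hs => by
            have hs' : s ∈ Icc σ b := ⟨hσ.trans hs.1, hs.2⟩
            have b1 := hEU s hs'
            have b2 := hEP s hs'
            have b3 : w s * R s ≤ C * (2 * (p₁ s ^ 2 + q₁ s ^ 2) + 2 * m ^ 2 * U s) :=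
              mul_le_mul (D.w_le' s hs) (split' s) (hR0 s) hC0.le
            have b4 : φ s * (p₁ s ^ 2 + q₁ s ^ 2 + U s) ≤ p₁ s ^ 2 + q₁ s ^ 2 + U s :=
              mul_le_of_le_one_left (by have := hU0 s; positivity) (hφ1 s)
            have b5 : C * (2 * (p₁ s ^ 2 + q₁ s ^ 2) + 2 * m ^ 2 * U s) ≤
                2 * C * energy ω F p p₁ q q₁ s := by
              have := mul_le_mul_of_nonneg_left b2 (show 0 ≤ 2 * C by positivity)
              linarith
            have b6 : 0 ≤ 2 * C * energy ω F p p₁ q q₁ s :=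
              mul_nonneg (by positivity) (energy_nonneg D hs')
            have b7 : p₁ s ^ 2 + q₁ s ^ 2 ≤ energy ω F p p₁ q q₁ s := by
              have : 0 ≤ m ^ 2 * U s := mul_nonneg (by positivity) (hU0 s)
              linarith
            simp only [T]
            have b8 : E₁ * energy ω F p p₁ q q₁ s = 2 * C * energy ω F p p₁ q q₁ s
              + energy ω F p p₁ q q₁ s + 2 * C * energy ω F p p₁ q q₁ s
              + 1 / m ^ 2 * energy ω F p p₁ q q₁ s := by rw [hE₁]; ring
            rw [b8]
            linarith
      rw [intervalIntegral.integral_const_mul] at h1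
      exact h1.trans (mul_le_mul_of_nonneg_left (S.integral_energy_mono D hσ (by linarith) le_rfl)
        (by positivity))
    have i5 := S.redshift D (ha.trans hσ)
    have i6 : ∫ s in a..s₁, w s * R s ≤
        2 * C ^ 2 * Λ / c * (R a / F a + (2 / m ^ 2 + 1) * J + 2 * C / (c ^ 2 * Λ) * A) := by
      refine i5.trans (mul_le_mul_of_nonneg_left ?_ (by positivity))
      have := (S.U_le D hσ hs₁).1
      simp only [R]
      linarith
    have i7 : ∫ s in a..s₁, φ s * U s ≤ G₀ * A * Gφ + J / m ^ 2 := by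
      rw [← intervalIntegral.integral_add_adjacent_intervals (ii (by fun_prop) a σ)
        (ii (by fun_prop) σ s₁)]
      linarith
    have i8 := mul_le_mul_of_nonneg_left i7 (show 0 ≤ 2 * m ^ 2 + 1 by positivity)
    rw [← intervalIntegral.integral_add_adjacent_intervals (ii cT a s₁) (ii cT s₁ b)]
    linarith
  change ∫ s in t..b, T s ≤ _
  refine le_of_forall_pos_le_add fun η hη => ?_
  obtain ⟨a, ha1, ha2, ha3⟩ := ((eventually_le_atBot σ).and ((eventually_le_atBot t).and
    (S.eventually_RF_le D (η := η * c / (6 * C ^ 2 * Λ)) (by positivity)))).exists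
  have h1 : ∫ s in t..b, T s ≤ ∫ s in a..b, T s :=
    intervalIntegral.integral_mono_interval ha2 htb le_rfl (ae_of_all _ hT0) (ii cT _ _)
  refine h1.trans ((key a ha1).trans ?_)
  have hAΛ : A / Λ ≤ A := div_le_self hA hΛ
  have h2 : R a / F a ≤ Y * A + η * c / (6 * C ^ 2 * Λ) :=
    ha3.trans (by gcongr)
  have h3 : 2 * C / (c ^ 2 * Λ) * A ≤ 2 * C / c ^ 2 * A := by
    have : c ^ 2 ≤ c ^ 2 * Λ := le_mul_of_one_le_right (by positivity) hΛ
    gcongr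
  have hAA : A ≤ Λ * A := le_mul_of_one_le_left hA hΛ
  calc _ ≤ 3 * (2 * C ^ 2 * Λ / c * (Y * A + η * c / (6 * C ^ 2 * Λ)
          + (2 / m ^ 2 + 1) * (G₀ * A) + 2 * C / c ^ 2 * A))
      + (2 * m ^ 2 + 1) * (G₀ * A * Gφ + G₀ * A / m ^ 2) + E₁ * (G₀ * A) := by gcongr
    _ = 6 * C ^ 2 / c * (Y + (2 / m ^ 2 + 1) * G₀ + 2 * C / c ^ 2) * (Λ * A)
      + ((2 * m ^ 2 + 1) * (G₀ * Gφ + G₀ / m ^ 2) + E₁ * G₀) * A + η := by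
        field_simp; ring
    _ ≤ 6 * C ^ 2 / c * (Y + (2 / m ^ 2 + 1) * G₀ + 2 * C / c ^ 2) * (Λ * A)
      + ((2 * m ^ 2 + 1) * (G₀ * Gφ + G₀ / m ^ 2) + E₁ * G₀) * (Λ * A) + η := by gcongr
    _ = _ := by ring

end Outgoing

/-- The radius as a function of the tortoise coordinate on a subextremal Reissner–Nordström
exterior with horizons `rm < rp` and surface gravity `κ`. -/
structure IsRadius (M E rm rp κ : ℝ) (rofs : ℝ → ℝ) : Prop where
  M_pos : 0 < M
  rm_nonneg : 0 ≤ rm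
  rm_lt : rm < rp
  sum : rm + rp = 2 * M
  prod : rm * rp = E ^ 2
  κ_pos : 0 < κ
  κ_eq : κ * rp ^ 2 = rp - M
  gt : ∀ s, rp < rofs s
  eq : ∀ s, rofs s + (2 * κ)⁻¹ * Real.log ((rofs s - rm) * (rofs s - rp)) = s

theorem isRadius_of_explicit {M E rm rp κ : ℝ} (hM : 0 < M) (hE : |E| < M)
    (hrm : rm = M - Real.sqrt (M ^ 2 - E ^ 2)) (hrp : rp = M + Real.sqrt (M ^ 2 - E ^ 2))
    (hκ : κ = (M * rp - E ^ 2) / rp ^ 3) {rofs : ℝ → ℝ} (hr1 : ∀ s : ℝ, rp < rofs s)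
    (hr2 : ∀ s : ℝ, rofs s + (2 * κ)⁻¹ * Real.log ((rofs s - rm) * (rofs s - rp)) = s) :
    IsRadius M E rm rp κ rofs := by
  have h1 : E ^ 2 < M ^ 2 := by rw [← sq_abs E]; exact pow_lt_pow_left₀ hE (abs_nonneg _) (by simp)
  have h2 : 0 < Real.sqrt (M ^ 2 - E ^ 2) := Real.sqrt_pos.2 (by linarith)
  have h3 := Real.sq_sqrt (show 0 ≤ M ^ 2 - E ^ 2 by linarith)
  set S := Real.sqrt (M ^ 2 - E ^ 2)
  have h4 : S ≤ M := by
    refine le_of_sq_le_sq ?_ hM.le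
    nlinarith [sq_nonneg E]
  have hrp0 : 0 < rp := by linarith
  have h5 : κ * rp ^ 2 = rp - M := by
    rw [hκ]
    field_simp
    rw [hrp]; nlinarith
  refine ⟨hM, by linarith, by linarith, by linarith, by rw [hrm, hrp]; nlinarith, ?_, h5, hr1, hr2⟩
  by_contra h
  nlinarith [mul_nonneg (neg_nonneg.2 (not_lt.1 h)) (sq_nonneg rp)]

namespace IsRadius
variable {M E rm rp κ : ℝ} {rofs : ℝ → ℝ}

theorem rp_pos (R : IsRadius M E rm rp κ rofs) : 0 < rp := R.rm_nonneg.trans_lt R.rm_lt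

theorem M_lt (R : IsRadius M E rm rp κ rofs) : M < rp := by linarith [R.sum, R.rm_lt]

theorem rm_lt_r (R : IsRadius M E rm rp κ rofs) (s : ℝ) : rm < rofs s := R.rm_lt.trans (R.gt s)

theorem r_pos (R : IsRadius M E rm rp κ rofs) (s : ℝ) : 0 < rofs s := R.rp_pos.trans (R.gt s)

theorem log_mono (R : IsRadius M E rm rp κ rofs) {a b : ℝ} (ha : rp < a) (hab : a ≤ b) :
    (2 * κ)⁻¹ * Real.log ((a - rm) * (a - rp)) ≤ (2 * κ)⁻¹ * Real.log ((b - rm) * (b - rp)) := by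
  have h1 := R.rm_lt
  have h2 := R.κ_pos
  have h3 : 0 < a - rm := by linarith
  have h4 : 0 < a - rp := by linarith
  have h5 : 0 < b - rm := by linarith
  gcongr

theorem strictMono (R : IsRadius M E rm rp κ rofs) : StrictMono rofs := by
  intro s t hst
  by_contra h
  have h1 := R.log_mono (R.gt t) (not_lt.1 h)
  linarith [R.eq s, R.eq t]

theorem sub_le (R : IsRadius M E rm rp κ rofs) {s t : ℝ} (hst : s ≤ t) :
    rofs t - rofs s ≤ t - s := by
  have h1 := R.log_mono (R.gt s) (R.strictMono.monotone hst)
  linarith [R.eq s, R.eq t]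

theorem continuous (R : IsRadius M E rm rp κ rofs) : Continuous rofs := by
  refine (LipschitzWith.of_le_add fun s t => ?_).continuous
  rcases le_total s t with h | h
  · linarith [R.strictMono.monotone h, dist_nonneg (x := s) (y := t)]
  · rw [Real.dist_eq]
    linarith [R.sub_le h, le_abs_self (s - t)]

theorem rofs_apply (R : IsRadius M E rm rp κ rofs) {r : ℝ} (hr : rp < r) :
    rofs (r + (2 * κ)⁻¹ * Real.log ((r - rm) * (r - rp))) = r := by
  set s := r + (2 * κ)⁻¹ * Real.log ((r - rm) * (r - rp)) with hs
  have e := R.eq s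
  rcases lt_trichotomy (rofs s) r with h | h | h
  · linarith [R.log_mono (R.gt s) h.le]
  · exact h
  · linarith [R.log_mono hr h.le]

theorem exists_eq (R : IsRadius M E rm rp κ rofs) {r : ℝ} (hr : rp < r) : ∃ s, rofs s = r :=
  ⟨_, R.rofs_apply hr⟩

/-- The derivative of the radius with respect to the tortoise coordinate. -/
noncomputable def speed (M rm rp κ r : ℝ) : ℝ :=
  (r - rm) * (r - rp) / ((r - rm) * (r - rp) + (r - M) / κ)

theorem Δ_pos (R : IsRadius M E rm rp κ rofs) (s : ℝ) :
    0 < (rofs s - rm) * (rofs s - rp) :=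
  mul_pos (sub_pos.2 (R.rm_lt_r s)) (sub_pos.2 (R.gt s))

theorem denom_pos (R : IsRadius M E rm rp κ rofs) (s : ℝ) :
    0 < (rofs s - rm) * (rofs s - rp) + (rofs s - M) / κ := by
  have h1 := R.Δ_pos s
  have h2 : 0 < (rofs s - M) / κ := div_pos (by linarith [R.gt s, R.M_lt]) R.κ_pos
  linarith

theorem hasDerivAt (R : IsRadius M E rm rp κ rofs) (s : ℝ) :
    HasDerivAt rofs (speed M rm rp κ (rofs s)) s := by
  have h1 := R.Δ_pos s
  have h2 := R.denom_pos s
  have h3 := R.κ_pos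
  set r := rofs s with hr
  have hd : HasDerivAt (fun r : ℝ => (r - rm) * (r - rp)) (1 * (r - rp) + (r - rm) * 1) r :=
    ((hasDerivAt_id r).sub_const rm).mul ((hasDerivAt_id r).sub_const rp)
  have hf : HasDerivAt (fun r : ℝ => r + (2 * κ)⁻¹ * Real.log ((r - rm) * (r - rp)))
      (1 + (2 * κ)⁻¹ * ((1 * (r - rp) + (r - rm) * 1) / ((r - rm) * (r - rp)))) r :=
    (hasDerivAt_id r).add ((hd.log h1.ne').const_mul _)
  have e : 1 + (2 * κ)⁻¹ * ((1 * (r - rp) + (r - rm) * 1) / ((r - rm) * (r - rp)))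
      = (speed M rm rp κ r)⁻¹ := by
    rw [speed, inv_div, show 1 * (r - rp) + (r - rm) * 1 = 2 * (r - M) by linarith [R.sum]]
    have h5 : κ ≠ 0 := h3.ne'
    rw [add_div, div_self h1.ne']
    congr 1
    generalize (r - rm) * (r - rp) = d
    rw [mul_inv, div_div, div_eq_mul_inv, div_eq_mul_inv, mul_inv]
    ring
  have hne : (speed M rm rp κ r)⁻¹ ≠ 0 := inv_ne_zero (div_pos h1 h2).ne'
  have := HasDerivAt.of_local_left_inverse (R.continuous.continuousAt (x := s))
    (hf.congr_deriv e) hne (Eventually.of_forall fun t => R.eq t)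
  rwa [inv_inv] at this

theorem speed_pos (R : IsRadius M E rm rp κ rofs) (s : ℝ) : 0 < speed M rm rp κ (rofs s) :=
  div_pos (R.Δ_pos s) (R.denom_pos s)

theorem continuous_speed (R : IsRadius M E rm rp κ rofs) :
    Continuous fun s => speed M rm rp κ (rofs s) := by
  have := R.continuous
  unfold speed
  exact Continuous.div (by fun_prop) (by fun_prop) fun s => (R.denom_pos s).ne'

/-- The speed is comparable to the distance to the horizon nearby. -/
theorem speed_ge (R : IsRadius M E rm rp κ rofs) {r : ℝ} (h1 : rp < r) (h2 : r ≤ rp + 1) :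
    (rp - rm) / ((rp + 1 - rm) + (rp + 1 - M) / κ) * (r - rp) ≤ speed M rm rp κ r := by
  have a1 := R.rm_lt
  have a2 := R.κ_pos
  have a3 := R.M_lt
  have a4 : 0 < (r - M) / κ := div_pos (by linarith) a2
  have a5 : (r - M) / κ ≤ (rp + 1 - M) / κ := by gcongr
  have a6 : (r - rm) * (r - rp) ≤ (rp + 1 - rm) * 1 := by
    apply mul_le_mul <;> linarith
  have a7 : 0 < (r - rm) * (r - rp) := mul_pos (by linarith) (by linarith)
  rw [speed, div_mul_eq_mul_div]
  apply div_le_div₀ a7.le _ (by linarith) (by linarith)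
  apply mul_le_mul <;> linarith

theorem tendsto_atBot (R : IsRadius M E rm rp κ rofs) :
    Tendsto (fun s => rofs s - rp) atBot (nhds 0) := by
  rw [Metric.tendsto_nhds]
  intro ε hε
  obtain ⟨s₀, hs₀⟩ := R.exists_eq (r := rp + ε / 2) (by linarith)
  filter_upwards [eventually_le_atBot s₀] with s hs
  rw [Real.dist_eq, sub_zero, abs_of_pos (by linarith [R.gt s])]
  linarith [R.strictMono.monotone hs]

theorem exists_far (R : IsRadius M E rm rp κ rofs) (R₀ : ℝ) :
    ∃ s₀, 1 ≤ s₀ ∧ ∀ s, s₀ ≤ s → R₀ ≤ rofs s ∧ rofs s ≤ s ∧ s ≤ 2 * rofs s := by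
  have h1 : ∀ᶠ r : ℝ in atTop, ‖Real.log r‖ ≤ κ * ‖id r‖ :=
    Real.isLittleO_log_id_atTop.def R.κ_pos
  obtain ⟨R₁, hR₁⟩ := eventually_atTop.1 h1
  obtain ⟨s₁, hs₁⟩ := R.exists_eq (r := max (rp + 1) (max R₀ R₁))
    (lt_of_lt_of_le (by linarith) (le_max_left _ _))
  refine ⟨max 1 s₁, le_max_left _ _, fun s hs => ?_⟩
  have g := R.strictMono.monotone ((le_max_right _ _).trans hs)
  rw [hs₁] at g
  have g1 := (le_max_left _ _).trans g
  have g2 := ((le_max_left _ _).trans (le_max_right _ _)).trans g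
  have g3 := ((le_max_right _ _).trans (le_max_right _ _)).trans g
  have e := R.eq s
  have l := hR₁ _ g3
  have p := R.r_pos s
  have k := R.κ_pos
  have hm := R.rm_lt
  have hm' := R.rm_nonneg
  have hp := R.rp_pos
  simp only [Real.norm_eq_abs, id, abs_of_pos p] at l
  have l1 := (abs_le.1 l).2
  set r := rofs s
  have d1 : 1 ≤ (r - rm) * (r - rp) := one_le_mul_of_one_le_of_one_le (by linarith) (by linarith)
  have d2 : (r - rm) * (r - rp) ≤ r ^ 2 := by
    rw [sq]; apply mul_le_mul <;> linarith
  have e1 : 0 ≤ Real.log ((r - rm) * (r - rp)) := Real.log_nonneg d1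
  have e2 : Real.log ((r - rm) * (r - rp)) ≤ 2 * (κ * r) := by
    refine (Real.log_le_log (by linarith) d2).trans ?_
    rw [Real.log_pow]
    push_cast
    linarith
  have e3 : 0 ≤ (2 * κ)⁻¹ * Real.log ((r - rm) * (r - rp)) := by positivity
  have e4 : (2 * κ)⁻¹ * Real.log ((r - rm) * (r - rp)) ≤ (2 * κ)⁻¹ * (2 * (κ * r)) := by gcongr
  have e5 : (2 * κ)⁻¹ * (2 * (κ * r)) = r := by field_simp
  exact ⟨g2, by linarith, by linarith⟩

end IsRadius

/-- The lapse factor of the Reissner–Nordström metric. -/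
noncomputable def lapse (M E r : ℝ) : ℝ := 1 - 2 * M / r + E ^ 2 / r ^ 2

/-- The second factor of the radial potential, with angular eigenvalue `Λ`. -/
noncomputable def angular (M m E Λ r : ℝ) : ℝ :=
  m ^ 2 + Λ / r ^ 2 + (2 * M * r - 2 * E ^ 2) / r ^ 4

/-- The frequency-independent part of the radial potential as a function of the radius. -/
noncomputable def radialPot (M m E Λ r : ℝ) : ℝ := lapse M E r * angular M m E Λ r

/-- The derivative of `radialPot` in the radius. -/
noncomputable def radialPotDeriv (M m E Λ r : ℝ) : ℝ :=
  (2 * M * r - 2 * E ^ 2) / r ^ 3 * angular M m E Λ r +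
    lapse M E r * (-2 * Λ / r ^ 3 - 6 * M / r ^ 4 + 8 * E ^ 2 / r ^ 5)

theorem hasDerivAt_radialPot {M m E Λ r : ℝ} (hr : 0 < r) :
    HasDerivAt (radialPot M m E Λ) (radialPotDeriv M m E Λ r) r := by
  have h0 : r ≠ 0 := hr.ne'
  have i := hasDerivAt_id r
  have h1 : HasDerivAt (lapse M E) ((2 * M * r - 2 * E ^ 2) / r ^ 3) r := by
    have := (((hasDerivAt_const r (2 * M)).div i h0).const_sub 1).add
      ((hasDerivAt_const r (E ^ 2)).div (i.pow 2) (pow_ne_zero 2 h0))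
    refine this.congr_deriv ?_
    simp only [id, Pi.pow_apply]
    field_simp
    ring
  have h2 : HasDerivAt (angular M m E Λ) (-2 * Λ / r ^ 3 - 6 * M / r ^ 4 + 8 * E ^ 2 / r ^ 5) r := by
    have := (((hasDerivAt_const r Λ).div (i.pow 2) (pow_ne_zero 2 h0)).const_add (m ^ 2)).add
      (((i.const_mul (2 * M)).sub_const (2 * E ^ 2)).div (i.pow 4) (pow_ne_zero 4 h0))
    refine this.congr_deriv ?_
    simp only [id, Pi.pow_apply]
    field_simp
    ring
  exact h1.mul h2

namespace IsRadius
variable {M E rm rp κ m Λ r : ℝ} {rofs : ℝ → ℝ}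

theorem lapse_eq (R : IsRadius M E rm rp κ rofs) (hr : 0 < r) :
    lapse M E r = (r - rm) * (r - rp) / r ^ 2 := by
  rw [lapse, ← R.sum, ← R.prod]
  field_simp
  ring

theorem horizon_gap (R : IsRadius M E rm rp κ rofs) (hr : rp ≤ r) :
    rp * (rp - M) ≤ M * r - E ^ 2 := by
  have h := mul_le_mul_of_nonneg_left hr R.M_pos.le
  have h1 : rm = 2 * M - rp := by linarith [R.sum]
  have h2 := R.prod
  rw [h1] at h2
  linarith [sub_mul (2 * M) rp rp, mul_sub rp rp M, mul_comm M rp, mul_assoc 2 M rp]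

theorem gap_pos (R : IsRadius M E rm rp κ rofs) : 0 < rp * (rp - M) :=
  mul_pos R.rp_pos (sub_pos.2 R.M_lt)

theorem angular_ge (R : IsRadius M E rm rp κ rofs) (hr : rp ≤ r) :
    m ^ 2 + Λ / r ^ 2 ≤ angular M m E Λ r := by
  have h := R.horizon_gap hr
  have h1 := R.gap_pos
  have h2 : 0 ≤ (2 * M * r - 2 * E ^ 2) / r ^ 4 := div_nonneg (by linarith) (by positivity)
  rw [angular]; linarith

theorem angular_le (R : IsRadius M E rm rp κ rofs) (hr : rp ≤ r) (hΛ : 1 ≤ Λ) :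
    angular M m E Λ r ≤ (m ^ 2 + 1 / rp ^ 2 + 2 * M / rp ^ 3) * Λ := by
  have hp := R.rp_pos
  have hr0 := hp.trans_le hr
  have hM := R.M_pos
  have h1 : Λ / r ^ 2 ≤ Λ / rp ^ 2 := by gcongr
  have h2 : (2 * M * r - 2 * E ^ 2) / r ^ 4 ≤ 2 * M / rp ^ 3 := by
    have e1 : (2 * M * r - 2 * E ^ 2) / r ^ 4 ≤ 2 * M * r / r ^ 4 := by
      gcongr; nlinarith [sq_nonneg E]
    have e2 : 2 * M * r / r ^ 4 = 2 * M / r ^ 3 := by field_simp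
    have e3 : 2 * M / r ^ 3 ≤ 2 * M / rp ^ 3 := by gcongr
    linarith
  have h3 : m ^ 2 ≤ m ^ 2 * Λ := le_mul_of_one_le_right (sq_nonneg _) hΛ
  have h4 : 2 * M / rp ^ 3 ≤ 2 * M / rp ^ 3 * Λ := le_mul_of_one_le_right (by positivity) hΛ
  rw [angular]
  have h5 : 1 / rp ^ 2 * Λ = Λ / rp ^ 2 := by ring
  linarith [add_mul (m ^ 2 + 1 / rp ^ 2) (2 * M / rp ^ 3) Λ, add_mul (m ^ 2) (1 / rp ^ 2) Λ]

theorem radialPot_ge (R : IsRadius M E rm rp κ rofs) (hr : rp < r) :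
    (r - rm) * (r - rp) / r ^ 4 * Λ ≤ radialPot M m E Λ r := by
  have hr0 := R.rp_pos.trans hr
  have h1 := R.angular_ge (m := m) (Λ := Λ) hr.le
  have h2 : 0 < (r - rm) * (r - rp) / r ^ 2 :=
    div_pos (mul_pos (by linarith [R.rm_lt]) (by linarith)) (by positivity)
  rw [radialPot, R.lapse_eq hr0]
  calc (r - rm) * (r - rp) / r ^ 4 * Λ = (r - rm) * (r - rp) / r ^ 2 * (Λ / r ^ 2) := by
        field_simp
    _ ≤ _ := mul_le_mul_of_nonneg_left (by nlinarith [sq_nonneg m]) h2.le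

theorem radialPot_le (R : IsRadius M E rm rp κ rofs) (hr : rp < r) (hΛ : 1 ≤ Λ) :
    radialPot M m E Λ r ≤ (m ^ 2 + 1 / rp ^ 2 + 2 * M / rp ^ 3) / rp * Λ * (r - rp) := by
  have hp := R.rp_pos
  have hr0 := hp.trans hr
  have h1 := R.angular_le (m := m) hr.le hΛ
  have hM := R.M_pos
  have hx : 0 < r - rp := by linarith
  have h2 : (r - rm) * (r - rp) / r ^ 2 ≤ (r - rp) / rp := by
    rw [div_le_div_iff₀ (by positivity) hp]
    have : (r - rm) * rp ≤ r * r := mul_le_mul (by linarith [R.rm_nonneg]) hr.le hp.le hr0.le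
    nlinarith
  have h3 : 0 ≤ angular M m E Λ r :=
    le_trans (by positivity) (R.angular_ge (m := m) (Λ := Λ) hr.le)
  rw [radialPot, R.lapse_eq hr0]
  calc _ ≤ (r - rp) / rp * ((m ^ 2 + 1 / rp ^ 2 + 2 * M / rp ^ 3) * Λ) :=
        mul_le_mul h2 h1 h3 (by positivity)
    _ = _ := by ring

/-- Close to the horizon the logarithmic derivative of the potential is at least of order
`(r - rp)⁻¹`. -/
theorem radialPotDeriv_ge (R : IsRadius M E rm rp κ rofs) (hr : rp < r) (hr1 : r ≤ rp + 1)
    (hr2 : 4 * (rp + 1) * (r - rp) ≤ rp * (rp - M)) (hΛ : 1 ≤ Λ) :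
    rp * (rp - M) / (rp + 1) ^ 2 * radialPot M m E Λ r ≤
      radialPotDeriv M m E Λ r * (r - rp) := by
  have hp := R.rp_pos
  have hr0 := hp.trans hr
  have hM := R.M_pos
  have hx : 0 < r - rp := by linarith
  have gap := R.horizon_gap hr.le
  have gp := R.gap_pos
  have hrm := R.rm_nonneg
  have hrm' := R.rm_lt
  set Q := angular M m E Λ r with hQ
  have hQ0 : 0 ≤ Q := le_trans (by positivity) (R.angular_ge (m := m) (Λ := Λ) hr.le)
  have e1 : -(4 / r) * Q ≤ -2 * Λ / r ^ 3 - 6 * M / r ^ 4 + 8 * E ^ 2 / r ^ 5 := by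
    have : -2 * Λ / r ^ 3 - 6 * M / r ^ 4 + 8 * E ^ 2 / r ^ 5 - -(4 / r) * Q
        = 4 * m ^ 2 / r + 2 * Λ / r ^ 3 + 2 * M / r ^ 4 := by
      rw [hQ, angular]; field_simp; ring
    have h' : 0 ≤ 4 * m ^ 2 / r + 2 * Λ / r ^ 3 + 2 * M / r ^ 4 := by positivity
    linarith
  have l0 : 0 ≤ (r - rm) * (r - rp) / r ^ 2 := by
    have : 0 < r - rm := by linarith
    positivity
  have e2 : (M * r - E ^ 2) / r ^ 3 * Q ≤ radialPotDeriv M m E Λ r := by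
    rw [radialPotDeriv, R.lapse_eq hr0, ← hQ]
    have a1 := mul_le_mul_of_nonneg_left e1 l0
    have a2 : (r - rm) * (r - rp) / r ^ 2 * (4 / r) ≤ (M * r - E ^ 2) / r ^ 3 := by
      rw [div_mul_div_comm, show r ^ 2 * r = r ^ 3 by ring]
      gcongr
      nlinarith
    have a3 := mul_le_mul_of_nonneg_right a2 hQ0
    have a4 : (2 * M * r - 2 * E ^ 2) / r ^ 3 = 2 * ((M * r - E ^ 2) / r ^ 3) := by ring
    rw [a4]
    nlinarith
  calc _ = rp * (rp - M) / (rp + 1) ^ 2 * ((r - rm) * (r - rp) / r ^ 2) * Q := by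
        rw [radialPot, R.lapse_eq hr0, ← hQ]; ring
    _ ≤ ((M * r - E ^ 2) / r ^ 2) * ((r - rp) / r) * Q := by
        refine mul_le_mul_of_nonneg_right ?_ hQ0
        refine mul_le_mul ?_ ?_ l0 (div_nonneg (by linarith) (by positivity))
        · gcongr
          linarith
        · rw [div_le_div_iff₀ (by positivity) hr0]
          nlinarith [mul_pos hx hr0, mul_nonneg hrm (mul_pos hx hr0).le]
    _ = (M * r - E ^ 2) / r ^ 3 * Q * (r - rp) := by field_simp
    _ ≤ _ := mul_le_mul_of_nonneg_right e2 hx.le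

end IsRadius

namespace IsRadius
variable {M E rm rp κ : ℝ} {rofs : ℝ → ℝ}

theorem exists_nearData (R : IsRadius M E rm rp κ rofs) {m b : ℝ} (hm : 0 < m) (hb : 1 ≤ b) :
    ∃ s₁ ≤ 0, ∃ c C k Λ₀ : ℝ, 0 < c ∧ 1 ≤ C ∧ 0 < k ∧ ∀ Λ ω : ℝ, Λ₀ ≤ Λ → m / 2 ≤ ω → ω ≤ m →
      ∃ σ ≤ s₁, NearData m c C k Λ ω σ s₁ b (fun s => radialPot M m E Λ (rofs s))
        (fun s => radialPotDeriv M m E Λ (rofs s) * speed M rm rp κ (rofs s))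
        (fun s => rofs s - rp) (fun s => speed M rm rp κ (rofs s))
        (fun s => rofs s / (rofs s - rp)) := by
  have hp := R.rp_pos
  have hM := R.M_pos
  have hML := R.M_lt
  have hκ := R.κ_pos
  have gp := R.gap_pos
  have hd := R.rm_lt
  obtain ⟨s', hs'⟩ := R.exists_eq (r := rp + min 1 (rp * (rp - M) / (4 * (rp + 1))))
    (by linarith [lt_min one_pos (div_pos gp (show 0 < 4 * (rp + 1) by linarith))])
  set s₁ := min s' 0 with hs₁
  have hs₁0 : s₁ ≤ 0 := min_le_right _ _
  have near : ∀ s, s ≤ s₁ → rofs s ≤ rp + 1 ∧ 4 * (rp + 1) * (rofs s - rp) ≤ rp * (rp - M) := by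
    intro s hs
    have h := R.strictMono.monotone (hs.trans (min_le_left _ _))
    rw [hs'] at h
    have h1 := min_le_left 1 (rp * (rp - M) / (4 * (rp + 1)))
    have h2 := min_le_right 1 (rp * (rp - M) / (4 * (rp + 1)))
    refine ⟨by linarith, ?_⟩
    have h3 : rofs s - rp ≤ rp * (rp - M) / (4 * (rp + 1)) := by linarith
    rw [le_div_iff₀ (by linarith)] at h3
    linarith
  set c₁ := (rp - rm) / ((rp + 1 - rm) + (rp + 1 - M) / κ) with hc₁
  have hc₁0 : 0 < c₁ := by
    have : 0 < (rp + 1 - M) / κ := div_pos (by linarith) hκ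
    exact div_pos (by linarith) (by linarith)
  set c₂ := (rp - rm) / (rp + 1) ^ 4 with hc₂
  have hc₂0 : 0 < c₂ := div_pos (by linarith) (by positivity)
  set c₃ := rp * (rp - M) / (rp + 1) ^ 2 * c₁ with hc₃
  have hc₃0 : 0 < c₃ := mul_pos (div_pos gp (by positivity)) hc₁0
  set c := min c₁ (min c₂ c₃) with hc
  have hc0 : 0 < c := lt_min hc₁0 (lt_min hc₂0 hc₃0)
  have cc₁ : c ≤ c₁ := min_le_left _ _
  have cc₂ : c ≤ c₂ := (min_le_right _ _).trans (min_le_left _ _)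
  have cc₃ : c ≤ c₃ := (min_le_right _ _).trans (min_le_right _ _)
  have x0 : ∀ s, 0 < rofs s - rp := fun s => sub_pos.2 (R.gt s)
  set C₁ := (m ^ 2 + 1 / rp ^ 2 + 2 * M / rp ^ 3) / rp with hC₁
  have hC₁0 : 0 ≤ C₁ := by positivity
  set C₂ := rofs b / (rofs s₁ - rp) with hC₂
  have hC₂0 : 0 ≤ C₂ := div_nonneg (R.r_pos b).le (x0 s₁).le
  set C := 1 + C₁ + C₂ + 1 / rp + rp with hC
  have hrp' : 0 < 1 / rp := by positivity
  have hC1 : 1 ≤ C := by linarith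
  set k := 2 * m ^ 2 / c with hk
  have hk0 : 0 < k := by positivity
  set a := (rp - rm) * (rofs s₁ - rp) / rofs b ^ 4 with ha
  have ha0 : 0 < a := div_pos (mul_pos (by linarith) (x0 s₁)) (by have := R.r_pos b; positivity)
  refine ⟨s₁, hs₁0, c, C, k, max 1 (max (k / (rofs s₁ - rp)) (2 * m ^ 2 / a)), hc0, hC1, hk0,
    fun Λ ω hΛ hω1 hω2 => ?_⟩
  have hΛ1 : 1 ≤ Λ := (le_max_left _ _).trans hΛ
  have hΛ0 : 0 < Λ := by linarith
  have hΛ2 : k / (rofs s₁ - rp) ≤ Λ := ((le_max_left _ _).trans (le_max_right _ _)).trans hΛ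
  have hΛ3 : 2 * m ^ 2 / a ≤ Λ := ((le_max_right _ _).trans (le_max_right _ _)).trans hΛ
  obtain ⟨σ, hσ⟩ := R.exists_eq (r := rp + k / Λ) (by linarith [div_pos hk0 hΛ0])
  have hσ1 : σ ≤ s₁ := by
    refine R.strictMono.le_iff_le.1 ?_
    rw [hσ]
    rw [div_le_iff₀ (x0 s₁)] at hΛ2
    have : k / Λ ≤ rofs s₁ - rp := by rw [div_le_iff₀ hΛ0]; linarith
    linarith
  have hxσ : Λ * (rofs σ - rp) = k := by rw [hσ]; field_simp; ring
  have Fge : ∀ s, s ≤ s₁ → c * Λ * (rofs s - rp) ≤ radialPot M m E Λ (rofs s) := by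
    intro s hs
    refine le_trans ?_ (R.radialPot_ge (R.gt s))
    have h1 := near s hs
    have h0 := R.r_pos s
    have h2 : c₂ ≤ (rofs s - rm) / rofs s ^ 4 := by
      apply div_le_div₀ (by linarith [R.gt s]) (by linarith [R.gt s]) (by positivity)
      exact pow_le_pow_left₀ h0.le h1.1 4
    have h3 : c * (Λ * (rofs s - rp)) ≤ (rofs s - rm) / rofs s ^ 4 * (Λ * (rofs s - rp)) :=
      mul_le_mul_of_nonneg_right (cc₂.trans h2) (mul_nonneg hΛ0.le (x0 s).le)
    calc _ = c * (Λ * (rofs s - rp)) := by ring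
      _ ≤ _ := h3
      _ = _ := by ring
  refine ⟨σ, hσ1, ?_⟩
  have cr := R.continuous
  exact
  { m_pos := hm
    c_pos := hc0
    one_le_C := hC1
    one_le_Λ := hΛ1
    k_pos := hk0
    half_le := hω1
    le_m := hω2
    hσ := hσ1
    hs₁ := by linarith
    dF := fun s => (hasDerivAt_radialPot (R.r_pos s)).comp s (R.hasDerivAt s)
    dx := fun s => (R.hasDerivAt s).sub_const rp
    cx' := R.continuous_speed
    cw := cr.div (by fun_prop) fun s => (x0 s).ne'
    x_pos := x0
    x'_ge := fun s hs => (mul_le_mul_of_nonneg_right cc₁ (x0 s).le).trans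
      (R.speed_ge (R.gt s) (near s hs).1)
    F_ge := Fge
    F_le := fun s _ => by
      refine (R.radialPot_le (R.gt s) hΛ1).trans ?_
      have : C₁ ≤ C := by linarith
      have := x0 s
      gcongr
    F'_ge := fun s hs => by
      have h1 := R.radialPotDeriv_ge (m := m) (R.gt s) (near s hs).1 (near s hs).2 hΛ1
      have hF : 0 ≤ radialPot M m E Λ (rofs s) :=
        le_trans (mul_nonneg (mul_nonneg hc0.le hΛ0.le) (x0 s).le) (Fge s hs)
      have h2 : 0 ≤ radialPotDeriv M m E Λ (rofs s) := by
        by_contra h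
        have h3 : 0 ≤ rp * (rp - M) / (rp + 1) ^ 2 * radialPot M m E Λ (rofs s) :=
          mul_nonneg (div_nonneg gp.le (by positivity)) hF
        nlinarith [mul_pos (neg_pos.2 (not_le.1 h)) (x0 s)]
      calc c * radialPot M m E Λ (rofs s) ≤ c₃ * radialPot M m E Λ (rofs s) :=
            mul_le_mul_of_nonneg_right cc₃ hF
        _ = c₁ * (rp * (rp - M) / (rp + 1) ^ 2 * radialPot M m E Λ (rofs s)) := by
            rw [hc₃]; ring
        _ ≤ c₁ * (radialPotDeriv M m E Λ (rofs s) * (rofs s - rp)) :=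
            mul_le_mul_of_nonneg_left h1 hc₁0.le
        _ = radialPotDeriv M m E Λ (rofs s) * (c₁ * (rofs s - rp)) := by ring
        _ ≤ _ := mul_le_mul_of_nonneg_left (R.speed_ge (R.gt s) (near s hs).1) h2
    w_ge := fun s _ => by
      rw [mul_assoc, div_mul_cancel₀ _ (x0 s).ne']
      have h1 : 1 / rp * rofs s ≤ C * rofs s :=
        mul_le_mul_of_nonneg_right (by linarith) (R.r_pos s).le
      have h2 : 1 ≤ 1 / rp * rofs s := by
        rw [div_mul_eq_mul_div, one_mul, one_le_div hp]; exact (R.gt s).le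
      linarith
    w_le := fun s hs => by
      rw [div_mul_cancel₀ _ (x0 s).ne']
      linarith [(near s hs).1]
    one_le_w := fun s => by rw [one_le_div (x0 s)]; linarith
    w_le' := fun s hs => by
      have : rofs s / (rofs s - rp) ≤ C₂ := by
        apply div_le_div₀ (R.r_pos b).le (R.strictMono.monotone hs.2) (x0 s₁)
        linarith [R.strictMono.monotone hs.1]
      linarith
    xσ := hxσ.le
    barrier := fun s hs => by
      rcases le_total s s₁ with h | h
      · refine le_trans ?_ (Fge s h)
        have h1 : rofs σ - rp ≤ rofs s - rp := by linarith [R.strictMono.monotone hs.1]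
        calc 2 * m ^ 2 = c * (Λ * (rofs σ - rp)) := by rw [hxσ, hk]; field_simp
          _ ≤ c * (Λ * (rofs s - rp)) := by gcongr
          _ = _ := by ring
      · refine le_trans ?_ (R.radialPot_ge (R.gt s))
        have h1 : a ≤ (rofs s - rm) * (rofs s - rp) / rofs s ^ 4 := by
          have h2 := R.strictMono.monotone h
          have h3 := R.strictMono.monotone hs.2
          have h4 := R.r_pos s
          apply div_le_div₀ (R.Δ_pos s).le _ (by positivity) (by gcongr)
          apply mul_le_mul _ (by linarith) (x0 s₁).le (by linarith [R.gt s])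
          linarith [R.gt s]
        calc 2 * m ^ 2 = a * (2 * m ^ 2 / a) := by field_simp
          _ ≤ _ := mul_le_mul h1 hΛ3 (by positivity) (ha0.le.trans h1)
    lim := R.tendsto_atBot }

end IsRadius

/-- The polynomially decaying weight near the horizon. -/
noncomputable def decayWeight (δ s : ℝ) : ℝ := ((max 0 (-s)) ^ (1 + δ) + 1)⁻¹

theorem decayWeight_pos {δ : ℝ} (s : ℝ) : 0 < decayWeight δ s := by
  have : 0 ≤ (max 0 (-s)) ^ (1 + δ) := Real.rpow_nonneg (le_max_left _ _) _
  unfold decayWeight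
  positivity

theorem decayWeight_le_one {δ : ℝ} (s : ℝ) : decayWeight δ s ≤ 1 := by
  have : 0 ≤ (max 0 (-s)) ^ (1 + δ) := Real.rpow_nonneg (le_max_left _ _) _
  exact inv_le_one_of_one_le₀ (by linarith)

theorem continuous_decayWeight {δ : ℝ} (hδ : 0 < δ) : Continuous (decayWeight δ) := by
  have h : Continuous fun s : ℝ => (max 0 (-s)) ^ (1 + δ) :=
    Continuous.rpow_const (by fun_prop) fun s => Or.inr (by linarith)
  refine Continuous.inv₀ (h.add continuous_const) fun s => ?_
  have : 0 ≤ (max 0 (-s)) ^ (1 + δ) := Real.rpow_nonneg (le_max_left _ _) _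
  positivity

theorem decayWeight_le {δ : ℝ} (hδ : 0 < δ) (hδ1 : δ < 1) {s : ℝ} (hs : s ≤ 0) :
    decayWeight δ s ≤ 4 * (1 - s) ^ (-δ - 1) := by
  have h1 : 0 < 1 - s := by linarith
  have e : (1 - s) ^ (-δ - 1) = ((1 - s) ^ (1 + δ))⁻¹ := by
    rw [← Real.rpow_neg h1.le]; congr 1; ring
  rw [e, decayWeight, max_eq_right (by linarith)]
  have h2 : 0 < (1 - s) ^ (1 + δ) := Real.rpow_pos_of_pos h1 _
  have h3 : 0 ≤ (-s) ^ (1 + δ) := Real.rpow_nonneg (by linarith) _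
  have h4 : (1 - s) ^ (1 + δ) ≤ 4 * ((-s) ^ (1 + δ) + 1) := by
    have a : (2 : ℝ) ^ (1 + δ) ≤ 4 := by
      have := Real.rpow_le_rpow_of_exponent_le (one_le_two (α := ℝ)) (show 1 + δ ≤ 2 by linarith)
      norm_num at this
      linarith
    rcases le_total (-s) 1 with h | h
    · have : (1 - s) ^ (1 + δ) ≤ 2 ^ (1 + δ) :=
        Real.rpow_le_rpow h1.le (by linarith) (by linarith)
      linarith
    · have b : (1 - s) ^ (1 + δ) ≤ (2 * (-s)) ^ (1 + δ) :=
        Real.rpow_le_rpow h1.le (by linarith) (by linarith)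
      rw [Real.mul_rpow (by norm_num) (by linarith)] at b
      nlinarith
  rw [inv_eq_one_div, ← div_eq_mul_inv, div_le_div_iff₀ (by linarith) h2]
  linarith

theorem integral_decayWeight_le {δ : ℝ} (hδ : 0 < δ) (hδ1 : δ < 1) {a σ : ℝ} (hσ : σ ≤ 0)
    (ha : a ≤ σ) : ∫ s in a..σ, decayWeight δ s ≤ 4 / δ := by
  have key := sub_le_integral_of_deriv_le (f := fun s => -(4 / δ * (1 - s) ^ (-δ)))
    (f' := fun s => -(4 / δ * ((-1) * (-δ) * (1 - s) ^ (-δ - 1)))) (g := fun s => -decayWeight δ s)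
    ha (fun s hs => by
      have h0 : (1 : ℝ) - s ≠ 0 := by linarith [hs.2]
      exact ((((hasDerivAt_id s).const_sub 1).rpow_const (Or.inl h0)).const_mul _).neg)
    (continuous_decayWeight hδ).neg.continuousOn (fun s hs => by
      have h := decayWeight_le hδ hδ1 (hs.2.trans hσ)
      have e : 4 / δ * ((-1) * (-δ) * (1 - s) ^ (-δ - 1)) = 4 * (1 - s) ^ (-δ - 1) := by field_simp
      rw [e]
      linarith)
  rw [intervalIntegral.integral_neg] at key
  have h1 : (1 - σ) ^ (-δ) ≤ 1 := by
    rw [Real.rpow_neg (by linarith)]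
    exact inv_le_one_of_one_le₀ (Real.one_le_rpow (by linarith) hδ.le)
  have h2 : 0 ≤ (1 - a) ^ (-δ) := Real.rpow_nonneg (by linarith) _
  have h3 : 0 < 4 / δ := by positivity
  nlinarith [mul_le_mul_of_nonneg_left h1 h3.le, mul_nonneg h3.le h2]

namespace IsRadius
variable {M E rm rp κ m Λ r : ℝ} {rofs : ℝ → ℝ}

theorem sq_le (R : IsRadius M E rm rp κ rofs) : E ^ 2 ≤ M ^ 2 := by
  have h1 := R.sum
  have h2 := R.prod
  have h3 : M = (rm + rp) / 2 := by linarith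
  rw [h3, ← h2]
  nlinarith [sq_nonneg (rp - rm)]

theorem lapse_le_one (R : IsRadius M E rm rp κ rofs) (hr : rp ≤ r) : lapse M E r ≤ 1 := by
  have hr0 := R.rp_pos.trans_le hr
  have h := R.horizon_gap hr
  have h2 := R.gap_pos
  have : E ^ 2 / r ^ 2 ≤ 2 * M / r := by
    rw [div_le_div_iff₀ (by positivity) hr0]
    nlinarith [sq_nonneg E, mul_pos R.M_pos hr0]
  rw [lapse]; linarith

theorem lapse_nonneg (R : IsRadius M E rm rp κ rofs) (hr : rp ≤ r) : 0 ≤ lapse M E r := by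
  have hr0 := R.rp_pos.trans_le hr
  rw [R.lapse_eq hr0]
  exact div_nonneg (mul_nonneg (by linarith [R.rm_lt]) (by linarith)) (by positivity)

theorem angular_nonneg (R : IsRadius M E rm rp κ rofs) (hr : rp ≤ r) (hΛ : 0 ≤ Λ) :
    0 ≤ angular M m E Λ r := by
  have hr0 := R.rp_pos.trans_le hr
  exact le_trans (by positivity) (R.angular_ge (m := m) (Λ := Λ) hr)

theorem radialPot_nonneg (R : IsRadius M E rm rp κ rofs) (hr : rp ≤ r) (hΛ : 0 ≤ Λ) :
    0 ≤ radialPot M m E Λ r :=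
  mul_nonneg (R.lapse_nonneg hr) (R.angular_nonneg hr hΛ)

theorem radialPot_le_mul (R : IsRadius M E rm rp κ rofs) (hr : rp ≤ r) (hΛ : 1 ≤ Λ) :
    radialPot M m E Λ r ≤ (m ^ 2 + 1 / rp ^ 2 + 2 * M / rp ^ 3) * Λ :=
  (mul_le_of_le_one_left (R.angular_nonneg hr (by linarith)) (R.lapse_le_one hr)).trans
    (R.angular_le hr hΛ)

theorem radialPot_far_ge (R : IsRadius M E rm rp κ rofs) (hr : rp ≤ r) (hr8 : 8 * M ≤ r)
    (hΛ : 0 ≤ Λ) : 3 / 4 * Λ / r ^ 2 - 2 * M * m ^ 2 / r ≤ radialPot M m E Λ r - m ^ 2 := by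
  have hr0 := R.rp_pos.trans_le hr
  have h1 := R.angular_ge (m := m) (Λ := Λ) hr
  have e1 : 2 * M / r ≤ 1 / 4 := by rw [div_le_div_iff₀ hr0 (by norm_num)]; linarith
  have e2 : 0 ≤ E ^ 2 / r ^ 2 := by positivity
  have l1 : 1 - 2 * M / r ≤ lapse M E r := by rw [lapse]; linarith
  have h2 : lapse M E r * (m ^ 2 + Λ / r ^ 2) ≤ radialPot M m E Λ r :=
    mul_le_mul_of_nonneg_left h1 (R.lapse_nonneg hr)
  have h3 : (1 - 2 * M / r) * m ^ 2 ≤ lapse M E r * m ^ 2 :=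
    mul_le_mul_of_nonneg_right l1 (sq_nonneg _)
  have h4 : 3 / 4 * (Λ / r ^ 2) ≤ lapse M E r * (Λ / r ^ 2) :=
    mul_le_mul_of_nonneg_right (by linarith) (by positivity)
  have e3 : 3 / 4 * Λ / r ^ 2 = 3 / 4 * (Λ / r ^ 2) := by ring
  have e4 : 2 * M * m ^ 2 / r = 2 * M / r * m ^ 2 := by ring
  rw [e3, e4]
  nlinarith

theorem radialPot_far_le (R : IsRadius M E rm rp κ rofs) (hr : rp ≤ r) (hr8 : 8 * M ≤ r)
    (hΛ : 1 ≤ Λ) : radialPot M m E Λ r - m ^ 2 ≤ 2 * Λ / r ^ 2 := by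
  have hr0 := R.rp_pos.trans_le hr
  have h0 : (2 * M * r - 2 * E ^ 2) / r ^ 4 ≤ Λ / r ^ 2 := by
    rw [div_le_div_iff₀ (by positivity) (by positivity)]
    have : 2 * M * r - 2 * E ^ 2 ≤ Λ * r ^ 2 := by nlinarith [sq_nonneg E, sq_nonneg r]
    nlinarith [mul_le_mul_of_nonneg_right this (sq_nonneg r)]
  have h1 : radialPot M m E Λ r ≤ angular M m E Λ r :=
    mul_le_of_le_one_left (R.angular_nonneg hr (by linarith)) (R.lapse_le_one hr)
  rw [angular] at h1
  have e : 2 * Λ / r ^ 2 = Λ / r ^ 2 + Λ / r ^ 2 := by ring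
  linarith

theorem radialPotDeriv_far_nonneg (R : IsRadius M E rm rp κ rofs) (hr : rp ≤ r) (hr8 : 8 * M ≤ r)
    (hΛ : 0 ≤ Λ) (h1 : 4 * Λ ≤ M * m ^ 2 * r) (h2 : 12 ≤ m ^ 2 * r ^ 2) :
    0 ≤ radialPotDeriv M m E Λ r := by
  have hr0 := R.rp_pos.trans_le hr
  have hM := R.M_pos
  have hE := R.sq_le
  have l0 := R.lapse_nonneg hr
  have l1 := R.lapse_le_one hr
  have a1 : m ^ 2 ≤ angular M m E Λ r :=
    le_trans (by linarith [show 0 ≤ Λ / r ^ 2 by positivity]) (R.angular_ge (Λ := Λ) hr)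
  have g0 : M * r ≤ 2 * M * r - 2 * E ^ 2 := by nlinarith
  have b1 : M * r / r ^ 3 * m ^ 2 ≤ (2 * M * r - 2 * E ^ 2) / r ^ 3 * angular M m E Λ r := by
    apply mul_le_mul _ a1 (sq_nonneg _) (div_nonneg (by nlinarith) (by positivity))
    gcongr
  have b2 : -(2 * Λ / r ^ 3 + 6 * M / r ^ 4) ≤
      lapse M E r * (-2 * Λ / r ^ 3 - 6 * M / r ^ 4 + 8 * E ^ 2 / r ^ 5) := by
    have p0 : 0 ≤ 2 * Λ / r ^ 3 + 6 * M / r ^ 4 := by positivity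
    have p1 : 0 ≤ 8 * E ^ 2 / r ^ 5 := by positivity
    have e : -2 * Λ / r ^ 3 = -(2 * Λ / r ^ 3) := by ring
    rw [e]
    nlinarith [mul_nonneg l0 p1, mul_le_mul_of_nonneg_right l1 p0]
  have b3 : 2 * Λ / r ^ 3 + 6 * M / r ^ 4 ≤ M * r / r ^ 3 * m ^ 2 := by
    have e : M * r / r ^ 3 * m ^ 2 - (2 * Λ / r ^ 3 + 6 * M / r ^ 4)
        = (M * m ^ 2 * r * r - 2 * Λ * r - 6 * M) / r ^ 4 := by
      field_simp
      ring
    have : 0 ≤ (M * m ^ 2 * r * r - 2 * Λ * r - 6 * M) / r ^ 4 := by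
      refine div_nonneg ?_ (by positivity)
      nlinarith [mul_le_mul_of_nonneg_right h1 hr0.le, mul_le_mul_of_nonneg_left h2 hM.le]
    linarith
  rw [radialPotDeriv]
  linarith

end IsRadius

theorem exists_level {V : ℝ → ℝ} {X Ym e : ℝ} (hV : Continuous V) (hX : X ≤ Ym)
    (hmono : ∀ s t, X ≤ s → s ≤ t → V s ≤ V t) (hYm : e ≤ V Ym) :
    ∃ Y ∈ Icc X Ym, (∀ s, Y ≤ s → e ≤ V s) ∧ (Y = X ∨ ∀ s ∈ Icc X Y, V s ≤ e) := by
  rcases le_total e (V X) with h | h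
  · exact ⟨X, ⟨le_rfl, hX⟩, fun s hs => h.trans (hmono _ _ le_rfl hs), Or.inl rfl⟩
  · obtain ⟨Y, hY, hVY⟩ := intermediate_value_Icc hX hV.continuousOn ⟨h, hYm⟩
    exact ⟨Y, hY, fun s hs => hVY ▸ hmono _ _ hY.1 hs,
      Or.inr fun s hs => hVY ▸ hmono _ _ hs.1 hs.2⟩

theorem transfer_level {V V' y z F : ℝ → ℝ} {X Y Ym e h η : ℝ} (hXY : X ≤ Y) (hX : 0 ≤ X)
    (hYm : Y ≤ Ym) (h2 : 2 ≤ Ym) (he : 4 * e * Ym ^ 2 ≤ 1)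
    (hV : ∀ s, X ≤ s → HasDerivAt V (V' s) s) (hV' : ∀ s, X ≤ s → 0 ≤ V' s)
    (hVl : ∀ s, X ≤ s → |V s| ≤ 1 / 4) (hlev : Y = X ∨ ∀ s ∈ Icc X Y, V s ≤ e) (hh : |h| ≤ e)
    (hy : ∀ s ∈ Icc X Y, HasDerivAt y (z s) s)
    (hz : ∀ s ∈ Icc X Y, HasDerivAt z ((V s - h) * y s + F s) s)
    (hF : ∀ s ∈ Icc X Y, |F s| ≤ η) :
    ∀ s ∈ Icc X Y, y s ^ 2 + z s ^ 2 ≤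
      4 * Real.exp 3 * Ym ^ 4 * (y Y ^ 2 + z Y ^ 2 + η ^ 2) := by
  intro s hs
  have hY0 : 0 < Ym := by linarith
  have he1 : Real.exp 3 ≥ 1 := Real.one_le_exp (by norm_num)
  have hYm4 : 1 ≤ Ym ^ 4 := one_le_pow₀ (by linarith)
  rcases hlev with rfl | hlev
  · obtain rfl : s = Y := le_antisymm hs.2 hs.1
    have : 1 ≤ 4 * Real.exp 3 * Ym ^ 4 := by nlinarith
    nlinarith [sq_nonneg (y s), sq_nonneg (z s), sq_nonneg η]
  · have sub : ∀ {t}, t ∈ Icc s Y → t ∈ Icc X Y := fun ht => ⟨hs.1.trans ht.1, ht.2⟩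
    have he4 : e ≤ 1 / 4 := by nlinarith [(abs_nonneg h).trans hh]
    have key := transfer_monotone (q := fun t => V t - h) (q' := V') (k := 1 / Ym) hs.2
      (by positivity) (by
        rw [div_pow, one_pow, div_le_div_iff₀ (by positivity) (by norm_num)]
        nlinarith) (fun t ht => hy t (sub ht)) (fun t ht => hz t (sub ht))
      (fun t ht => (hV t (sub ht).1).sub_const h) (fun t ht => hV' t (sub ht).1)
      (fun t ht => by
        have h1 := hlev t (sub ht)
        have h3 := (abs_le.1 hh).1
        have : 2 * e ≤ (1 / Ym) ^ 2 / 2 := by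
          rw [div_pow, one_pow, div_div, le_div_iff₀ (by positivity)]
          linarith
        linarith)
      (fun t ht => by
        have h1 := (abs_le.1 (hVl t (sub ht).1)).1
        have h3 := (abs_le.1 hh).2
        linarith) (fun t ht => hF t (sub ht))
    refine key.trans ?_
    have a1 : 3 * (1 / Ym) * (Y - s) ≤ 3 := by
      have : Y - s ≤ Ym := by linarith [hs.1]
      rw [mul_one_div, div_mul_eq_mul_div, div_le_iff₀ hY0]
      linarith
    have a2 : Real.exp (3 * (1 / Ym) * (Y - s)) ≤ Real.exp 3 := Real.exp_le_exp.2 a1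
    have e1 : 2 * z Y ^ 2 / (1 / Ym) ^ 2 = 2 * (z Y ^ 2 * Ym ^ 2) := by field_simp
    have e2 : 2 * η ^ 2 / (1 / Ym) ^ 3 * (Y - s) = 2 * (η ^ 2 * (Ym ^ 3 * (Y - s))) := by
      field_simp
    rw [e1, e2]
    have a3 : Ym ^ 3 * (Y - s) ≤ Ym ^ 4 := by
      have : Y - s ≤ Ym := by linarith [hs.1]
      calc Ym ^ 3 * (Y - s) ≤ Ym ^ 3 * Ym := by gcongr
        _ = _ := by ring
    have a4 : Ym ^ 2 ≤ Ym ^ 4 := pow_le_pow_right₀ (by linarith) (by norm_num)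
    have a5 : y Y ^ 2 + 2 * (z Y ^ 2 * Ym ^ 2) + 2 * (η ^ 2 * (Ym ^ 3 * (Y - s))) ≤
        2 * Ym ^ 4 * (y Y ^ 2 + z Y ^ 2 + η ^ 2) := by
      nlinarith [mul_le_mul_of_nonneg_left a3 (sq_nonneg η),
        mul_le_mul_of_nonneg_left a4 (sq_nonneg (z Y)),
        mul_le_mul_of_nonneg_left hYm4 (sq_nonneg (y Y))]
    calc _ ≤ 2 * Real.exp 3 * (2 * Ym ^ 4 * (y Y ^ 2 + z Y ^ 2 + η ^ 2)) := by
          refine mul_le_mul (by linarith) a5 ?_ (by positivity)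
          have : 0 ≤ Y - s := by linarith [hs.2]
          positivity
      _ = _ := by ring

/-- Far-region data from pointwise bounds on a potential which is eventually increasing. -/
theorem FarData.exists_of_bounds {V V' : ℝ → ℝ} {X X₂ Ym e c k T : ℝ} (hc : Continuous V)
    (hbdd : ∃ K, ∀ s, |V s| ≤ K) (hX0 : 0 ≤ X) (hX : X ≤ X₂) (hX₂ : X₂ ≤ Ym) (hYm : 2 ≤ Ym)
    (he0 : 0 < e) (he : 4 * e * Ym ^ 2 ≤ 1) (hV : ∀ s, X₂ ≤ s → HasDerivAt V (V' s) s)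
    (hV' : ∀ s, X₂ ≤ s → 0 ≤ V' s) (hVl : ∀ s, X₂ ≤ s → |V s| ≤ 1 / 4) (hk : 0 < k) (hk1 : k ≤ 1)
    (hVk : ∀ s ∈ Icc X X₂, |V s| + e ≤ k ^ 2) (hc0 : 0 < c) (hVc : ∀ s, Ym ≤ s → c + e ≤ V s)
    (hT : (k ^ 2)⁻¹ * Real.exp (3 * k * X₂) * (4 * Real.exp 3 * Ym ^ 4 + X₂ / k) ≤ T) :
    ∃ Y ∈ Icc X₂ Ym, FarData V X Y Ym e c (Ym + 2 / c) T := by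
  have hX₂0 : 0 ≤ X₂ := hX0.trans hX
  have mono : ∀ s t, X₂ ≤ s → s ≤ t → V s ≤ V t := fun s t hs hst =>
    le_of_deriv_nonneg hst (fun x hx => hV x (hs.trans hx.1)) fun x hx => hV' x (hs.trans hx.1)
  obtain ⟨Y, hY, hYe, hlev⟩ := exists_level (e := e) hc hX₂ mono (by linarith [hVc Ym le_rfl])
  have he4 : e ≤ 1 / 4 := by nlinarith
  have hE1 : 1 ≤ Real.exp (3 * k * X₂) := Real.one_le_exp (by positivity)
  have hE3 : 1 ≤ Real.exp 3 := Real.one_le_exp (by norm_num)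
  have hk2 : 1 ≤ (k ^ 2)⁻¹ := by
    rw [one_le_inv₀ (by positivity)]; exact pow_le_one₀ hk.le hk1
  have hYm4 : 1 ≤ Ym ^ 4 := one_le_pow₀ (by linarith)
  set T₁ := 4 * Real.exp 3 * Ym ^ 4 with hT₁
  have hT₁1 : 1 ≤ T₁ := by nlinarith
  have hQ : 0 ≤ X₂ / k := by positivity
  set Z := (k ^ 2)⁻¹ * Real.exp (3 * k * X₂) with hZ
  have hZ1 : 1 ≤ Z := one_le_mul_of_one_le_of_one_le hk2 hE1
  have hT₁T : T₁ ≤ T := by nlinarith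
  refine ⟨Y, hY,
    { cont := hc, bdd := hbdd, hXY := hX.trans hY.1, hYm := hY.2, he := he0, hV := hYe, hc := hc0,
      hVc := hVc, hP := by linarith [hY.1], hT := by linarith, hV1 := fun s hs => ?_,
      transfer := fun h hh y z F η hy hz hF s hs => ?_ }⟩
  · have := (abs_le.1 (hVl s (hY.1.trans hs.1))).2
    linarith
  · have right := transfer_level hY.1 hX₂0 hY.2 hYm he hV hV' hVl hlev hh
      (fun t ht => hy t ⟨hX.trans ht.1, ht.2⟩) (fun t ht => hz t ⟨hX.trans ht.1, ht.2⟩)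
      (fun t ht => hF t ⟨hX.trans ht.1, ht.2⟩)
    have hN : 0 ≤ y Y ^ 2 + z Y ^ 2 + η ^ 2 := by positivity
    rcases le_total X₂ s with h1 | h1
    · exact (right s ⟨h1, hs.2⟩).trans (mul_le_mul_of_nonneg_right hT₁T hN)
    · have sub : ∀ {t}, t ∈ Icc s X₂ → t ∈ Icc X Y :=
        fun ht => ⟨hs.1.trans ht.1, ht.2.trans hY.1⟩
      have g := gronwall_sol (q := fun t => V t - h) h1 hk (fun t ht => hy t (sub ht))
        (fun t ht => hz t (sub ht)) (fun t ht => by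
          have := hVk t ⟨(sub ht).1, ht.2⟩
          exact (abs_sub _ _).trans (by linarith)) (fun t ht => hF t (sub ht))
      have r := right X₂ ⟨le_rfl, hY.1⟩
      have s0 : 0 ≤ s := hX0.trans hs.1
      have k1 : k ^ 2 ≤ 1 := pow_le_one₀ hk.le hk1
      have b1 : Real.exp (3 * k * (X₂ - s)) ≤ Real.exp (3 * k * X₂) :=
        Real.exp_le_exp.2 (mul_le_mul_of_nonneg_left (by linarith) (by positivity))
      have b2 : k ^ 2 * y X₂ ^ 2 + z X₂ ^ 2 + η ^ 2 / k * (X₂ - s) ≤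
          (T₁ + X₂ / k) * (y Y ^ 2 + z Y ^ 2 + η ^ 2) := by
        have c1 : k ^ 2 * y X₂ ^ 2 ≤ y X₂ ^ 2 := mul_le_of_le_one_left (sq_nonneg _) k1
        have c2 : η ^ 2 / k * (X₂ - s) ≤ X₂ / k * η ^ 2 := by
          calc η ^ 2 / k * (X₂ - s) ≤ η ^ 2 / k * X₂ := by gcongr; linarith
            _ = _ := by ring
        have c3 : X₂ / k * η ^ 2 ≤ X₂ / k * (y Y ^ 2 + z Y ^ 2 + η ^ 2) := by
          gcongr
          linarith [sq_nonneg (y Y), sq_nonneg (z Y)]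
        linarith [add_mul T₁ (X₂ / k) (y Y ^ 2 + z Y ^ 2 + η ^ 2)]
      have b3 : k ^ 2 * (y s ^ 2 + z s ^ 2) ≤ Real.exp (3 * k * X₂) *
          ((T₁ + X₂ / k) * (y Y ^ 2 + z Y ^ 2 + η ^ 2)) := by
        have : k ^ 2 * (y s ^ 2 + z s ^ 2) ≤ k ^ 2 * y s ^ 2 + z s ^ 2 := by
          nlinarith [sq_nonneg (z s)]
        refine (this.trans g).trans (mul_le_mul b1 b2 ?_ (Real.exp_pos _).le)
        have : 0 ≤ X₂ - s := by linarith
        positivity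
      calc y s ^ 2 + z s ^ 2 = (k ^ 2)⁻¹ * (k ^ 2 * (y s ^ 2 + z s ^ 2)) := by field_simp
        _ ≤ (k ^ 2)⁻¹ * (Real.exp (3 * k * X₂) *
              ((T₁ + X₂ / k) * (y Y ^ 2 + z Y ^ 2 + η ^ 2))) := by gcongr
        _ = Z * (T₁ + X₂ / k) * (y Y ^ 2 + z Y ^ 2 + η ^ 2) := by rw [hZ]; ring
        _ ≤ _ := mul_le_mul_of_nonneg_right hT hN

theorem eventually_mul_pow_le_exp (K : ℝ) (N : ℕ) :
    ∀ᶠ L : ℕ in atTop, K * (L : ℝ) ^ N ≤ Real.exp L := by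
  have h := (Real.isLittleO_pow_exp_atTop (n := N)).def (show 0 < 1 / (|K| + 1) by positivity)
  filter_upwards [tendsto_natCast_atTop_atTop.eventually h] with L hL
  rw [Real.norm_eq_abs, Real.norm_eq_abs, abs_of_pos (Real.exp_pos _), abs_of_nonneg (by positivity),
    div_mul_eq_mul_div, one_mul, le_div_iff₀ (by positivity)] at hL
  have h1 : K ≤ |K| + 1 := by linarith [le_abs_self K]
  have h2 : K * (L : ℝ) ^ N ≤ (|K| + 1) * (L : ℝ) ^ N := by gcongr
  linarith

/-- The effective angular frequency. -/
noncomputable def angFreq (L : ℕ) : ℝ := Real.sqrt ((L : ℝ) * ((L : ℝ) + 1))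

/-- The superexponentially small distance to the spectrum. -/
noncomputable def resWidth (L : ℕ) : ℝ := Real.exp (-(1 / 2) * angFreq L * Real.log (angFreq L))

theorem angFreq_sq (L : ℕ) : angFreq L ^ 2 = (L : ℝ) * ((L : ℝ) + 1) :=
  Real.sq_sqrt (by positivity)

theorem le_angFreq (L : ℕ) : (L : ℝ) ≤ angFreq L :=
  Real.le_sqrt_of_sq_le (by nlinarith [Nat.cast_nonneg (α := ℝ) L])

theorem angFreq_le (L : ℕ) : angFreq L ≤ L + 1 := by
  have h : (0 : ℝ) ≤ L := Nat.cast_nonneg L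
  exact Real.sqrt_le_iff.2 ⟨by linarith, by nlinarith⟩

theorem angFreq_le_two_mul {L : ℕ} (hL : 1 ≤ L) : angFreq L ≤ 2 * L := by
  have h : (1 : ℝ) ≤ L := by exact_mod_cast hL
  linarith [angFreq_le L]

theorem eventually_le_log (R : ℝ) : ∀ᶠ L : ℕ in atTop, R ≤ Real.log L :=
  (Real.tendsto_log_atTop.comp tendsto_natCast_atTop_atTop).eventually (eventually_ge_atTop R)

theorem eventually_resWidth_le (a : ℝ) :
    ∀ᶠ L : ℕ in atTop, resWidth L ≤ Real.exp (-(a * L)) := by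
  filter_upwards [eventually_le_log (2 * a), eventually_ge_atTop 1] with L hL h1
  have h : (1 : ℝ) ≤ L := by exact_mod_cast h1
  refine Real.exp_le_exp.2 ?_
  have q := le_angFreq L
  have hl := Real.log_le_log (by linarith) q
  have h0 := Real.log_nonneg h
  nlinarith [mul_le_mul q hl h0 (by linarith), mul_le_mul_of_nonneg_left hL (by linarith : (0:ℝ) ≤ L)]

theorem eventually_exists_power {K c : ℝ} (hK : 0 < K) (hc : 0 < c) (a : ℝ) :
    ∀ᶠ L : ℕ in atTop, ∃ n : ℕ, ((n : ℝ) + 2) * (n + 1) ≤ (L : ℝ) * (L + 1) / 4 ∧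
      Real.exp (a * L) ≤ resWidth L / 2 * (K * (c * ((L : ℝ) * (L + 1))) ^ (n + 2)) := by
  filter_upwards [eventually_le_log
      (4 * (|a| + |Real.log c| + 2 * Real.log 2 + |Real.log K|)), eventually_ge_atTop 3]
    with L hL h3
  have h : (3 : ℝ) ≤ L := by exact_mod_cast h3
  have hL0 : (0 : ℝ) < L := by linarith
  obtain ⟨n, hn1, hn2⟩ : ∃ n : ℕ, 2 * (n + 2) ≤ L + 1 ∧ L ≤ 2 * (n + 2) :=
    ⟨(L + 1) / 2 - 2, by omega, by omega⟩
  have hn1' : 2 * ((n : ℝ) + 2) ≤ L + 1 := by exact_mod_cast hn1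
  have hn2' : (L : ℝ) ≤ 2 * ((n : ℝ) + 2) := by exact_mod_cast hn2
  refine ⟨n, by nlinarith [Nat.cast_nonneg (α := ℝ) n], ?_⟩
  set l : ℝ := (L : ℝ) with hl
  have hlog2 : 0 ≤ Real.log 2 := Real.log_nonneg (by norm_num)
  have ca := abs_nonneg a
  have cc := neg_abs_le (Real.log c)
  have cc0 := abs_nonneg (Real.log c)
  have cK := neg_abs_le (Real.log K)
  have cK0 := abs_nonneg (Real.log K)
  have h2a := le_abs_self a
  have e2 : Real.exp ((n + 2 : ℕ) * (Real.log c + 2 * Real.log l)) ≤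
      (c * (l * (l + 1))) ^ (n + 2) := by
    rw [Real.exp_nat_mul]
    refine pow_le_pow_left₀ (Real.exp_pos _).le ?_ _
    rw [Real.exp_add, Real.exp_log hc, two_mul, Real.exp_add, Real.exp_log hL0]
    gcongr
    linarith
  have e3 : Real.exp (-((l + 1) / 2 * (Real.log l + Real.log 2))) ≤ resWidth L := by
    refine Real.exp_le_exp.2 ?_
    have q := le_angFreq L
    have q2 := angFreq_le L
    have hl1 := Real.log_nonneg (show 1 ≤ angFreq L by linarith)
    have hl2 : Real.log (angFreq L) ≤ Real.log l + Real.log 2 := by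
      rw [← Real.log_mul hL0.ne' (by norm_num)]
      exact Real.log_le_log (by linarith) (by linarith)
    nlinarith [mul_le_mul q2 hl2 hl1 (by linarith)]
  have e4 : Real.exp (a * l + Real.log 2) ≤
      Real.exp (-((l + 1) / 2 * (Real.log l + Real.log 2))) *
        (Real.exp (Real.log K) * Real.exp ((n + 2 : ℕ) * (Real.log c + 2 * Real.log l))) := by
    rw [← Real.exp_add, ← Real.exp_add]
    refine Real.exp_le_exp.2 ?_
    push_cast
    set ll := Real.log l with hlam
    set lc := Real.log c with hlc
    set lK := Real.log K with hlK
    set l2 := Real.log 2 with hl2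
    have b0 : 0 ≤ lc + 2 * ll := by linarith
    have b1 : l / 2 * (lc + 2 * ll) ≤ ((n : ℝ) + 2) * (lc + 2 * ll) :=
      mul_le_mul_of_nonneg_right (by linarith) b0
    have b2 : l / 4 * ll ≤ (l - 1) / 2 * ll := mul_le_mul_of_nonneg_right (by linarith) (by linarith)
    have b3 : l * (|a| + |lc| + 2 * l2 + |lK|) ≤ l / 4 * ll := by
      have := mul_le_mul_of_nonneg_left hL (show 0 ≤ l / 4 by linarith)
      linarith
    have b4 : a * l ≤ l * |a| := by nlinarith
    have b5 : -(l * |lc|) ≤ l / 2 * lc := by nlinarith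
    have b6 : -lK ≤ l * |lK| := by nlinarith
    have b7 : (l + 1) / 2 * l2 + l2 ≤ l * (2 * l2) := by nlinarith
    linarith
  rw [Real.exp_add, Real.exp_log (by norm_num : (0:ℝ) < 2), Real.exp_log hK] at e4
  have e5 : Real.exp (-((l + 1) / 2 * (Real.log l + Real.log 2))) *
        (K * Real.exp ((n + 2 : ℕ) * (Real.log c + 2 * Real.log l))) ≤
      resWidth L * (K * (c * (l * (l + 1))) ^ (n + 2)) := by
    have : 0 ≤ resWidth L := (Real.exp_pos _).le
    gcongr
  linarith

theorem resWidth_pos (L : ℕ) : 0 < resWidth L := Real.exp_pos _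

theorem eventually_transfer_le {β γ η : ℝ} (hβ : 0 < β) (hη : 0 < η) (p : ℕ) :
    ∃ a, 0 ≤ a ∧ ∀ᶠ L : ℕ in atTop,
      ((η / angFreq L) ^ 2)⁻¹ * Real.exp (3 * (η / angFreq L) * (β * angFreq L ^ 2)) *
        (4 * Real.exp 3 * (γ * (L : ℝ) ^ p) ^ 4 + β * angFreq L ^ 2 / (η / angFreq L))
        ≤ Real.exp (a * L) := by
  refine ⟨6 * η * β + 3, by positivity, ?_⟩
  filter_upwards [eventually_ge_atTop 1, eventually_mul_pow_le_exp (4 / η ^ 2) 2,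
    eventually_mul_pow_le_exp (4 * Real.exp 3 * γ ^ 4) (4 * p),
    eventually_mul_pow_le_exp (8 * β / η) 3, eventually_mul_pow_le_exp 2 0] with L h1 e1 e2 e3 e4
  have hl : (1 : ℝ) ≤ L := by exact_mod_cast h1
  have q1 := le_angFreq L
  have q2 := angFreq_le_two_mul h1
  set l : ℝ := (L : ℝ)
  set q := angFreq L
  have hq : 0 < q := by linarith
  have f1 : ((η / q) ^ 2)⁻¹ ≤ Real.exp l := by
    refine le_trans ?_ e1
    calc ((η / q) ^ 2)⁻¹ = q ^ 2 / η ^ 2 := by field_simp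
      _ ≤ (2 * l) ^ 2 / η ^ 2 := by gcongr
      _ = _ := by ring
  have f2 : Real.exp (3 * (η / q) * (β * q ^ 2)) ≤ Real.exp (6 * η * β * l) := by
    refine Real.exp_le_exp.2 ?_
    calc 3 * (η / q) * (β * q ^ 2) = 3 * η * β * q := by field_simp
      _ ≤ 3 * η * β * (2 * l) := by gcongr
      _ = _ := by ring
  have f3 : 4 * Real.exp 3 * (γ * l ^ p) ^ 4 ≤ Real.exp l := by
    refine le_trans (le_of_eq ?_) e2
    rw [mul_pow, ← pow_mul, mul_comm p 4]; ring
  have f4 : β * q ^ 2 / (η / q) ≤ Real.exp l := by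
    refine le_trans ?_ e3
    calc β * q ^ 2 / (η / q) = β * q ^ 3 / η := by field_simp
      _ ≤ β * (2 * l) ^ 3 / η := by gcongr
      _ = _ := by ring
  have f5 : 4 * Real.exp 3 * (γ * l ^ p) ^ 4 + β * q ^ 2 / (η / q) ≤ Real.exp l * Real.exp l := by
    have := Real.exp_pos l
    rw [pow_zero, mul_one] at e4
    nlinarith
  calc _ ≤ Real.exp l * Real.exp (6 * η * β * l) * (Real.exp l * Real.exp l) := by
        gcongr
    _ = _ := by rw [← Real.exp_add, ← Real.exp_add, ← Real.exp_add]; congr 1; ring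

theorem eventually_small {γ a : ℝ} (ha : 0 ≤ a) (p : ℕ) :
    ∀ᶠ L : ℕ in atTop, γ * (L : ℝ) ^ p * (Real.exp (a * L) *
      ((γ * (L : ℝ) ^ p + 8 * (L : ℝ) ^ p) ^ 2 + 5 * Real.exp (a * L)) * (resWidth L / 2) ^ 2)
      ≤ 1 / 64 := by
  filter_upwards [eventually_ge_atTop 1, eventually_mul_pow_le_exp |γ| p,
    eventually_mul_pow_le_exp (|γ| + 8) p, eventually_mul_pow_le_exp 384 0,
    eventually_resWidth_le (a + 2)] with L h1 e1 e2 e3 e4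
  have hl : (1 : ℝ) ≤ L := by exact_mod_cast h1
  set l : ℝ := (L : ℝ)
  have hr := resWidth_pos L
  rw [pow_zero, mul_one] at e3
  have hP : 0 < l ^ p := by positivity
  have g0 := neg_abs_le γ
  have f1 : γ * l ^ p ≤ Real.exp l := le_trans (by gcongr; exact le_abs_self γ) e1
  have f2 : (γ * l ^ p + 8 * l ^ p) ^ 2 ≤ Real.exp l ^ 2 := by
    rw [← sq_abs]
    refine pow_le_pow_left₀ (abs_nonneg _) (le_trans ?_ e2) 2
    rw [← add_mul, abs_mul, abs_of_pos hP]
    gcongr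
    exact (abs_add_le _ _).trans (by norm_num)
  have f3 : (γ * l ^ p + 8 * l ^ p) ^ 2 + 5 * Real.exp (a * l) ≤ 6 * Real.exp ((a + 2) * l) := by
    have t1 : Real.exp l ^ 2 ≤ Real.exp ((a + 2) * l) := by
      rw [← Real.exp_nat_mul]; refine Real.exp_le_exp.2 ?_; push_cast; nlinarith
    have t2 : Real.exp (a * l) ≤ Real.exp ((a + 2) * l) := Real.exp_le_exp.2 (by nlinarith)
    linarith
  have f4 : (resWidth L / 2) ^ 2 ≤ Real.exp (-((a + 2) * l)) ^ 2 :=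
    pow_le_pow_left₀ (by positivity) (by linarith) 2
  calc _ ≤ Real.exp l * (Real.exp (a * l) * (6 * Real.exp ((a + 2) * l)) *
        Real.exp (-((a + 2) * l)) ^ 2) := by gcongr
    _ = 6 * (Real.exp l * Real.exp (a * l) * Real.exp ((a + 2) * l) *
        Real.exp (-((a + 2) * l)) * Real.exp (-((a + 2) * l))) := by ring
    _ = 6 * Real.exp (-l) := by
        rw [← Real.exp_add, ← Real.exp_add, ← Real.exp_add, ← Real.exp_add]
        congr 2
        ring
    _ ≤ 1 / 64 := by
        rw [Real.exp_neg, ← div_eq_mul_inv, div_le_div_iff₀ (Real.exp_pos _) (by norm_num)]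
        linarith

theorem eventually_dominates {α γ κ₀ S a : ℝ} (hα : 0 < α) (hS : 0 < S) (hκ₀ : 0 < κ₀)
    (ha : 0 ≤ a) (p : ℕ) :
    ∀ᶠ L : ℕ in atTop, ∃ (n : ℕ) (B : ℝ), ((n : ℝ) + 2) * (n + 1) ≤ angFreq L ^ 2 / 4 ∧ 0 < B ∧
      5 * Real.exp (a * L) ≤ B ^ 2 ∧ (α * angFreq L ^ 2) ^ 2 * (5 * Real.exp (a * L)) ≤ B ^ 2 ∧
      γ * (L : ℝ) ^ p * (5 * Real.exp (a * L)) + (γ * (L : ℝ) ^ p + 8 * (L : ℝ) ^ p) ≤ B ^ 2 ∧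
      Real.exp (3 * (κ₀ * angFreq L) * S) * (10 * (κ₀ * angFreq L) ^ 4) * B ^ 4 * 128 ^ 2 <
        (resWidth L / 2 * (S * (α * angFreq L ^ 2 / (4 * S)) ^ (n + 2))) ^ 2 := by
  filter_upwards [eventually_ge_atTop 1, eventually_mul_pow_le_exp γ p,
    eventually_mul_pow_le_exp (γ + 8) p, eventually_mul_pow_le_exp 5 0,
    eventually_mul_pow_le_exp (80 * α ^ 2) 4,
    eventually_mul_pow_le_exp (160 * κ₀ ^ 4 * 128 ^ 2) 4,
    eventually_exists_power hS (show 0 < α / (4 * S) by positivity) (3 * κ₀ * S + 2 * a + 5)]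
    with L h1 e1 e2 e3 e4 e5 ⟨n, hn, e6⟩
  have hl : (1 : ℝ) ≤ L := by exact_mod_cast h1
  have q1 := le_angFreq L
  have q2 := angFreq_le_two_mul h1
  rw [← angFreq_sq] at hn e6
  set l : ℝ := (L : ℝ)
  set q := angFreq L
  have hq : 0 < q := by linarith
  rw [pow_zero, mul_one] at e3
  have hE := Real.exp_pos l
  have hT := Real.exp_pos (a * l)
  have B2 : Real.exp ((a + 2) * l) ^ 2 = Real.exp ((2 * a + 4) * l) := by
    rw [← Real.exp_nat_mul]; congr 1; push_cast; ring
  have B4 : Real.exp ((a + 2) * l) ^ 4 = Real.exp ((4 * a + 8) * l) := by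
    rw [← Real.exp_nat_mul]; congr 1; push_cast; ring
  refine ⟨n, Real.exp ((a + 2) * l), hn, Real.exp_pos _, ?_, ?_, ?_, ?_⟩
  · rw [B2]
    calc 5 * Real.exp (a * l) ≤ Real.exp l * Real.exp (a * l) := by gcongr
      _ = Real.exp (l + a * l) := by rw [Real.exp_add]
      _ ≤ _ := Real.exp_le_exp.2 (by nlinarith)
  · rw [B2]
    calc (α * q ^ 2) ^ 2 * (5 * Real.exp (a * l)) ≤ (α * (2 * l) ^ 2) ^ 2 * (5 * Real.exp (a * l)) := by
          gcongr
      _ = 80 * α ^ 2 * l ^ 4 * Real.exp (a * l) := by ring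
      _ ≤ Real.exp l * Real.exp (a * l) := by gcongr
      _ = Real.exp (l + a * l) := by rw [Real.exp_add]
      _ ≤ _ := Real.exp_le_exp.2 (by nlinarith)
  · rw [B2]
    have t1 : γ * l ^ p * (5 * Real.exp (a * l)) ≤ Real.exp l * (Real.exp l * Real.exp (a * l)) := by
      gcongr
    have t2 : γ * l ^ p + 8 * l ^ p ≤ Real.exp l * (Real.exp l * Real.exp (a * l)) := by
      have h3 : 1 ≤ Real.exp (a * l) := Real.one_le_exp (by positivity)
      have h4 : 1 ≤ Real.exp l * Real.exp (a * l) := one_le_mul_of_one_le_of_one_le (by linarith) h3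
      nlinarith
    calc _ ≤ 5 * (Real.exp l * (Real.exp l * Real.exp (a * l))) := by
          have := mul_pos hE (mul_pos hE hT)
          linarith
      _ ≤ Real.exp l * (Real.exp l * (Real.exp l * Real.exp (a * l))) := by gcongr
      _ = Real.exp (l + (l + (l + a * l))) := by rw [Real.exp_add, Real.exp_add, Real.exp_add]
      _ ≤ _ := Real.exp_le_exp.2 (by nlinarith)
  · rw [B4]
    have t1 : Real.exp (3 * (κ₀ * q) * S) ≤ Real.exp (6 * κ₀ * S * l) := by
      refine Real.exp_le_exp.2 ?_
      have := mul_le_mul_of_nonneg_left q2 (show 0 ≤ 3 * κ₀ * S by positivity)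
      linarith
    have t2 : 10 * (κ₀ * q) ^ 4 * 128 ^ 2 ≤ Real.exp l := by
      refine le_trans ?_ e5
      calc 10 * (κ₀ * q) ^ 4 * 128 ^ 2 ≤ 10 * (κ₀ * (2 * l)) ^ 4 * 128 ^ 2 := by gcongr
        _ = _ := by ring
    calc _ = Real.exp (3 * (κ₀ * q) * S) * (10 * (κ₀ * q) ^ 4 * 128 ^ 2) *
          Real.exp ((4 * a + 8) * l) := by ring
      _ ≤ Real.exp (6 * κ₀ * S * l) * Real.exp l * Real.exp ((4 * a + 8) * l) := by gcongr
      _ = Real.exp (6 * κ₀ * S * l + l + (4 * a + 8) * l) := by rw [Real.exp_add, Real.exp_add]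
      _ < Real.exp ((2 : ℕ) * ((3 * κ₀ * S + 2 * a + 5) * l)) :=
          Real.exp_lt_exp.2 (by push_cast; nlinarith)
      _ = Real.exp ((3 * κ₀ * S + 2 * a + 5) * l) ^ 2 := by rw [Real.exp_nat_mul]
      _ ≤ _ := by
          refine pow_le_pow_left₀ (Real.exp_pos _).le (e6.trans (le_of_eq ?_)) 2
          rw [div_mul_eq_mul_div α]

theorem eventually_mul_resWidth_le (K : ℝ) (N : ℕ) :
    ∀ᶠ L : ℕ in atTop, K * (L : ℝ) ^ N * resWidth L ≤ 1 := by
  filter_upwards [eventually_mul_pow_le_exp K N, eventually_resWidth_le 1] with L e1 e2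
  rw [one_mul] at e2
  calc K * (L : ℝ) ^ N * resWidth L ≤ Real.exp L * Real.exp (-L) :=
        mul_le_mul e1 e2 (resWidth_pos L).le (Real.exp_pos _).le
    _ = 1 := by rw [← Real.exp_add, add_neg_cancel, Real.exp_zero]

theorem eventually_le_angFreq_sq (K : ℝ) : ∀ᶠ L : ℕ in atTop, K ≤ angFreq L ^ 2 := by
  filter_upwards [(tendsto_natCast_atTop_atTop (R := ℝ)).eventually (eventually_ge_atTop K),
    eventually_ge_atTop 1] with L hL h1
  have h : (1 : ℝ) ≤ L := by exact_mod_cast h1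
  rw [angFreq_sq]
  nlinarith

namespace IsRadius
variable {M E rm rp κ m : ℝ} {rofs : ℝ → ℝ}

theorem continuous_radialPot (R : IsRadius M E rm rp κ rofs) (Λ : ℝ) :
    Continuous fun s => radialPot M m E Λ (rofs s) :=
  continuous_iff_continuousAt.2 fun s =>
    (hasDerivAt_radialPot (R.r_pos s)).continuousAt.comp R.continuous.continuousAt

theorem abs_effective_le (R : IsRadius M E rm rp κ rofs) {r Λ α μ C : ℝ} (hr : rp ≤ r)
    (hr8 : 8 * M ≤ r) (hΛ : 1 ≤ Λ) (hα : 0 < α) (hαr : α * Λ / 2 ≤ r) (hμ : 0 ≤ μ)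
    (hμC : μ ≤ C / Λ) :
    |radialPot M m E Λ r - m ^ 2 + μ| ≤ (8 / α ^ 2 + C + 4 * M * m ^ 2 / α) / Λ := by
  have hr0 := R.rp_pos.trans_le hr
  have hM := R.M_pos
  have l := R.radialPot_far_ge (m := m) hr hr8 (zero_le_one.trans hΛ)
  have u := R.radialPot_far_le (m := m) hr hr8 hΛ
  have hΛ0 : 0 < Λ := by linarith
  have t1 : 2 * M * m ^ 2 / r ≤ 4 * M * m ^ 2 / α / Λ := by
    calc 2 * M * m ^ 2 / r ≤ 2 * M * m ^ 2 / (α * Λ / 2) := by gcongr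
      _ = _ := by field_simp; ring
  have t2 : 2 * Λ / r ^ 2 ≤ 8 / α ^ 2 / Λ := by
    calc 2 * Λ / r ^ 2 ≤ 2 * Λ / (α * Λ / 2) ^ 2 := by gcongr
      _ = _ := by field_simp; norm_num
  have t3 : 0 ≤ 3 / 4 * Λ / r ^ 2 := by positivity
  have t4 : 0 ≤ 8 / α ^ 2 / Λ := by positivity
  have t5 : 0 ≤ 4 * M * m ^ 2 / α / Λ := by positivity
  rw [add_div, add_div, abs_le]
  constructor <;> linarith

set_option maxHeartbeats 1000000 in
/-- For large angular momentum the effective potential satisfies the far-field hypotheses. -/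
theorem exists_farData (R : IsRadius M E rm rp κ rofs) (hm : 0 < m) {C₁ s₀ : ℝ} (hC₁ : 0 < C₁)
    {p : ℕ} (hp : 2 ≤ p)
    (far : ∀ s, s₀ ≤ s → 8 * M ≤ rofs s ∧ rofs s ≤ s ∧ s ≤ 2 * rofs s) {γ : ℝ}
    (hγ : γ = 8 * M * m ^ 2 + 4 * (8 / (M * m ^ 2))) :
    ∃ a, 0 ≤ a ∧ ∀ᶠ L : ℕ in atTop, ∀ ω : ℝ, ((L : ℝ) ^ p)⁻¹ ≤ m ^ 2 - ω ^ 2 →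
      m ^ 2 - ω ^ 2 ≤ C₁ * ((L : ℝ) ^ 2)⁻¹ →
      ∃ Y ∈ Icc (8 / (M * m ^ 2) * angFreq L ^ 2) (γ * (L : ℝ) ^ p),
        FarData (fun s => radialPot M m E (angFreq L ^ 2) (rofs s) - ω ^ 2)
          (1 / (4 * M * m ^ 2) * angFreq L ^ 2) Y (γ * (L : ℝ) ^ p) (resWidth L / 2)
          (1 / (4 * (L : ℝ) ^ p)) (γ * (L : ℝ) ^ p + 8 * (L : ℝ) ^ p) (Real.exp (a * L)) := by
  have hM := R.M_pos
  set α := 1 / (4 * M * m ^ 2) with hα'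
  set β := 8 / (M * m ^ 2) with hβ'
  have hα : 0 < α := by positivity
  have hβ : 0 < β := by positivity
  have hαβ : α ≤ β := by
    rw [hα', hβ', div_le_div_iff₀ (by positivity) (by positivity)]
    nlinarith [mul_pos hM (pow_pos hm 2)]
  have hγ0 : 0 < γ := by rw [hγ]; positivity
  set η := 8 / α ^ 2 + 4 * C₁ + 4 * M * m ^ 2 / α + 1 with hη'
  have hη1 : 1 ≤ η := by
    have : 0 < 8 / α ^ 2 + 4 * C₁ + 4 * M * m ^ 2 / α := by positivity
    linarith
  have hη : 0 < η := by linarith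
  obtain ⟨a, ha, tr⟩ := eventually_transfer_le (γ := γ) hβ hη p
  refine ⟨a, ha, ?_⟩
  filter_upwards [tr, eventually_ge_atTop 1, eventually_mul_resWidth_le (2 * γ ^ 2) (2 * p),
    eventually_mul_resWidth_le 4 2, eventually_mul_resWidth_le 2 p,
    eventually_le_angFreq_sq (4 * η ^ 2), eventually_le_angFreq_sq (8 / (m * β)),
    eventually_le_angFreq_sq (max s₀ 2 / α), eventually_le_angFreq_sq (2 / β)]
    with L hT h1 f1 f2 f3 f4 f5 f6 f7 ω hω1 hω2
  have hl : (1 : ℝ) ≤ L := by exact_mod_cast h1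
  have q1 := le_angFreq L
  have q2 := angFreq_le_two_mul h1
  have hw := resWidth_pos L
  set l : ℝ := (L : ℝ)
  set q := angFreq L
  have hl0 : 0 < l := by linarith
  have hq1 : 1 ≤ q := hl.trans q1
  have hq0 : 0 < q := by linarith
  have hΛ1 : 1 ≤ q ^ 2 := one_le_pow₀ hq1
  have hΛ4 : q ^ 2 ≤ 4 * l ^ 2 := by
    calc q ^ 2 ≤ (2 * l) ^ 2 := by gcongr
      _ = _ := by ring
  have hlp : l ^ 2 ≤ l ^ p := pow_le_pow_right₀ hl hp
  have hlp0 : 0 < l ^ p := by positivity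
  have hμ0 : 0 ≤ m ^ 2 - ω ^ 2 := le_trans (by positivity) hω1
  have hμC : m ^ 2 - ω ^ 2 ≤ 4 * C₁ / q ^ 2 := by
    refine hω2.trans ?_
    rw [← div_eq_mul_inv, div_le_div_iff₀ (by positivity) (by positivity)]
    linarith [mul_le_mul_of_nonneg_left hΛ4 hC₁.le]
  have he1 : resWidth L / 2 ≤ 1 / q ^ 2 := by
    rw [le_div_iff₀ (by positivity)]
    linarith [mul_le_mul_of_nonneg_left hΛ4 hw.le]
  have he2 : resWidth L / 2 ≤ 1 / (4 * l ^ p) := by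
    rw [le_div_iff₀ (by positivity)]
    linarith
  have hX : max s₀ 2 ≤ α * q ^ 2 := by rwa [div_le_iff₀' hα] at f6
  have hXX : α * q ^ 2 ≤ β * q ^ 2 := by gcongr
  have hXs : ∀ s, α * q ^ 2 ≤ s → rp ≤ rofs s ∧ 8 * M ≤ rofs s ∧ rofs s ≤ s ∧ s ≤ 2 * rofs s :=
    fun s hs => ⟨(R.gt s).le, far s ((le_max_left _ _).trans (hX.trans hs))⟩
  have hbd : ∀ s, α * q ^ 2 ≤ s →
      |radialPot M m E (q ^ 2) (rofs s) - ω ^ 2| + resWidth L / 2 ≤ (η / q) ^ 2 := by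
    intro s hs
    obtain ⟨r1, r2, r3, r4⟩ := hXs s hs
    have h := R.abs_effective_le (m := m) r1 r2 hΛ1 hα (by linarith) hμ0 hμC
    rw [show radialPot M m E (q ^ 2) (rofs s) - m ^ 2 + (m ^ 2 - ω ^ 2) =
      radialPot M m E (q ^ 2) (rofs s) - ω ^ 2 by ring] at h
    calc _ ≤ (8 / α ^ 2 + 4 * C₁ + 4 * M * m ^ 2 / α) / q ^ 2 + 1 / q ^ 2 := add_le_add h he1
      _ = η / q ^ 2 := by rw [← add_div]
      _ ≤ η ^ 2 / q ^ 2 := by gcongr; exact le_self_pow₀ hη1 two_ne_zero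
      _ = _ := by rw [div_pow]
  have hηq : (η / q) ^ 2 ≤ 1 / 4 := by
    rw [div_pow, div_le_div_iff₀ (by positivity) (by norm_num)]
    linarith
  have hYm : β * q ^ 2 ≤ γ * l ^ p := by
    calc β * q ^ 2 ≤ β * (4 * l ^ p) := by gcongr; linarith
      _ ≤ γ * l ^ p := by
        rw [hγ]
        have : 0 ≤ 8 * M * m ^ 2 * l ^ p := by positivity
        linarith
  have hbq : 2 ≤ β * q ^ 2 := by rwa [div_le_iff₀' hβ] at f7
  have hbdd : ∃ K, ∀ s, |radialPot M m E (q ^ 2) (rofs s) - ω ^ 2| ≤ K := by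
    refine ⟨(m ^ 2 + 1 / rp ^ 2 + 2 * M / rp ^ 3) * q ^ 2 + ω ^ 2, fun s => ?_⟩
    have h0 := R.radialPot_nonneg (m := m) (R.gt s).le (sq_nonneg q)
    have h1 := R.radialPot_le_mul (m := m) (R.gt s).le hΛ1
    rw [abs_le]
    have h2 : 0 ≤ (m ^ 2 + 1 / rp ^ 2 + 2 * M / rp ^ 3) * q ^ 2 := h0.trans h1
    constructor <;> linarith [sq_nonneg ω]
  have h2c : 2 / (1 / (4 * l ^ p)) = 8 * l ^ p := by field_simp; norm_num
  rw [← h2c]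
  refine FarData.exists_of_bounds (k := η / q)
    (V' := fun s => radialPotDeriv M m E (q ^ 2) (rofs s) * speed M rm rp κ (rofs s))
    ((R.continuous_radialPot _).sub continuous_const) hbdd (by positivity) hXX hYm
    (hbq.trans hYm) (by positivity) ?_ (fun s _ => ?_) (fun s hs => ?_) (fun s hs => ?_)
    (by positivity) ?_ (fun s hs => hbd s hs.1) (by positivity) (fun s hs => ?_) hT
  · calc 4 * (resWidth L / 2) * (γ * l ^ p) ^ 2 = 2 * γ ^ 2 * l ^ (2 * p) * resWidth L := by
          rw [mul_pow, ← pow_mul, mul_comm p 2]; ring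
      _ ≤ 1 := f1
  · exact ((hasDerivAt_radialPot (R.r_pos s)).comp s (R.hasDerivAt s)).sub_const _
  · obtain ⟨r1, r2, r3, r4⟩ := hXs s (hXX.trans hs)
    refine mul_nonneg (R.radialPotDeriv_far_nonneg r1 r2 (sq_nonneg q) ?_ ?_) (R.speed_pos s).le
    · have : M * m ^ 2 * (β * q ^ 2) = 8 * q ^ 2 := by rw [hβ']; field_simp
      have hr := mul_le_mul_of_nonneg_left (show β * q ^ 2 ≤ 2 * rofs s by linarith)
        (show 0 ≤ M * m ^ 2 by positivity)
      linarith
    · have : 4 ≤ m * rofs s := by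
        rw [div_le_iff₀' (by positivity)] at f5
        have hr := mul_le_mul_of_nonneg_left (show β * q ^ 2 ≤ 2 * rofs s by linarith) hm.le
        linarith
      have h := pow_le_pow_left₀ (by norm_num) this 2
      rw [mul_pow] at h
      linarith
  · linarith [hbd s (hXX.trans hs)]
  · refine le_of_sq_le_sq (hηq.trans (by norm_num)) zero_le_one
  · obtain ⟨r1, r2, r3, r4⟩ := hXs s (hXX.trans (hYm.trans hs))
    have h := R.radialPot_far_ge (m := m) r1 r2 (sq_nonneg q)
    have t3 : 0 ≤ 3 / 4 * q ^ 2 / rofs s ^ 2 := by positivity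
    have t4 : 2 * M * m ^ 2 / rofs s ≤ 1 / (2 * l ^ p) := by
      rw [div_le_div_iff₀ (R.r_pos s) (by positivity)]
      have : 8 * M * m ^ 2 * l ^ p ≤ s := by
        refine le_trans ?_ hs
        rw [hγ]
        have : 0 < 4 * β * l ^ p := by positivity
        linarith
      linarith
    have t5 : (l ^ p)⁻¹ = 1 / (2 * l ^ p) + 2 * (1 / (4 * l ^ p)) := by field_simp; norm_num
    linarith

end IsRadius

theorem Vpot_eq (M m E : ℝ) (rofs : ℝ → ℝ) (ω : ℝ) (L : ℕ) (s : ℝ) :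
    Vpot M m E rofs ω L s = radialPot M m E (angFreq L ^ 2) (rofs s) - ω ^ 2 := by
  rw [Vpot, radialPot, lapse, angular, angFreq_sq]
  ring

theorem W0_eq (M m E : ℝ) (rofs : ℝ → ℝ) (L : ℕ) (s : ℝ) :
    W0 M m E rofs L s = radialPot M m E (angFreq L ^ 2) (rofs s) - m ^ 2 := by
  rw [W0, radialPot, lapse, angular, angFreq_sq]

namespace IsRadius
variable {M E rm rp κ m : ℝ} {rofs : ℝ → ℝ}

/-- In the region where the centrifugal term dominates, the effective potential is bounded below
by a quarter of it. -/
theorem centrifugal_le (R : IsRadius M E rm rp κ rofs) (hm : 0 < m) {ω Λ s : ℝ} (hΛ : 0 ≤ Λ)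
    (hω : ω ^ 2 ≤ m ^ 2) (hr8 : 8 * M ≤ rofs s) (hrs : rofs s ≤ s)
    (hs : s ≤ 1 / (4 * M * m ^ 2) * Λ) :
    Λ / 4 ≤ s ^ 2 * (radialPot M m E Λ (rofs s) - ω ^ 2) := by
  have hM := R.M_pos
  have hr0 := R.r_pos s
  have h := R.radialPot_far_ge (m := m) (R.gt s).le hr8 hΛ
  have h1 : 4 * M * m ^ 2 * rofs s ≤ Λ := by
    have := hrs.trans hs
    rwa [one_div_mul_eq_div, le_div_iff₀' (by positivity)] at this
  have h2 : Λ / 4 / rofs s ^ 2 ≤ 3 / 4 * Λ / rofs s ^ 2 - 2 * M * m ^ 2 / rofs s := by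
    have : 3 / 4 * Λ / rofs s ^ 2 - 2 * M * m ^ 2 / rofs s =
        (3 / 4 * Λ - 2 * M * m ^ 2 * rofs s) / rofs s ^ 2 := by field_simp
    rw [this]
    gcongr
    linarith
  have h3 : Λ / 4 / rofs s ^ 2 ≤ radialPot M m E Λ (rofs s) - ω ^ 2 := by linarith
  have h4 : 0 ≤ radialPot M m E Λ (rofs s) - ω ^ 2 := le_trans (by positivity) h3
  rw [div_le_iff₀' (by positivity)] at h3
  exact h3.trans (by gcongr)

set_option maxHeartbeats 1000000 in
/-- Away from the resonances, decaying solutions of the radial equation satisfy a dissipative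
Robin condition at `2 * S` up to an error controlled by the source. -/
theorem exists_far_robin (R : IsRadius M E rm rp κ rofs) (hm : 0 < m) {C₁ s₀ : ℝ} (hC₁ : 0 < C₁)
    {p : ℕ} (hp : 2 ≤ p) (hs₀ : 1 ≤ s₀)
    (far : ∀ s, s₀ ≤ s → 8 * M ≤ rofs s ∧ rofs s ≤ s ∧ s ≤ 2 * rofs s) {S : ℝ} (hS : s₀ ≤ S) :
    ∃ K, 0 ≤ K ∧ ∀ᶠ L : ℕ in atTop, ∀ ω : ℝ, ((L : ℝ) ^ p)⁻¹ ≤ m ^ 2 - ω ^ 2 →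
      m ^ 2 - ω ^ 2 ≤ C₁ * ((L : ℝ) ^ 2)⁻¹ →
      (∀ lam : ℝ, lam ≤ 0 → IsDirichletEV M m E rofs L S lam →
        resWidth L ≤ |m ^ 2 - ω ^ 2 + lam|) →
      ∃ θ ≤ 0, ∀ (a a₁ h : ℝ → ℝ) (A : ℝ), (∀ s, HasDerivAt a (a₁ s) s) →
        (∀ s, HasDerivAt a₁ ((radialPot M m E (angFreq L ^ 2) (rofs s) - ω ^ 2) * a s + h s) s) →
        Continuous h → (∀ t, 2 * S ≤ t → ∫ s in (2 * S)..t, h s ^ 2 ≤ A) →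
        Tendsto a atTop (nhds 0) → Tendsto a₁ atTop (nhds 0) →
        (a₁ (2 * S) - θ * a (2 * S)) ^ 2 ≤ A * K := by
  have hM := R.M_pos
  have hrp := R.rp_pos
  set α := 1 / (4 * M * m ^ 2) with hα'
  have hα : 0 < α := by positivity
  obtain ⟨γ, hγ⟩ : ∃ γ, γ = 8 * M * m ^ 2 + 4 * (8 / (M * m ^ 2)) := ⟨_, rfl⟩
  have hγ0 : 0 < γ := by rw [hγ]; positivity
  set D₀ := m ^ 2 + 1 / rp ^ 2 + 2 * M / rp ^ 3 with hD₀
  have hD₀0 : 0 < D₀ := by positivity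
  set κ₀ := D₀ + 1 with hκ₀
  have hκ1 : 1 ≤ κ₀ := by linarith
  have hS1 : 1 ≤ S := hs₀.trans hS
  have hS0 : 0 < S := by linarith
  obtain ⟨a, ha, ev⟩ := R.exists_farData hm hC₁ hp far hγ
  set b := 2 * S with hb
  refine ⟨1 + 8 * (1 + 2 * b ^ 2 + b + b ^ 2 * κ₀ ^ 2), by positivity, ?_⟩
  filter_upwards [ev, eventually_ge_atTop 1, eventually_small (γ := γ) ha p,
    eventually_dominates (γ := γ) hα hS0 (zero_lt_one.trans_le hκ1) ha p, eventually_le_angFreq_sq 8,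
    eventually_le_angFreq_sq ((b + 1) / α), eventually_mul_resWidth_le (8 * α ^ 2) 2,
    eventually_mul_resWidth_le 1 p]
    with L hfar h1 f1 ⟨n, B, g1, g2, g3, g4, g5, g6⟩ f2 f3 f4 f5 ω hω1 hω2 hres
  obtain ⟨Y, hY, D⟩ := hfar ω hω1 hω2
  have hl : (1 : ℝ) ≤ L := by exact_mod_cast h1
  have q1 := le_angFreq L
  have q2 := angFreq_le_two_mul h1
  have hw := resWidth_pos L
  set l : ℝ := (L : ℝ)
  set q := angFreq L
  have hl0 : 0 < l := by linarith
  have hq1 : 1 ≤ q := hl.trans q1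
  have hq0 : 0 < q := by linarith
  have hΛ1 : 1 ≤ q ^ 2 := one_le_pow₀ hq1
  have hΛ4 : q ^ 2 ≤ 4 * l ^ 2 := by
    calc q ^ 2 ≤ (2 * l) ^ 2 := by gcongr
      _ = _ := by ring
  have hlp0 : 0 < l ^ p := by positivity
  have hμ0 : 0 ≤ m ^ 2 - ω ^ 2 := le_trans (by positivity) hω1
  have hXb : b + 1 ≤ α * q ^ 2 := by rwa [div_le_iff₀' hα] at f3
  have hT := Real.exp_pos (a * l)
  have hXX : α * q ^ 2 ≤ 8 / (M * m ^ 2) * q ^ 2 := by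
    have : α ≤ 8 / (M * m ^ 2) := by
      rw [hα', div_le_div_iff₀ (by positivity) (by positivity)]
      linarith [mul_pos hM (pow_pos hm 2)]
    gcongr
  have hcen : ∀ s ∈ Icc S (α * q ^ 2),
      q ^ 2 / 4 ≤ s ^ 2 * (radialPot M m E (q ^ 2) (rofs s) - ω ^ 2) := by
    intro s hs
    obtain ⟨r1, r2, -⟩ := far s (hS.trans hs.1)
    exact R.centrifugal_le hm (sq_nonneg q) (by linarith) r1 r2 hs.2
  refine D.robin (b := b) (k := κ₀ * q) (Λ := q ^ 2) (B := B)
    (G := S * (α * q ^ 2 / (4 * S)) ^ (n + 2)) n hS0 (by linarith) (by linarith) hXb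
    (one_le_mul_of_one_le_of_one_le hκ1 hq1) (fun s hs => ?_) (by linarith) hcen (fun s hs => ?_)
    g1 ?_ (fun h hh y z H h0 => ?_) g2 g3 g4 ?_ le_rfl (by positivity) ?_ ?_
  · have u := R.radialPot_le_mul (m := m) (R.gt s).le hΛ1
    have e1 : D₀ * q ^ 2 ≤ κ₀ ^ 2 * q ^ 2 := by
      gcongr
      nlinarith
    rw [mul_pow]
    linarith [sq_nonneg ω]
  · have hs0 : 0 < s := hS0.trans_le hs.1
    have c1 := hcen s hs
    have e1 : q ^ 2 / 4 / (α * q ^ 2) ^ 2 ≤ radialPot M m E (q ^ 2) (rofs s) - ω ^ 2 := by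
      calc q ^ 2 / 4 / (α * q ^ 2) ^ 2 ≤ q ^ 2 / 4 / s ^ 2 := by
            have := hs.2
            gcongr
        _ ≤ _ := by rwa [div_le_iff₀' (by positivity)]
    refine le_trans ?_ e1
    rw [le_div_iff₀ (by positivity)]
    have e2 := mul_le_mul_of_nonneg_left hΛ4 (show 0 ≤ 2 * α ^ 2 * resWidth L by positivity)
    have e3 : 2 * α ^ 2 * resWidth L * q ^ 2 ≤ 1 := by linarith
    have e4 := mul_le_mul_of_nonneg_right e3 (sq_nonneg q)
    linarith
  · refine le_trans ?_ f1
    have hw2 : 0 < resWidth L / 2 := by linarith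
    gcongr
    linarith [hY.2]
  · have hμ : (l ^ p)⁻¹ ≥ resWidth L := by
      rw [ge_iff_le, le_inv_comm₀ hw hlp0, ← one_div, le_div_iff₀ hw]
      linarith
    have hab := abs_le.1 hh
    have ev := D.isDirichletEV (μ := m ^ 2 - ω ^ 2) (M := M) (m := m) (E := E) (rofs := rofs)
      (L := L) (fun s => by rw [W0_eq]; ring) (by linarith [hY.1] : S < Y) hh H h0
    have := hres _ (by linarith) ev
    rw [show m ^ 2 - ω ^ 2 + (h - (m ^ 2 - ω ^ 2)) = h by ring] at this
    linarith
  · refine le_trans ?_ g5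
    have : Y - α * q ^ 2 ≤ γ * l ^ p := by
      have : 0 ≤ α * q ^ 2 := by positivity
      linarith [hY.2]
    gcongr
  · rwa [show b - S = S by rw [hb]; ring]
  · have e0 : 0 ≤ 1 + 2 * b ^ 2 + b := by positivity
    have e1 : 0 ≤ b ^ 2 * κ₀ ^ 2 := by positivity
    have e2 : 1 + 2 * b ^ 2 + b ≤ (1 + 2 * b ^ 2 + b) * q ^ 2 := le_mul_of_one_le_right e0 hΛ1
    have e3 : q ^ 2 / 8 ≤ q ^ 2 / 4 - 1 := by linarith
    calc 1 + b ^ 2 * (2 + (κ₀ * q) ^ 2) + b = 1 + 2 * b ^ 2 + b + b ^ 2 * κ₀ ^ 2 * q ^ 2 := by ring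
      _ ≤ q ^ 2 / 8 * (8 * (1 + 2 * b ^ 2 + b + b ^ 2 * κ₀ ^ 2)) := by linarith
      _ ≤ (q ^ 2 / 4 - 1) * (8 * (1 + 2 * b ^ 2 + b + b ^ 2 * κ₀ ^ 2)) := by gcongr
      _ = _ := by ring

end IsRadius

theorem lintegral_Iic_le_of_intervalIntegral_le {f : ℝ → ℝ} {b B : ℝ} (hf : Continuous f)
    (h0 : ∀ s, 0 ≤ f s) (hB : ∀ t ≤ b, ∫ s in t..b, f s ≤ B) :
    ∫⁻ s in Iic b, ENNReal.ofReal (f s) ≤ ENNReal.ofReal B := by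
  have hi : IntegrableOn f (Iic b) := by
    refine integrableOn_Iic_of_intervalIntegral_norm_bounded (a := id) (l := atBot) B b
      (fun t => (hf.integrableOn_Icc (a := t) (b := b)).mono_set Ioc_subset_Icc_self) tendsto_id ?_
    filter_upwards [eventually_le_atBot b] with t ht
    simp only [Real.norm_of_nonneg (h0 _)]
    exact hB t ht
  rw [← ofReal_integral_eq_lintegral_ofReal hi (Eventually.of_forall h0)]
  refine ENNReal.ofReal_le_ofReal
    (le_of_tendsto (intervalIntegral_tendsto_integral_Iic b hi tendsto_id) ?_)
  filter_upwards [eventually_le_atBot b] with t ht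
  exact hB t ht

theorem intervalIntegral_le_toReal_lintegral {f : ℝ → ℝ} (hf : Continuous f) (h0 : ∀ s, 0 ≤ f s)
    (hfin : ∫⁻ s, ENNReal.ofReal (f s) ≠ ⊤) {a t : ℝ} (hat : a ≤ t) :
    ∫ s in a..t, f s ≤ (∫⁻ s, ENNReal.ofReal (f s)).toReal := by
  have hi : Integrable f := ⟨hf.aestronglyMeasurable,
    (hasFiniteIntegral_iff_ofReal (Eventually.of_forall h0)).2 hfin.lt_top⟩
  rw [intervalIntegral.integral_of_le hat,
    ← integral_eq_lintegral_of_nonneg_ae (Eventually.of_forall h0) hf.aestronglyMeasurable]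
  exact setIntegral_le_integral hi (Eventually.of_forall h0)

theorem hasDerivAt_re {u : ℝ → ℂ} {u' : ℂ} {s : ℝ} (h : HasDerivAt u u' s) :
    HasDerivAt (fun s => (u s).re) u'.re s :=
  Complex.reCLM.hasFDerivAt.comp_hasDerivAt s h

theorem hasDerivAt_im {u : ℝ → ℂ} {u' : ℂ} {s : ℝ} (h : HasDerivAt u u' s) :
    HasDerivAt (fun s => (u s).im) u'.im s :=
  Complex.imCLM.hasFDerivAt.comp_hasDerivAt s h

theorem sq_norm_eq (z : ℂ) : ‖z‖ ^ 2 = z.re ^ 2 + z.im ^ 2 := by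
  rw [Complex.sq_norm, Complex.normSq_apply]; ring

theorem sq_norm_add_I_mul (ω : ℝ) (z w : ℂ) :
    ‖w + Complex.I * (ω : ℂ) * z‖ ^ 2 = (w.re - ω * z.im) ^ 2 + (w.im + ω * z.re) ^ 2 := by
  rw [sq_norm_eq]
  simp
  ring

theorem WeaklyOutgoing.tendsto_atTop {ω : ℝ} {u : ℝ → ℂ} (h : WeaklyOutgoing ω u) :
    Tendsto u atTop (nhds 0) ∧ Tendsto (deriv u) atTop (nhds 0) := by
  obtain ⟨ε, hε, he⟩ := h.2
  constructor <;> refine squeeze_zero_norm' ?_ he <;>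
    filter_upwards [eventually_ge_atTop 0] with s hs <;>
    refine le_trans ?_ (le_mul_of_one_le_left (by positivity) (Real.one_le_exp (by positivity)))
  · linarith [norm_nonneg (deriv u s)]
  · linarith [norm_nonneg (u s)]

theorem WeaklyOutgoing.tendsto_atBot {ω : ℝ} {u : ℝ → ℂ} (h : WeaklyOutgoing ω u) :
    Tendsto (fun s => deriv u s + Complex.I * (ω : ℂ) * u s) atBot (nhds 0) ∧
      ∃ I, Tendsto (fun s => ‖u s‖ ^ 2) atBot (nhds I) := by
  obtain ⟨c, h1, h2⟩ := h.1
  constructor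
  · have := h2.add (h1.const_mul (Complex.I * (ω : ℂ)))
    rw [mul_zero, add_zero] at this
    refine this.congr fun s => ?_
    ring
  · refine ⟨‖c‖ ^ 2, Tendsto.pow ?_ 2⟩
    rw [← tendsto_sub_nhds_zero_iff]
    refine squeeze_zero_norm (fun s => ?_) (norm_zero (E := ℂ) ▸ h1.norm)
    have e : ‖c * Complex.exp (-Complex.I * (ω : ℂ) * (s : ℂ))‖ = ‖c‖ := by
      rw [norm_mul, Complex.norm_exp]
      simp
    rw [← e]
    exact abs_norm_sub_norm_le _ _

/-- Real and imaginary parts of a weakly outgoing solution form an `Outgoing` pair. -/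
theorem exists_outgoing {ω : ℝ} {F w : ℝ → ℝ} {u H : ℝ → ℂ} (hu : ContDiff ℝ 2 u)
    (cH : Continuous H) (cw : Continuous w) (hw : ∀ s, 0 ≤ w s)
    (heq : ∀ s, deriv (deriv u) s - ((F s - ω ^ 2 : ℝ) : ℂ) * u s = H s)
    (out : WeaklyOutgoing ω u) (hfin : ∫⁻ s, ENNReal.ofReal (w s * ‖H s‖ ^ 2) ≠ ⊤) :
    ∃ I, Outgoing ω I (∫⁻ s, ENNReal.ofReal (w s * ‖H s‖ ^ 2)).toReal F w
      (fun s => (u s).re) (fun s => (deriv u s).re) (fun s => (u s).im) (fun s => (deriv u s).im)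
      (fun s => (H s).re) (fun s => (H s).im) := by
  have h2 : ContDiff ℝ 1 (deriv u) :=
    ((contDiff_succ_iff_deriv (n := 1)).1 (by rwa [one_add_one_eq_two])).2.2
  have d1 : ∀ s, HasDerivAt u (deriv u s) s := fun s =>
    (hu.differentiable (by norm_num) s).hasDerivAt
  have d2 : ∀ s, HasDerivAt (deriv u) (((F s - ω ^ 2 : ℝ) : ℂ) * u s + H s) s := fun s =>
    ((h2.differentiable (by norm_num) s).hasDerivAt).congr_deriv (by rw [← heq s]; ring)
  obtain ⟨l1, I, l2⟩ := out.tendsto_atBot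
  refine ⟨I, ⟨fun s => hasDerivAt_re (d1 s), fun s => hasDerivAt_im (d1 s), fun s => ?_,
    fun s => ?_, Complex.continuous_re.comp cH, Complex.continuous_im.comp cH,
    ENNReal.toReal_nonneg, fun a t hat => ?_, ?_, ?_, ?_⟩⟩
  · refine (hasDerivAt_re (d2 s)).congr_deriv ?_
    rw [Complex.add_re, Complex.re_ofReal_mul]
  · refine (hasDerivAt_im (d2 s)).congr_deriv ?_
    rw [Complex.add_im, Complex.im_ofReal_mul]
  · simp only [← sq_norm_eq]
    exact intervalIntegral_le_toReal_lintegral (by fun_prop)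
      (fun s => mul_nonneg (hw s) (sq_nonneg _)) hfin hat
  · have := (Complex.continuous_re.tendsto 0).comp l1
    rw [Complex.zero_re] at this
    refine this.congr fun s => ?_
    simp [sub_eq_add_neg]
  · have := (Complex.continuous_im.tendsto 0).comp l1
    rw [Complex.zero_im] at this
    refine this.congr fun s => ?_
    simp
  · simpa only [sq_norm_eq] using l2

/-- Improved estimate away from the critical frequencies: if m^2 - w^2 stays at distance
exp(-(1/2) LL log LL) from every nonpositive Dirichlet eigenvalue, the solution obeys a
polynomial-in-L estimate on a compact region. -/
theorem statement11
    (M m E : ℝ) (hM : 0 < M) (hm : 0 < m) (hE : |E| < M)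
    (rm rp κ : ℝ)
    (hrm : rm = M - Real.sqrt (M ^ 2 - E ^ 2))
    (hrp : rp = M + Real.sqrt (M ^ 2 - E ^ 2))
    (hκ : κ = (M * rp - E ^ 2) / rp ^ 3)
    (rofs : ℝ → ℝ)
    (hr1 : ∀ s : ℝ, rp < rofs s)
    (hr2 : ∀ s : ℝ, rofs s + (2 * κ)⁻¹ * Real.log ((rofs s - rm) * (rofs s - rp)) = s) :
    ∀ p : ℕ, 2 ≤ p → ∀ C₁ : ℝ, 0 < C₁ →
    ∃ Sstar : ℝ, 0 < Sstar ∧ ∀ S₀ : ℝ, Sstar ≤ S₀ →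
    ∀ δ : ℝ, δ ∈ Set.Ioo (0 : ℝ) 1 →
    ∃ C : ℝ, 0 < C ∧ ∃ L₀ : ℕ, ∀ L : ℕ, L₀ ≤ L →
    ∀ ω : ℝ, 0 < ω → ω < m →
      ((L : ℝ) ^ p)⁻¹ ≤ m ^ 2 - ω ^ 2 → m ^ 2 - ω ^ 2 ≤ C₁ * ((L : ℝ) ^ 2)⁻¹ →
    (∀ lam : ℝ, lam ≤ 0 → IsDirichletEV M m E rofs L S₀ lam →
      Real.exp (-(1 / 2) * Real.sqrt ((L : ℝ) * ((L : ℝ) + 1)) *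
          Real.log (Real.sqrt ((L : ℝ) * ((L : ℝ) + 1))))
        ≤ |m ^ 2 - ω ^ 2 + lam|) →
    ∀ H u : ℝ → ℂ, Continuous H → ContDiff ℝ 2 u →
    (∀ s : ℝ, deriv (deriv u) s - (Vpot M m E rofs ω L s : ℂ) * u s = H s) →
    WeaklyOutgoing ω u →
    (∫⁻ s in Set.Iic (2 * S₀),
        ENNReal.ofReal (rofs s / (rofs s - rp) * ‖deriv u s + Complex.I * (ω : ℂ) * u s‖ ^ 2
          + ((max 0 (-s)) ^ (1 + δ) + 1)⁻¹ * (‖deriv u s‖ ^ 2 + ‖u s‖ ^ 2)))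
      ≤ ENNReal.ofReal (C * Real.sqrt ((L : ℝ) * ((L : ℝ) + 1)) ^ 2) *
        ∫⁻ s : ℝ, ENNReal.ofReal (rofs s / (rofs s - rp) * ‖H s‖ ^ 2) := by
  intro p hp C₁ hC₁
  have R := isRadius_of_explicit hM hE hrm hrp hκ hr1 hr2
  obtain ⟨s₀, hs₀, far⟩ := R.exists_far (8 * M)
  refine ⟨s₀, by linarith, fun S hS δ hδ => ?_⟩
  obtain ⟨K, hK, ev⟩ := R.exists_far_robin hm hC₁ hp hs₀ far hS
  obtain ⟨s₁, hs₁, c, C, k, Λ₀, hc, hC, hk, near⟩ :=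
    R.exists_nearData (m := m) (b := 2 * S) hm (by linarith)
  obtain ⟨G, hG, key⟩ := Outgoing.exists_total_bound hm hc hC hk hK
    (show 0 ≤ 4 / δ from div_nonneg (by norm_num) hδ.1.le)
  refine ⟨G, hG, ?_⟩
  obtain ⟨L₀, hL₀⟩ := eventually_atTop.1 ((ev.and (eventually_le_angFreq_sq Λ₀)).and
    ((eventually_ge_atTop 1).and ((tendsto_natCast_atTop_atTop (R := ℝ)).eventually
      (eventually_ge_atTop (2 * C₁ / m ^ 2)))))
  refine ⟨L₀, fun L hL ω hω hωm hμ1 hμ2 hres H u cH hu heq out => ?_⟩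
  obtain ⟨⟨far_robin, hΛ₀⟩, hL1, hLC⟩ := hL₀ L hL
  have hl : (1 : ℝ) ≤ L := by exact_mod_cast hL1
  have hΛ : 0 < angFreq L ^ 2 := by
    have := le_angFreq L
    have : 0 < angFreq L := by linarith
    positivity
  change _ ≤ ENNReal.ofReal (G * angFreq L ^ 2) * _
  by_cases hfin : ∫⁻ s : ℝ, ENNReal.ofReal (rofs s / (rofs s - rp) * ‖H s‖ ^ 2) = ⊤
  · rw [hfin, ENNReal.mul_top (ENNReal.ofReal_pos.2 (mul_pos hG hΛ)).ne']
    exact le_top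
  have hω2 : m / 2 ≤ ω := by
    have h1 : C₁ * ((L : ℝ) ^ 2)⁻¹ ≤ m ^ 2 / 2 := by
      rw [← div_eq_mul_inv, div_le_div_iff₀ (by positivity) (by norm_num)]
      rw [div_le_iff₀' (by positivity)] at hLC
      have := mul_le_mul_of_nonneg_left (show (L : ℝ) ≤ L ^ 2 by nlinarith) (sq_nonneg m)
      linarith
    by_contra! h
    nlinarith
  obtain ⟨σ, hσ, D⟩ := near _ ω hΛ₀ hω2 hωm.le
  obtain ⟨θ, hθ, rob⟩ := far_robin ω hμ1 hμ2 hres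
  set w : ℝ → ℝ := fun s => rofs s / (rofs s - rp) with hw
  have w1 : ∀ s, 1 ≤ w s := D.one_le_w
  have cw : Continuous w := D.cw
  obtain ⟨I, O⟩ := exists_outgoing (F := fun s => radialPot M m E (angFreq L ^ 2) (rofs s)) (w := w)
    hu cH cw (fun s => zero_le_one.trans (w1 s)) (fun s => by rw [← Vpot_eq]; exact heq s) out hfin
  set A := (∫⁻ s, ENNReal.ofReal (w s * ‖H s‖ ^ 2)).toReal with hA
  obtain ⟨lu, lu'⟩ := out.tendsto_atTop
  have ch := O.ch
  have cg := O.cg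
  have src : ∀ f : ℝ → ℝ, Continuous f → (∀ s, f s ^ 2 ≤ (H s).re ^ 2 + (H s).im ^ 2) →
      ∀ t, 2 * S ≤ t → ∫ s in (2 * S)..t, f s ^ 2 ≤ A := fun f cf hf t ht => by
    refine (intervalIntegral.integral_mono_on ht ((cf.pow 2).intervalIntegrable _ _)
      (Continuous.intervalIntegrable (by fun_prop) _ _) fun s _ => ?_).trans (O.hA _ t ht)
    exact (hf s).trans (le_mul_of_one_le_left (by positivity) (w1 s))
  have rp' := rob _ _ _ A O.dp O.dp₁ ch (src _ ch fun s => by nlinarith [sq_nonneg (H s).im])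
    ((Complex.continuous_re.tendsto' 0 0 Complex.zero_re).comp lu)
    ((Complex.continuous_re.tendsto' 0 0 Complex.zero_re).comp lu')
  have rq' := rob _ _ _ A O.dq O.dq₁ cg (src _ cg fun s => by nlinarith [sq_nonneg (H s).re])
    ((Complex.continuous_im.tendsto' 0 0 Complex.zero_im).comp lu)
    ((Complex.continuous_im.tendsto' 0 0 Complex.zero_im).comp lu')
  have cφ := continuous_decayWeight hδ.1
  have fin := key _ _ _ _ _ _ _ _ _ _ _ _ _ _ _ _ _ _ _ (decayWeight δ) D O hθ rp' rq' cφ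
    (fun s => (decayWeight_pos s).le) decayWeight_le_one
    (fun a ha => integral_decayWeight_le hδ.1 hδ.2 (hσ.trans hs₁) ha)
  have cu : Continuous u := hu.continuous
  have cu' : Continuous (deriv u) := hu.continuous_deriv (by norm_num)
  calc _ ≤ ENNReal.ofReal (G * angFreq L ^ 2 * A) := by
        refine lintegral_Iic_le_of_intervalIntegral_le (f := fun s =>
          w s * ‖deriv u s + Complex.I * (ω : ℂ) * u s‖ ^ 2
          + decayWeight δ s * (‖deriv u s‖ ^ 2 + ‖u s‖ ^ 2)) (by fun_prop) (fun s => ?_) ?_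
        · have := (decayWeight_pos (δ := δ) s).le
          have := zero_le_one.trans (w1 s)
          positivity
        · simp only [sq_norm_add_I_mul]
          simpa only [sq_norm_eq] using fin
    _ = _ := by rw [ENNReal.ofReal_mul (by positivity), hA, ENNReal.ofReal_toReal hfin]
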